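/- There exists a constant c > 0 such that for every integer n ≥ 2 there exists a threshold M with the following property: for all integers m ≥ M, every non-homotopic drawing in the plane with n vertices and m edges has crossing number at least c·m²·(log m)^{1/(6n)}/n⁷. -/

import Mathlib

open unitInterval ENNReal

/-- A drawing in the plane with `n` vertices and `m` edges: a finite set `V ⊆ ℂ` of
`n` vertices together with continuous curves `f e : [0,1] → ℂ` whose endpoints are
vertices and whose interiors avoid the vertices. -/
structure PlaneDrawing (n m : ℕ) where
  V : Set ℂ
  finV : V.Finite
  cardV : V.ncard = n
  f : Fin m → I → ℂ
  cont : ∀ e, Continuous (f e)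
  source_mem : ∀ e, f e 0 ∈ V
  target_mem : ∀ e, f e 1 ∈ V
  interior_not_mem : ∀ e, ∀ t : I, t ≠ 0 → t ≠ 1 → f e t ∉ V

/-- Homotopy between two curves, fixing the endpoints of the first, with interior
avoiding the vertex set `V`. -/
def HomotopicIn (V : Set ℂ) (a b : I → ℂ) : Prop :=
  ∃ g : I × I → ℂ, Continuous g ∧
    (∀ t, g (0, t) = a t) ∧ (∀ t, g (1, t) = b t) ∧
    (∀ s, g (s, 0) = a 0) ∧ (∀ s, g (s, 1) = a 1) ∧
    (∀ s t : I, s ≠ 0 → s ≠ 1 → t ≠ 0 → t ≠ 1 → g (s, t) ∉ V)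

/-- Two edges are homotopic if one is homotopic to the other or to its reversal. -/
def EdgeHomotopic (V : Set ℂ) (a b : I → ℂ) : Prop :=
  HomotopicIn V a b ∨ HomotopicIn V (fun t => a (σ t)) b

/-- An edge is a trivial loop if it is homotopic to the constant map at its endpoint. -/
def IsTrivialLoop (V : Set ℂ) (a : I → ℂ) : Prop :=
  EdgeHomotopic V a fun _ => a 0

/-- A drawing is non-homotopic if no two distinct edges are homotopic and
no edge is a trivial loop. -/
def PlaneDrawing.NonHomotopic {n m : ℕ} (D : PlaneDrawing n m) : Prop :=
  (∀ e e' : Fin m, e ≠ e' → ¬ EdgeHomotopic D.V (D.f e) (D.f e')) ∧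
  (∀ e : Fin m, ¬ IsTrivialLoop D.V (D.f e))

/-- The crossing number: half the cardinality of the set of ordered crossings. -/
noncomputable def PlaneDrawing.crossingNumber {n m : ℕ} (D : PlaneDrawing n m) : ℝ≥0∞ :=
  (({p : (Fin m × I) × (Fin m × I) |
      p.1 ≠ p.2 ∧ p.1.2 ≠ 0 ∧ p.1.2 ≠ 1 ∧ p.2.2 ≠ 0 ∧ p.2.2 ≠ 1 ∧
      D.f p.1.1 p.1.2 = D.f p.2.1 p.2.2}).encard : ℝ≥0∞) / 2

section Logarithms

open Complex Set

theorem exists_continuous_log {A : Type*} [TopologicalSpace A] [SimplyConnectedSpace A]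
    [LocallyPathConnectedSpace A] {f : A → ℂ} (hf : Continuous f) (h0 : ∀ a, f a ≠ 0) :
    ∃ L : A → ℂ, Continuous L ∧ ∀ a, exp (L a) = f a := by
  obtain ⟨a₀⟩ : Nonempty A := PathConnectedSpace.nonempty
  obtain ⟨F, ⟨-, hF⟩, -⟩ := isCoveringMapOn_exp.existsUnique_continuousMap_lifts ⟨f, hf⟩
    (exp_log (h0 a₀)) (fun a => h0 a)
  exact ⟨F, F.continuous, fun a => congrFun hF a⟩

theorem exists_continuousOn_log_Icc {f : ℝ → ℂ} {a b : ℝ} (hab : a ≤ b)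
    (hf : ContinuousOn f (Icc a b)) (h0 : ∀ t ∈ Icc a b, f t ≠ 0) :
    ∃ L : ℝ → ℂ, Continuous L ∧ ∀ t ∈ Icc a b, exp (L t) = f t := by
  have hc : Continuous (fun t : ℝ => f (projIcc a b hab t)) :=
    (continuousOn_iff_continuous_domRestrict.1 hf).comp continuous_projIcc
  obtain ⟨L, hL, h⟩ := exists_continuous_log hc (fun t => h0 _ (projIcc a b hab t).2)
  refine ⟨L, hL, fun t ht => ?_⟩
  rw [h, projIcc_of_mem hab ht]

theorem exists_continuousOn_log_Icc_prod {f : ℝ × ℝ → ℂ} {a b c d : ℝ} (hab : a ≤ b) (hcd : c ≤ d)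
    (hf : ContinuousOn f (Icc a b ×ˢ Icc c d)) (h0 : ∀ t ∈ Icc a b ×ˢ Icc c d, f t ≠ 0) :
    ∃ L : ℝ × ℝ → ℂ, Continuous L ∧ ∀ t ∈ Icc a b ×ˢ Icc c d, exp (L t) = f t := by
  have hc : Continuous (fun t : ℝ × ℝ => f ((projIcc a b hab t.1 : ℝ), (projIcc c d hcd t.2 : ℝ))) :=
    hf.comp_continuous (by fun_prop)
      fun t => ⟨(projIcc a b hab t.1).2, (projIcc c d hcd t.2).2⟩
  obtain ⟨L, hL, h⟩ := exists_continuous_log hc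
    (fun t => h0 _ ⟨(projIcc a b hab t.1).2, (projIcc c d hcd t.2).2⟩)
  refine ⟨L, hL, fun t ht => ?_⟩
  rw [h, projIcc_of_mem hab ht.1, projIcc_of_mem hcd ht.2]

theorem exists_continuous_log_unitInterval {f : I → ℂ} (hf : Continuous f) (h0 : ∀ t, f t ≠ 0) :
    ∃ L : I → ℂ, Continuous L ∧ ∀ t, exp (L t) = f t := by
  obtain ⟨L, hL, h⟩ := exists_continuous_log (A := ℝ) (f := IccExtend zero_le_one f)
    hf.Icc_extend' (fun t => h0 _)
  exact ⟨fun t => L t, hL.comp continuous_subtype_val, fun t => by rw [h, IccExtend_val]⟩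

theorem sub_eq_sub_of_exp_eq {A : Type*} [TopologicalSpace A] {S : Set A} (hS : IsPreconnected S)
    {L L' : A → ℂ} (hL : ContinuousOn L S) (hL' : ContinuousOn L' S)
    (h : ∀ x ∈ S, exp (L x) = exp (L' x)) {x y : A} (hx : x ∈ S) (hy : y ∈ S) :
    L x - L y = L' x - L' y := by
  have key : (L x - L' x) / (2 * Real.pi * Complex.I) = (L y - L' y) / (2 * Real.pi * Complex.I) := by
    have hc : ContinuousOn (fun z => (L z - L' z) / (2 * Real.pi * Complex.I)) S := by fun_prop
    have hre : ContinuousOn (fun z => ((L z - L' z) / (2 * Real.pi * Complex.I)).re) S :=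
      continuous_re.comp_continuousOn hc
    have hint : ∀ z ∈ S, ∃ n : ℤ, (L z - L' z) / (2 * Real.pi * Complex.I) = n := by
      intro z hz
      obtain ⟨n, hn⟩ := exp_eq_exp_iff_exists_int.1 (h z hz)
      refine ⟨n, ?_⟩
      rw [hn]
      field_simp [Real.pi_ne_zero]
      ring
    obtain ⟨n, hn⟩ := hint x hx
    obtain ⟨k, hk⟩ := hint y hy
    rw [hn, hk]
    have := hS.constant_of_mapsTo (T := range ((↑) : ℤ → ℝ)) Int.isClosedEmbedding_coe_real.isEmbedding.isDiscrete_range hre (fun z hz => by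
      obtain ⟨n, hn⟩ := hint z hz
      exact ⟨n, by simp only [hn, intCast_re]⟩) hx hy
    simp only [hn, hk, intCast_re] at this
    exact_mod_cast this
  have hI : (2 * Real.pi * Complex.I : ℂ) ≠ 0 := by simp [Real.pi_ne_zero]
  have := (div_left_inj' hI).1 key
  linear_combination this

theorem abs_im_sub_lt_pi {A : Type*} [TopologicalSpace A] {S : Set A} (hS : IsPreconnected S)
    {L : A → ℂ} (hL : ContinuousOn L S) {w : A → ℂ} (hw : ∀ x ∈ S, exp (L x) = w x)
    {u : ℂ} (hu : ∀ x ∈ S, 0 < (w x * u).re) {x y : A} (hx : x ∈ S) (hy : y ∈ S) :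
    |(L x - L y).im| < Real.pi := by
  have hu0 : u ≠ 0 := by
    rintro rfl
    simpa using hu x hx
  have hcont : ContinuousOn w S := (continuous_exp.comp_continuousOn hL).congr fun z hz => (hw z hz).symm
  have hlog : ContinuousOn (fun z => Complex.log (w z * u)) S :=
    ContinuousOn.clog (by fun_prop) fun z hz => Or.inl (hu z hz)
  have e := sub_eq_sub_of_exp_eq hS (L := fun z => L z + Complex.log u) (hL.add continuousOn_const) hlog
    (fun z hz => by
      have hne : w z * u ≠ 0 := fun h => by have := hu z hz; simp [h] at this
      rw [exp_add, exp_log hu0, exp_log hne, hw z hz]) hx hy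
  have e2 : L x - L y = Complex.log (w x * u) - Complex.log (w y * u) := by linear_combination e
  rw [e2, sub_im, log_im, log_im]
  have h1 := abs_arg_lt_pi_div_two_iff.2 (Or.inl (hu x hx))
  have h2 := abs_arg_lt_pi_div_two_iff.2 (Or.inl (hu y hy))
  rw [abs_lt] at *
  constructor <;> linarith

end Logarithms

section Winding

open Complex Set

/-- `d` is the total variation of a continuous logarithm of `γ - c`. -/
def HasWinding (γ : I → ℂ) (c d : ℂ) : Prop :=
  ∃ L : I → ℂ, Continuous L ∧ (∀ t, exp (L t) = γ t - c) ∧ L 1 - L 0 = d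

variable {γ : I → ℂ} {c d d' : ℂ}

theorem exists_hasWinding (hγ : Continuous γ) (hc : ∀ t, γ t ≠ c) : ∃ d, HasWinding γ c d := by
  obtain ⟨L, hL, h⟩ := exists_continuous_log_unitInterval (f := fun t => γ t - c) (by fun_prop)
    (fun t => sub_ne_zero.2 (hc t))
  exact ⟨_, L, hL, h, rfl⟩

theorem HasWinding.unique (h : HasWinding γ c d) (h' : HasWinding γ c d') : d = d' := by
  obtain ⟨L, hL, h1, rfl⟩ := h
  obtain ⟨L', hL', h1', rfl⟩ := h'
  exact sub_eq_sub_of_exp_eq isPreconnected_univ hL.continuousOn hL'.continuousOn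
    (fun x _ => by rw [h1, h1']) (mem_univ _) (mem_univ _)

theorem HasWinding.exists_int (h : HasWinding γ c d) (hγ : γ 0 = γ 1) :
    ∃ k : ℤ, d = k * (2 * Real.pi * Complex.I) := by
  obtain ⟨L, hL, h1, rfl⟩ := h
  obtain ⟨n, hn⟩ := exp_eq_exp_iff_exists_int.1 (show exp (L 1) = exp (L 0) by rw [h1, h1, hγ])
  exact ⟨n, by rw [hn]; ring⟩

theorem HasWinding.of_joined {A : ℝ → ℂ} (hγc : Continuous γ) (hγ : γ 0 = γ 1) {a b : ℝ} (hab : a ≤ b)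
    (hA : ContinuousOn A (Icc a b)) (hAγ : ∀ s ∈ Icc a b, ∀ t, γ t ≠ A s)
    (h : HasWinding γ (A a) d) : HasWinding γ (A b) d := by
  obtain ⟨G, hG, hGe⟩ := exists_continuousOn_log_Icc_prod (zero_le_one' ℝ) hab
    (f := fun p : ℝ × ℝ => IccExtend zero_le_one γ p.1 - A p.2)
    (by
      refine ContinuousOn.sub (Continuous.continuousOn ?_) (hA.comp continuousOn_snd fun p hp => hp.2)
      exact hγc.Icc_extend'.comp continuous_fst)
    (by
      rintro ⟨t, s⟩ ⟨-, hs⟩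
      exact sub_ne_zero.2 (hAγ s hs _))
  have hw : ∀ s ∈ Icc a b, HasWinding γ (A s) (G (1, s) - G (0, s)) := fun s hs =>
    ⟨fun t => G (t, s), by fun_prop, fun t => by rw [hGe _ ⟨t.2, hs⟩, IccExtend_val], by simp⟩
  have hconst := sub_eq_sub_of_exp_eq (isPreconnected_Icc (a := a) (b := b)) (L := fun s => G (1, s))
    (L' := fun s => G (0, s)) (by fun_prop) (by fun_prop) (fun s hs => by
      rw [hGe _ ⟨by simp, hs⟩, hGe _ ⟨by simp, hs⟩]
      simp [hγ]) (right_mem_Icc.2 hab) (left_mem_Icc.2 hab)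
  have e := h.unique (hw a (left_mem_Icc.2 hab))
  have := hw b (right_mem_Icc.2 hab)
  rwa [show G (1, b) - G (0, b) = d by rw [e]; linear_combination hconst] at this

theorem HasWinding.of_norm_lt (hγc : Continuous γ) (hγ : γ 0 = γ 1) (hc : ∀ t, ‖γ t‖ < ‖c‖) :
    HasWinding γ c 0 := by
  have hc0 : c ≠ 0 := by
    rintro rfl
    simpa using (hc 0).trans_le' (norm_nonneg _)
  have hpos : ∀ t, 0 < (1 - γ t / c).re := by
    intro t
    have h1 : ‖γ t / c‖ < 1 := by
      rw [norm_div, div_lt_one (by positivity)]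
      exact hc t
    have := (re_le_norm (γ t / c)).trans_lt h1
    simp only [sub_re, one_re]
    linarith
  refine ⟨fun t => Complex.log (1 - γ t / c) + Complex.log (-c), ?_, fun t => ?_, by simp [hγ]⟩
  · refine Continuous.add (Continuous.clog (by fun_prop) fun t => Or.inl (hpos t)) continuous_const
  · have hne : 1 - γ t / c ≠ 0 := fun h => by have := hpos t; simp [h] at this
    rw [exp_add, exp_log hne, exp_log (neg_ne_zero.2 hc0)]
    field_simp
    ring

end Winding

section Exit

open Set

theorem exists_last_exit {φ : ℝ → ℝ} (hφ : Continuous φ) {a b ρ : ℝ} (hab : a ≤ b) (ha : ρ ≤ φ a)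
    (hb : φ b < ρ) :
    ∃ s ∈ Ico a b, φ s = ρ ∧ ∀ s' ∈ Ioc s b, φ s' < ρ := by
  have hne : (Icc a b ∩ {s | ρ ≤ φ s}).Nonempty := ⟨a, left_mem_Icc.2 hab, ha⟩
  obtain ⟨s, ⟨hs, hsρ⟩, hmax⟩ :=
    (isCompact_Icc.inter_right (isClosed_le continuous_const hφ)).exists_isGreatest hne
  have hlt : ∀ s' ∈ Ioc s b, φ s' < ρ := fun s' hs' => by
    by_contra! h
    exact absurd (hmax ⟨⟨hs.1.trans hs'.1.le, hs'.2⟩, h⟩) (not_le.2 hs'.1)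
  have hsb : s < b := lt_of_le_of_ne hs.2 (by rintro rfl; exact absurd hb (not_lt.2 hsρ))
  obtain ⟨s2, hs2, e⟩ := intermediate_value_Icc' hsb.le hφ.continuousOn ⟨hb.le, hsρ⟩
  rcases hs2.1.eq_or_lt with rfl | h
  · exact ⟨s, ⟨hs.1, hsb⟩, e, hlt⟩
  · exact absurd e (hlt s2 ⟨h, hs2.2⟩).ne

theorem exists_first_exit {φ : ℝ → ℝ} (hφ : Continuous φ) {a b ρ : ℝ} (hab : a ≤ b) (ha : φ a < ρ)
    (hb : ρ ≤ φ b) :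
    ∃ s ∈ Ioc a b, φ s = ρ ∧ ∀ s' ∈ Ico a s, φ s' < ρ := by
  obtain ⟨s, hs, e, h⟩ := exists_last_exit (φ := fun t => φ (-t)) (by fun_prop) (neg_le_neg hab)
    (by simpa using hb) (by simpa using ha)
  refine ⟨-s, ⟨by linarith [hs.2], by linarith [hs.1]⟩, e, fun s' hs' => ?_⟩
  simpa using h (-s') ⟨by linarith [hs'.2], by linarith [hs'.1]⟩

end Exit

section Jump

open Complex Set

theorem re_sub_mul_conj_pos {x y : ℂ} {ρ : ℝ} (hx : ‖x‖ = ρ) (hy : ‖y‖ ≤ ρ) (hne : y ≠ x) :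
    0 < ((y - x) * (starRingEnd ℂ) (-x)).re := by
  have h1 : ‖y - x‖ ^ 2 = ‖y‖ ^ 2 + ‖x‖ ^ 2 - 2 * (y * (starRingEnd ℂ) x).re := by
    rw [← normSq_eq_norm_sq, ← normSq_eq_norm_sq, ← normSq_eq_norm_sq, normSq_sub]
  have h2 : 0 < ‖y - x‖ ^ 2 := by
    have : 0 < ‖y - x‖ := norm_pos_iff.2 (sub_ne_zero.2 hne)
    positivity
  have h3 : ((y - x) * (starRingEnd ℂ) (-x)).re = ‖x‖ ^ 2 - (y * (starRingEnd ℂ) x).re := by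
    rw [← normSq_eq_norm_sq, normSq_apply]
    simp [mul_re]
    ring
  have h4 : ‖y‖ ^ 2 ≤ ρ ^ 2 := pow_le_pow_left₀ (norm_nonneg _) hy 2
  rw [h3, hx]
  rw [hx] at h1
  linarith

theorem abs_im_winding_sub_lt {κ A : ℝ → ℂ} (hκ : Continuous κ) (hA : Continuous A) {t₀ s₀ : ℝ}
    (ht₀ : t₀ ∈ Icc (0 : ℝ) 1) (hs₀ : s₀ ∈ Ioo (0 : ℝ) 1) (hloop : κ 0 = κ 1)
    (hx : κ t₀ = A s₀) (hne : κ 0 ≠ κ t₀)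
    (honly : ∀ t ∈ Icc (0 : ℝ) 1, ∀ s ∈ Icc (0 : ℝ) 1, κ t = A s → t = t₀ ∧ s = s₀)
    {d d' : ℂ} (h0 : HasWinding (fun t => κ t) (A 0) d)
    (h1 : HasWinding (fun t => κ t) (A 1) d') : |(d' - d).im| < 4 * Real.pi := by
  have hA0 : A 0 ≠ A s₀ := fun h => by
    have := (honly t₀ ht₀ 0 (by simp) (hx.trans h.symm)).2
    exact hs₀.1.ne this
  have hA1 : A 1 ≠ A s₀ := fun h => by
    have := (honly t₀ ht₀ 1 (by simp) (hx.trans h.symm)).2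
    exact hs₀.2.ne' this
  obtain ⟨ρ, hρ, hρ0, hρ1, hρκ⟩ : ∃ ρ : ℝ, 0 < ρ ∧ ρ ≤ ‖A 0 - A s₀‖ ∧ ρ ≤ ‖A 1 - A s₀‖ ∧
      ρ ≤ ‖κ 0 - κ t₀‖ :=
    ⟨min ‖A 0 - A s₀‖ (min ‖A 1 - A s₀‖ ‖κ 0 - κ t₀‖), by
      simp only [lt_min_iff, norm_pos_iff, sub_ne_zero]
      exact ⟨hA0, hA1, hne⟩, by simp, by simp, by simp⟩
  obtain ⟨sm, hsm, hsmρ, hsm'⟩ := exists_last_exit (φ := fun s => ‖A s - A s₀‖) (by fun_prop)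
    hs₀.1.le hρ0 (by simpa using hρ)
  obtain ⟨sp, hsp, hspρ, hsp'⟩ := exists_first_exit (φ := fun s => ‖A s - A s₀‖) (by fun_prop)
    hs₀.2.le (by simpa using hρ) hρ1
  obtain ⟨tm, htm, htmρ, htm'⟩ := exists_last_exit (φ := fun s => ‖κ s - κ t₀‖) (by fun_prop)
    ht₀.1 hρκ (by simpa using hρ)
  obtain ⟨tp, htp, htpρ, htp'⟩ := exists_first_exit (φ := fun s => ‖κ s - κ t₀‖) (by fun_prop)
    ht₀.2 (by simpa using hρ) (hloop ▸ hρκ)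
  have hAle : ∀ s ∈ Icc sm sp, ‖A s - A s₀‖ ≤ ρ := by
    intro s hs
    rcases le_total s s₀ with h | h
    · rcases hs.1.eq_or_lt with rfl | h'
      · exact hsmρ.le
      · exact (hsm' s ⟨h', h⟩).le
    · rcases hs.2.eq_or_lt with rfl | h'
      · exact hspρ.le
      · exact (hsp' s ⟨h, h'⟩).le
  have hκle : ∀ s ∈ Icc tm tp, ‖κ s - κ t₀‖ ≤ ρ := by
    intro s hs
    rcases le_total s t₀ with h | h
    · rcases hs.1.eq_or_lt with rfl | h'
      · exact htmρ.le
      · exact (htm' s ⟨h', h⟩).le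
    · rcases hs.2.eq_or_lt with rfl | h'
      · exact htpρ.le
      · exact (htp' s ⟨h, h'⟩).le
  have hnever : ∀ t ∈ Icc (0 : ℝ) 1, ∀ s ∈ Icc (0 : ℝ) 1, (t ≠ t₀ ∨ s ≠ s₀) → κ t - A s ≠ 0 := by
    intro t ht s hs h e
    have := honly t ht s hs (sub_eq_zero.1 e)
    tauto
  have sub1 : Icc sm sp ⊆ Icc 0 1 := Icc_subset_Icc hsm.1 hsp.2
  have sub2 : Icc tm tp ⊆ Icc 0 1 := Icc_subset_Icc htm.1 htp.2
  have hs : sm ≤ sp := hsm.2.le.trans hsp.1.le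
  have ht : tm ≤ tp := htm.2.le.trans htp.1.le
  -- transport the windings to the ends of the local arc
  have w0 : HasWinding (fun t => κ t) (A sm) d := h0.of_joined (by fun_prop) (by simpa using hloop)
    hsm.1 hA.continuousOn fun s hs t => sub_ne_zero.1
      (hnever t t.2 s ⟨hs.1, by linarith [hs.2, hsm.2, hs₀.2]⟩ (Or.inr (by linarith [hs.2, hsm.2] : s < s₀).ne))
  have w1 : HasWinding (fun t => κ t) (A sp) d' := by
    have := HasWinding.of_joined (A := fun s => A (-s)) (a := -1) (b := -sp) (by fun_prop)
      (by simpa using hloop) (by linarith [hsp.2]) (by fun_prop)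
      (fun s hs t => sub_ne_zero.1
        (hnever t t.2 (-s) ⟨by linarith [hs.2, hsp.1, hs₀.1], by linarith [hs.1]⟩
          (Or.inr (by linarith [hs.2, hsp.1] : s₀ < -s).ne')))
      (d := d') (by simpa using h1)
    simpa using this
  obtain ⟨La, hLa, hLae, rfl⟩ := w0
  obtain ⟨Lb, hLb, hLbe, rfl⟩ := w1
  obtain ⟨G, hG, hGe⟩ := exists_continuousOn_log_Icc_prod htm.1 hs
    (f := fun p => κ p.1 - A p.2) (by fun_prop)
    (fun p hp => hnever _ ⟨hp.1.1, by linarith [hp.1.2, htm.2, ht₀.2]⟩ _ (sub1 hp.2)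
      (Or.inl (by linarith [hp.1.2, htm.2] : p.1 < t₀).ne))
  obtain ⟨G', hG', hGe'⟩ := exists_continuousOn_log_Icc_prod htp.2 hs
    (f := fun p => κ p.1 - A p.2) (by fun_prop)
    (fun p hp => hnever _ ⟨by linarith [hp.1.1, htp.1, ht₀.1], hp.1.2⟩ _ (sub1 hp.2)
      (Or.inl (by linarith [hp.1.1, htp.1] : t₀ < p.1).ne'))
  have msm : sm ∈ Icc sm sp := left_mem_Icc.2 hs
  have msp : sp ∈ Icc sm sp := right_mem_Icc.2 hs
  have mtm : tm ∈ Icc tm tp := left_mem_Icc.2 ht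
  have mtp : tp ∈ Icc tm tp := right_mem_Icc.2 ht
  have m0 : (0 : ℝ) ∈ Icc 0 tm := left_mem_Icc.2 htm.1
  have m0' : tm ∈ Icc 0 tm := right_mem_Icc.2 htm.1
  have m1 : (1 : ℝ) ∈ Icc tp 1 := right_mem_Icc.2 htp.2
  have m1' : tp ∈ Icc tp 1 := left_mem_Icc.2 htp.2
  let La' := IccExtend zero_le_one La
  let Lb' := IccExtend zero_le_one Lb
  have hLa' : Continuous La' := hLa.Icc_extend'
  have hLb' : Continuous Lb' := hLb.Icc_extend'
  have ea : ∀ t ∈ Icc (0 : ℝ) 1, exp (La' t) = κ t - A sm := fun t ht => by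
    rw [show La' t = La ⟨t, ht⟩ from IccExtend_of_mem _ _ ht, hLae]
  have eb : ∀ t ∈ Icc (0 : ℝ) 1, exp (Lb' t) = κ t - A sp := fun t ht => by
    rw [show Lb' t = Lb ⟨t, ht⟩ from IccExtend_of_mem _ _ ht, hLbe]
  have i1 : Icc 0 tm ⊆ Icc (0 : ℝ) 1 := Icc_subset_Icc le_rfl (by linarith [htm.2, ht₀.2])
  have i2 : Icc tp 1 ⊆ Icc (0 : ℝ) 1 := Icc_subset_Icc (by linarith [htp.1, ht₀.1]) le_rfl
  have c1 := sub_eq_sub_of_exp_eq isPreconnected_Icc (L := La') (L' := fun t => G (t, sm))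
    hLa'.continuousOn (by fun_prop) (fun t ht => by rw [ea t (i1 ht), hGe _ ⟨ht, msm⟩]) m0' m0
  have c2 := sub_eq_sub_of_exp_eq isPreconnected_Icc (L := Lb') (L' := fun t => G (t, sp))
    hLb'.continuousOn (by fun_prop) (fun t ht => by rw [eb t (i1 ht), hGe _ ⟨ht, msp⟩]) m0' m0
  have c3 := sub_eq_sub_of_exp_eq isPreconnected_Icc (L := La') (L' := fun t => G' (t, sm))
    hLa'.continuousOn (by fun_prop) (fun t ht => by rw [ea t (i2 ht), hGe' _ ⟨ht, msm⟩]) m1 m1'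
  have c4 := sub_eq_sub_of_exp_eq isPreconnected_Icc (L := Lb') (L' := fun t => G' (t, sp))
    hLb'.continuousOn (by fun_prop) (fun t ht => by rw [eb t (i2 ht), hGe' _ ⟨ht, msp⟩]) m1 m1'
  have c5 := sub_eq_sub_of_exp_eq isPreconnected_Icc (L := fun s => G (0, s))
    (L' := fun s => G' (1, s)) (by fun_prop) (by fun_prop)
    (fun s hs => by rw [hGe _ ⟨m0, hs⟩, hGe' _ ⟨m1, hs⟩, hloop]) msp msm
  have hlocal : ∀ s ∈ Icc sm sp, ‖A s - A s₀‖ = ρ → s ≠ s₀ → ∀ t ∈ Icc tm tp,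
      0 < ((κ t - A s) * (starRingEnd ℂ) (-(A s - A s₀))).re := by
    intro s hs e hss t ht
    have := re_sub_mul_conj_pos e (y := κ t - A s₀) (hx ▸ hκle t ht)
      (fun h => hnever t (sub2 ht) s (sub1 hs) (Or.inr hss) (by linear_combination h))
    simpa using this
  have hlocal' : ∀ t ∈ Icc tm tp, ‖κ t - κ t₀‖ = ρ → t ≠ t₀ → ∀ s ∈ Icc sm sp,
      0 < ((κ t - A s) * (starRingEnd ℂ) (κ t - A s₀)).re := by
    intro t ht e htt s hs
    have := re_sub_mul_conj_pos (x := κ t - A s₀) (hx ▸ e) (y := A s - A s₀) (hAle s hs)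
      (fun h => hnever t (sub2 ht) s (sub1 hs) (Or.inl htt) (by linear_combination -h))
    have e2 : (κ t - A s) * (starRingEnd ℂ) (κ t - A s₀) =
      (A s - A s₀ - (κ t - A s₀)) * (starRingEnd ℂ) (-(κ t - A s₀)) := by
      rw [map_neg]; ring
    rwa [e2]
  have b1 := abs_im_sub_lt_pi isPreconnected_Icc (L := La') hLa'.continuousOn
    (fun t ht => ea t (sub2 ht)) (hlocal sm msm hsmρ hsm.2.ne) mtp mtm
  have b2 := abs_im_sub_lt_pi isPreconnected_Icc (L := Lb') hLb'.continuousOn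
    (fun t ht => eb t (sub2 ht)) (hlocal sp msp hspρ hsp.1.ne') mtp mtm
  have b3 := abs_im_sub_lt_pi isPreconnected_Icc (L := fun s => G (tm, s)) (by fun_prop)
    (fun s hs => hGe (tm, s) ⟨m0', hs⟩) (hlocal' tm mtm htmρ htm.2.ne) msp msm
  have b4 := abs_im_sub_lt_pi isPreconnected_Icc (L := fun s => G' (tp, s)) (by fun_prop)
    (fun s hs => hGe' (tp, s) ⟨m1', hs⟩) (hlocal' tp mtp htpρ htp.1.ne') msp msm
  have e0 : La 1 - La 0 = La' 1 - La' 0 := by simp [La']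
  have e1 : Lb 1 - Lb 0 = Lb' 1 - Lb' 0 := by simp [Lb']
  have hfinal : Lb 1 - Lb 0 - (La 1 - La 0) = (Lb' tp - Lb' tm) - (La' tp - La' tm) +
      (G (tm, sp) - G (tm, sm)) - (G' (tp, sp) - G' (tp, sm)) := by
    rw [e0, e1]
    linear_combination c2 + c4 - c1 - c3 - c5
  rw [hfinal]
  simp only [sub_im, add_im] at *
  rw [abs_lt] at *
  constructor <;> linarith

end Jump

section Push

open Complex Set Metric

theorem isPreconnected_polar {S : Set ℝ} (hS : IsPreconnected S) (hpos : ∀ r ∈ S, 0 < r) (q : ℂ) :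
    IsPreconnected {z : ℂ | ‖z - q‖ ∈ S} := by
  have : {z : ℂ | ‖z - q‖ ∈ S} = (fun p : ℝ × ℝ => q + p.1 * exp (p.2 * Complex.I)) '' (S ×ˢ univ) := by
    ext z
    constructor
    · intro hz
      refine ⟨(‖z - q‖, arg (z - q)), ⟨hz, mem_univ _⟩, ?_⟩
      simp only [norm_mul_exp_arg_mul_I]
      ring
    · rintro ⟨⟨r, θ⟩, ⟨hr, -⟩, rfl⟩
      simp only [mem_ofPred_eq, add_sub_cancel_left, norm_mul, norm_exp_ofReal_mul_I, norm_real,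
        Real.norm_eq_abs, mul_one]
      rwa [abs_of_pos (hpos r hr)]
  rw [this]
  exact (hS.prod isPreconnected_univ).image _ (by fun_prop)

theorem isPreconnected_diff_singleton {O : Set ℂ} (hO : IsOpen O) (hc : IsPreconnected O) (q : ℂ) :
    IsPreconnected (O \ {q}) := by
  by_cases hq : q ∈ O
  swap
  · rwa [sdiff_singleton_eq_self hq]
  obtain ⟨ρ, hρ, hB⟩ := Metric.isOpen_iff.1 hO q hq
  have hBc : IsPreconnected (ball q ρ \ {q}) := by
    convert isPreconnected_polar (S := Ioo 0 ρ) isPreconnected_Ioo (fun r hr => hr.1) q using 1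
    ext z
    simp [dist_eq_norm, and_comm, sub_eq_zero]
  have main : ∀ u v : Set ℂ, IsOpen u → IsOpen v → O \ {q} ⊆ u ∪ v → ((O \ {q}) ∩ v).Nonempty →
      ball q ρ \ {q} ⊆ u → ((O \ {q}) ∩ (u ∩ v)).Nonempty := by
    rintro u v hu hv hcov ⟨y, ⟨hyO, hyq⟩, hyv⟩ hBu
    have hs : IsOpen ({q}ᶜ : Set ℂ) := isOpen_compl_singleton
    obtain ⟨z, hzO, hz1, ⟨hz2, hz3⟩⟩ := hc (u ∪ ball q ρ) (v ∩ {q}ᶜ)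
      (hu.union isOpen_ball) (hv.inter hs)
      (by
        intro z hz
        by_cases hzq : z = q
        · exact Or.inl (Or.inr (hzq ▸ mem_ball_self hρ))
        · rcases hcov ⟨hz, hzq⟩ with h | h
          · exact Or.inl (Or.inl h)
          · exact Or.inr ⟨h, hzq⟩)
      ⟨q, hq, Or.inr (mem_ball_self hρ)⟩ ⟨y, hyO, hyv, hyq⟩
    refine ⟨z, ⟨hzO, hz3⟩, ?_, hz2⟩
    rcases hz1 with h | h
    · exact h
    · exact hBu ⟨h, hz3⟩
  rintro u v hu hv hcov hu' hv'
  by_contra hne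
  have h := isPreconnected_iff_subset_of_disjoint.1 hBc u v hu hv
    ((sdiff_subset_sdiff_left hB).trans hcov) (by
      rw [not_nonempty_iff_eq_empty] at hne
      exact subset_eq_empty (inter_subset_inter_left _ (sdiff_subset_sdiff_left hB)) hne)
  rcases h with h | h
  · exact hne (main u v hu hv hcov hv' h)
  · rw [inter_comm u v] at hne
    exact hne (main v u hv hu (by rwa [union_comm]) hu' h)

theorem isPreconnected_diff_finite {O Q : Set ℂ} (hO : IsOpen O) (hc : IsPreconnected O)
    (hQ : Q.Finite) : IsPreconnected (O \ Q) := by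
  induction Q, hQ using Set.Finite.induction_on with
  | empty => simpa
  | @insert a s _ hs ih =>
    have := isPreconnected_diff_singleton (hO.sdiff hs.isClosed) ih a
    rwa [sdiff_sdiff, union_singleton] at this

/-- A continuous self-map of the plane supported in `O`, with `y` the only point sent to `x`. -/
def CanMove (O : Set ℂ) (x y : ℂ) : Prop :=
  ∃ ψ : ℂ → ℂ, Continuous ψ ∧ (∀ z ∉ O, ψ z = z) ∧ (∀ z ∈ O, ψ z ∈ O) ∧ ∀ z, ψ z = x → z = y

theorem canMove_of_dist_lt {O : Set ℂ} {x y : ℂ} {r : ℝ} (hO : ball y r ⊆ O) (hxy : dist x y < r) :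
    CanMove O x y := by
  have hr : 0 < r := dist_nonneg.trans_lt hxy
  have hxy' : ‖x - y‖ < r := by rwa [← dist_eq_norm]
  let b : ℂ → ℝ := fun z => max 0 (1 - ‖z - y‖ / r)
  have hb0 : ∀ z, z ∉ ball y r → b z = 0 := by
    intro z hz
    rw [mem_ball, not_lt, dist_eq_norm] at hz
    have : 1 ≤ ‖z - y‖ / r := (one_le_div hr).2 hz
    exact max_eq_left (by linarith)
  have hb1 : ∀ z, z ∈ ball y r → b z = 1 - ‖z - y‖ / r ∧ 0 < b z := by
    intro z hz
    rw [mem_ball, dist_eq_norm] at hz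
    have : ‖z - y‖ / r < 1 := (div_lt_one hr).2 hz
    have e : b z = 1 - ‖z - y‖ / r := max_eq_right (by linarith)
    exact ⟨e, by rw [e]; linarith⟩
  have hball : ∀ z ∈ ball y r, z + b z * (x - y) ∈ ball y r := by
    intro z hz
    obtain ⟨e, h⟩ := hb1 z hz
    rw [mem_ball, dist_eq_norm] at hz ⊢
    calc ‖z + b z * (x - y) - y‖ = ‖(z - y) + b z * (x - y)‖ := by ring_nf
      _ ≤ ‖z - y‖ + b z * ‖x - y‖ := by
        refine (norm_add_le _ _).trans ?_
        rw [norm_mul, norm_real, Real.norm_eq_abs, abs_of_pos h]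
      _ < ‖z - y‖ + b z * r := by gcongr
      _ = r := by rw [e]; field_simp; ring
  refine ⟨fun z => z + b z * (x - y), by fun_prop, fun z hz => ?_, fun z hz => ?_, fun z hz => ?_⟩
  · simp [hb0 z fun h => hz (hO h)]
  · by_cases h : z ∈ ball y r
    · exact hO (hball z h)
    · simpa [hb0 z h] using hz
  · dsimp only at hz
    by_cases h : z ∈ ball y r
    · obtain ⟨e, h'⟩ := hb1 z h
      rw [mem_ball, dist_eq_norm] at h
      by_contra hne
      have hpos : 0 < ‖z - y‖ := norm_pos_iff.2 (sub_ne_zero.2 hne)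
      have e1 : z - y = (1 - b z : ℝ) * (x - y) := by
        push_cast
        linear_combination hz
      have e2 : ‖z - y‖ = ‖z - y‖ / r * ‖x - y‖ := by
        conv_lhs => rw [e1, norm_mul, norm_real, Real.norm_eq_abs, e,
          show 1 - (1 - ‖z - y‖ / r) = ‖z - y‖ / r by ring, abs_of_nonneg (by positivity)]
      have : ‖z - y‖ / r * ‖x - y‖ < ‖z - y‖ / r * r := by gcongr
      rw [← e2, div_mul_cancel₀ _ hr.ne'] at this
      exact lt_irrefl _ this
    · rw [hb0 z h] at hz
      exact absurd (by rw [mem_ball]; rw [← hz] at hxy; simpa using hxy) h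

theorem CanMove.trans {O : Set ℂ} {x y z : ℂ} (h : CanMove O x y) (h' : CanMove O y z) :
    CanMove O x z := by
  obtain ⟨ψ, h1, h2, h3, h4⟩ := h
  obtain ⟨ψ', h1', h2', h3', h4'⟩ := h'
  refine ⟨fun z => ψ (ψ' z), by fun_prop, fun z hz => ?_, fun z hz => h3 _ (h3' _ hz), fun z hz => ?_⟩
  · dsimp only
    rw [h2' z hz, h2 z hz]
  · exact h4' _ (h4 _ hz)

theorem IsPreconnected.canMove {O : Set ℂ} (hO : IsOpen O) (hc : IsPreconnected O) {x y : ℂ}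
    (hx : x ∈ O) (hy : y ∈ O) : CanMove O x y := by
  refine hc.induction₂' (CanMove O) (fun x hx => ?_) (fun x y z _ _ _ => CanMove.trans) hx hy
  obtain ⟨r, hr, hB⟩ := Metric.isOpen_iff.1 hO x hx
  have : ball x (r / 2) ∈ nhdsWithin x O := mem_nhdsWithin_of_mem_nhds (ball_mem_nhds x (by linarith))
  filter_upwards [this] with y hy
  refine ⟨canMove_of_dist_lt (r := r / 2) (fun z hz => hB ?_) ?_, canMove_of_dist_lt hB ?_⟩
  · rw [mem_ball] at *
    linarith [dist_triangle z y x]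
  · rw [mem_ball, dist_comm] at hy
    exact hy
  · rw [mem_ball] at hy
    linarith

theorem exists_push {Γ U : Set ℂ} {W : Set ℂ} (hW : W.Finite)
    (hWU : ∀ w ∈ W, w ∈ U ∨ ∃ O : Set ℂ, IsOpen O ∧ IsPreconnected O ∧ w ∈ O ∧ Disjoint O Γ ∧
      (O ∩ U).Infinite) :
    ∃ ψ : ℂ → ℂ, Continuous ψ ∧ (∀ z ∈ Γ, ψ z = z) ∧ ∀ z, ψ z ∈ W → z ∈ U := by
  induction h : (W \ U).ncard generalizing W with
  | zero =>
    rw [ncard_eq_zero (hW.subset sdiff_subset), sdiff_eq_empty] at h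
    exact ⟨id, continuous_id, fun _ _ => rfl, fun z hz => h hz⟩
  | succ k ih =>
    obtain ⟨w, hwW, hwU⟩ : (W \ U).Nonempty := by
      rw [nonempty_iff_ne_empty]
      intro h0
      simp [h0] at h
    obtain ⟨O, hO, hOc, hwO, hOΓ, hinf⟩ := (hWU w hwW).resolve_left hwU
    obtain ⟨w', ⟨hw'O, hw'U⟩, hw'W⟩ := hinf.exists_notMem_finite hW
    have hO' : IsOpen (O \ (W \ {w})) := hO.sdiff (hW.subset sdiff_subset).isClosed
    obtain ⟨ψ, h1, h2, h3, h4⟩ := (isPreconnected_diff_finite hO hOc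
      (hW.subset (sdiff_subset (t := {w})))).canMove hO' (x := w) (y := w') ⟨hwO, by simp⟩
      ⟨hw'O, fun h => hw'W h.1⟩
    have hW' : (insert w' (W \ {w})).Finite := (hW.subset sdiff_subset).insert _
    have hcard : (insert w' (W \ {w}) \ U).ncard = k := by
      have e : insert w' (W \ {w}) \ U = (W \ U) \ {w} := by
        ext z
        simp only [mem_sdiff, mem_insert_iff, mem_singleton_iff]
        constructor
        · rintro ⟨rfl | h, h'⟩
          · exact absurd hw'U h'
          · exact ⟨⟨h.1, h'⟩, h.2⟩
        · rintro ⟨⟨h, h'⟩, h''⟩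
          exact ⟨Or.inr ⟨h, h''⟩, h'⟩
      have hmem : w ∈ W \ U := ⟨hwW, hwU⟩
      rw [e, ncard_sdiff_singleton_of_mem hmem, h]
      simp
    obtain ⟨ψ', h1', h2', h3'⟩ := ih hW' (by
      rintro v (rfl | hv)
      · exact Or.inl hw'U
      · exact hWU v hv.1) hcard
    refine ⟨fun z => ψ (ψ' z), by fun_prop, fun z hz => ?_, fun z hz => h3' z ?_⟩
    · dsimp only
      rw [h2' z hz, h2 z fun h => disjoint_left.1 hOΓ h.1 hz]
    · dsimp only at hz
      by_cases hv : ψ (ψ' z) = w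
      · exact Or.inl (h4 _ hv)
      · right
        have hmem : ψ (ψ' z) ∈ W \ {w} := ⟨hz, hv⟩
        by_cases hO'' : ψ' z ∈ O \ (W \ {w})
        · exact absurd hmem (h3 _ hO'').2
        · rwa [h2 _ hO''] at hmem

end Push

section Homotopy

open Complex Set Metric

theorem Path.Homotopic.of_continuous {X : Type*} [TopologicalSpace X] {x y : X} {p q : Path x y}
    (H : I × I → X) (hH : Continuous H) (h0 : ∀ t, H (0, t) = p t) (h1 : ∀ t, H (1, t) = q t)
    (hx : ∀ s, H (s, 0) = x) (hy : ∀ s, H (s, 1) = y) : p.Homotopic q :=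
  ⟨{ toFun := H
     continuous_toFun := hH
     map_zero_left := h0
     map_one_left := h1
     prop' := by
      rintro s t (rfl | rfl)
      · simp [hx]
      · simp [hy] }⟩

variable {V : Set ℂ} {x y : ↥Vᶜ}

/-- The planar points lying on one of two paths. -/
def pathsRange (p q : Path x y) : Set ℂ := range (fun t => (p t : ℂ)) ∪ range (fun t => (q t : ℂ))

theorem isClosed_pathsRange (p q : Path x y) : IsClosed (pathsRange p q) :=
  ((isCompact_range (by fun_prop)).union (isCompact_range (by fun_prop))).isClosed

/-- `w` is joined off the paths `p`, `q` to arbitrarily remote points. -/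
def JoinedFar (Γ : Set ℂ) (w : ℂ) : Prop :=
  ∃ T : Set ℂ, IsPreconnected T ∧ w ∈ T ∧ Disjoint T Γ ∧ ∃ z ∈ T, ∀ z' ∈ Γ, ‖z'‖ < ‖z‖

theorem exists_component {Γ T : Set ℂ} (hΓ : IsClosed Γ) (hT : IsPreconnected T) (hd : Disjoint T Γ)
    {w : ℂ} (hw : w ∈ T) :
    ∃ O : Set ℂ, IsOpen O ∧ IsPreconnected O ∧ Disjoint O Γ ∧ T ⊆ O ∧
      ∀ T', IsPreconnected T' → Disjoint T' Γ → (T' ∩ O).Nonempty → T' ⊆ O := by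
  have hwΓ : w ∈ Γᶜ := disjoint_left.1 hd hw
  refine ⟨connectedComponentIn Γᶜ w, hΓ.isOpen_compl.connectedComponentIn,
    isPreconnected_connectedComponentIn, ?_, ?_, ?_⟩
  · exact disjoint_compl_left.mono_left (connectedComponentIn_subset _ _)
  · exact hT.subset_connectedComponentIn hw (disjoint_left.1 hd)
  · rintro T' hT' hd' ⟨z, hz, hz'⟩
    rw [connectedComponentIn_eq hz']
    exact hT'.subset_connectedComponentIn hz (disjoint_left.1 hd')

theorem infinite_of_joinedFar {Γ : Set ℂ} (hΓ : IsClosed Γ) {w : ℂ} (h : JoinedFar Γ w) (R : ℝ) :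
    ∃ O : Set ℂ, IsOpen O ∧ IsPreconnected O ∧ w ∈ O ∧ Disjoint O Γ ∧
      (O ∩ {z | R < ‖z‖}).Infinite := by
  obtain ⟨T, hT, hw, hd, z, hz, hfar⟩ := h
  obtain ⟨O, hO, hOc, hOΓ, hTO, hmax⟩ := exists_component hΓ hT hd hw
  refine ⟨O, hO, hOc, hTO hw, hOΓ, ?_⟩
  have hsub : {z' : ℂ | ‖z'‖ ∈ Ici ‖z‖ ∩ Ioi 0} ⊆ O ∪ {0} ∨ z = 0 := by
    by_cases h0 : z = 0
    · exact Or.inr h0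
    left
    have := hmax {z' : ℂ | ‖z' - 0‖ ∈ Ici ‖z‖}
      (isPreconnected_polar isPreconnected_Ici (fun r hr => (norm_pos_iff.2 h0).trans_le hr) 0)
      (disjoint_left.2 fun z' h1 h2 => absurd (hfar z' h2) (by simpa using h1)) ⟨z, by simp, hTO hz⟩
    intro z' hz'
    exact Or.inl (this (by simpa using hz'.1))
  obtain ⟨z1, hz1, hz1'⟩ : ∃ z1 ∈ O, R < ‖z1‖ := by
    rcases hsub with h | h
    · let M := max ‖z‖ (max R 0) + 1
      have hM0 : 0 < M := by positivity
      have hn : ‖(M : ℂ)‖ = M := by rw [norm_real, Real.norm_eq_abs, abs_of_pos hM0]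
      have hMz : ‖z‖ ≤ M := (le_max_left _ _).trans (lt_add_one _).le
      have hMR : R < M := (lt_add_one R).trans_le
        (add_le_add (((le_max_left R 0).trans (le_max_right ‖z‖ _))) le_rfl)
      refine ⟨M, ?_, by rwa [hn]⟩
      rcases h (show ‖(M : ℂ)‖ ∈ Ici ‖z‖ ∩ Ioi 0 by rw [hn]; exact ⟨hMz, hM0⟩) with h' | h'
      · exact h'
      · simp only [mem_singleton_iff, Complex.ofReal_eq_zero] at h'
        exact absurd h' hM0.ne'
    · have hΓe : Γ = ∅ := eq_empty_iff_forall_notMem.2 fun z' h' =>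
        absurd (hfar z' h') (by simp [h])
      have := hmax univ isPreconnected_univ (by simp [hΓe]) ⟨w, mem_univ _, hTO hw⟩
      refine ⟨((|R| + 1 : ℝ) : ℂ), this (mem_univ _), ?_⟩
      rw [norm_real, Real.norm_eq_abs, abs_of_nonneg (by positivity)]
      linarith [le_abs_self R]
  exact infinite_of_mem_nhds z1 ((hO.inter (isOpen_lt continuous_const continuous_norm)).mem_nhds
    ⟨hz1, hz1'⟩)

theorem homotopic_of_joinedFar (hV : V.Finite) (p q : Path x y)
    (hfar : ∀ w ∈ V, JoinedFar (pathsRange p q) w) : p.Homotopic q := by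
  have hΓ := isClosed_pathsRange p q
  obtain ⟨R, hR⟩ : ∃ R, ∀ z ∈ pathsRange p q, ‖z‖ < R := by
    have hc : IsCompact (pathsRange p q) :=
      (isCompact_range (by fun_prop)).union (isCompact_range (by fun_prop))
    obtain ⟨R, hR⟩ := hc.isBounded.exists_norm_le
    exact ⟨R + 1, fun z hz => (hR z hz).trans_lt (lt_add_one R)⟩
  obtain ⟨ψ, h1, h2, h3⟩ := exists_push (Γ := pathsRange p q) (U := {z | R < ‖z‖}) hV
    (fun w hw => Or.inr (infinite_of_joinedFar hΓ (hfar w hw) R))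
  have hp : ∀ t, (p t : ℂ) ∈ pathsRange p q := fun t => Or.inl ⟨t, rfl⟩
  have hq : ∀ t, (q t : ℂ) ∈ pathsRange p q := fun t => Or.inr ⟨t, rfl⟩
  let H : I × I → ℂ := fun z => ((1 - z.1 : ℝ) : ℂ) * p z.2 + ((z.1 : ℝ) : ℂ) * q z.2
  have hH : Continuous H := by fun_prop
  have hHR : ∀ z, ‖H z‖ ≤ R := by
    intro z
    have hz := z.1.2
    calc ‖H z‖ ≤ (1 - z.1) * ‖(p z.2 : ℂ)‖ + z.1 * ‖(q z.2 : ℂ)‖ := by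
          refine (norm_add_le _ _).trans_eq ?_
          rw [norm_mul, norm_mul, norm_real, norm_real, Real.norm_eq_abs, Real.norm_eq_abs,
            abs_of_nonneg hz.1, abs_of_nonneg (sub_nonneg.2 hz.2)]
      _ ≤ (1 - z.1) * R + z.1 * R :=
          add_le_add (mul_le_mul_of_nonneg_left (hR _ (hp z.2)).le (sub_nonneg.2 hz.2))
            (mul_le_mul_of_nonneg_left (hR _ (hq z.2)).le hz.1)
      _ = R := by ring
  refine Path.Homotopic.of_continuous (fun z => ⟨ψ (H z), fun hz => ?_⟩) (by fun_prop) ?_ ?_ ?_ ?_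
  · exact absurd (h3 _ hz) (not_lt.2 (hHR z))
  · intro t
    ext
    simp [H, h2 _ (hp t)]
  · intro t
    ext
    simp [H, h2 _ (hq t)]
  · intro s
    ext
    have e : H (s, 0) = p 0 := by simp [H]; ring
    simp only [e, h2 _ (hp 0)]
    simp
  · intro s
    ext
    have e : H (s, 1) = p 1 := by simp [H]; ring
    simp only [e, h2 _ (hp 1)]
    simp

theorem homotopic_of_hasWinding (hV : V.Finite) (p q : Path x y) {c d : ℂ}
    (hV' : ∀ w ∈ V, JoinedFar (pathsRange p q) w ∨
      ∃ T : Set ℂ, IsPreconnected T ∧ w ∈ T ∧ c ∈ T ∧ Disjoint T (pathsRange p q))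
    (hp : HasWinding (fun t => (p t : ℂ)) c d) (hq : HasWinding (fun t => (q t : ℂ)) c d) :
    p.Homotopic q := by
  have hΓ := isClosed_pathsRange p q
  obtain ⟨L, hL, hLe, rfl⟩ := hp
  obtain ⟨L', hL', hLe', hd⟩ := hq
  obtain ⟨k, hk⟩ : ∃ k : ℂ, exp k = 1 ∧ L' 0 + k = L 0 :=
    ⟨L 0 - L' 0, by
      have hne : (x : ℂ) - c ≠ 0 := by
        have := hLe 0
        simp only [Path.source] at this
        rw [← this]
        exact exp_ne_zero _
      rw [exp_sub, hLe, hLe']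
      simp [div_self hne], by ring⟩
  let M : I × I → ℂ := fun z => ((1 - z.1 : ℝ) : ℂ) * L z.2 + ((z.1 : ℝ) : ℂ) * (L' z.2 + k)
  have hM : Continuous M := by fun_prop
  obtain ⟨B, hB⟩ : ∃ B, ∀ z, ‖M z‖ ≤ B := by
    obtain ⟨B, hB⟩ := (isCompact_range hM).isBounded.exists_norm_le
    exact ⟨B, fun z => hB _ ⟨z, rfl⟩⟩
  let H : I × I → ℂ := fun z => c + exp (M z)
  have hH : Continuous H := by fun_prop
  have hlow : ∀ z, Real.exp (-B) ≤ ‖H z - c‖ := by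
    intro z
    simp only [H, add_sub_cancel_left, norm_exp, Real.exp_le_exp]
    linarith [(abs_le.1 ((abs_re_le_norm (M z)).trans (hB z))).1]
  have hup : ∀ z, ‖H z‖ ≤ ‖c‖ + Real.exp B := by
    intro z
    refine (norm_add_le _ _).trans (add_le_add le_rfl ?_)
    rw [norm_exp, Real.exp_le_exp]
    exact (re_le_norm _).trans (hB z)
  let R' := ‖c‖ + Real.exp B
  have hc0 : 0 < Real.exp (-B) := Real.exp_pos _
  obtain ⟨ψ, h1, h2, h3⟩ := exists_push (Γ := pathsRange p q)
    (U := {z | R' < ‖z‖} ∪ ball c (Real.exp (-B))) hV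
    (fun w hw => by
      right
      rcases hV' w hw with h | ⟨T, hT, hwT, hcT, hd⟩
      · obtain ⟨O, a1, a2, a3, a4, a5⟩ := infinite_of_joinedFar hΓ h R'
        exact ⟨O, a1, a2, a3, a4, a5.mono (inter_subset_inter_right _ subset_union_left)⟩
      · obtain ⟨O, hO, hOc, hOΓ, hTO, -⟩ := exists_component hΓ hT hd hwT
        refine ⟨O, hO, hOc, hTO hwT, hOΓ, ?_⟩
        refine (infinite_of_mem_nhds c ((hO.inter isOpen_ball).mem_nhds
          ⟨hTO hcT, mem_ball_self hc0⟩)).mono (inter_subset_inter_right _ subset_union_right))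
  have hp : ∀ t, (p t : ℂ) ∈ pathsRange p q := fun t => Or.inl ⟨t, rfl⟩
  have hq : ∀ t, (q t : ℂ) ∈ pathsRange p q := fun t => Or.inr ⟨t, rfl⟩
  have e0 : ∀ t, H (0, t) = p t := fun t => by simp [H, M, hLe]
  have e1 : ∀ t, H (1, t) = q t := fun t => by simp [H, M, exp_add, hk.1, hLe']
  have e2 : ∀ s, H (s, 0) = p 0 := fun s => by
    rw [← e0]
    simp only [H, M, hk.2]
    congr 2
    push_cast
    simp
    ring
  have e3 : ∀ s, H (s, 1) = p 1 := fun s => by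
    have : L' 1 + k = L 1 := by linear_combination hd + hk.2
    rw [← e0]
    simp only [H, M, this]
    congr 2
    push_cast
    simp
    ring
  refine Path.Homotopic.of_continuous (fun z => ⟨ψ (H z), fun hz => ?_⟩) (by fun_prop) ?_ ?_ ?_ ?_
  · rcases h3 _ hz with h | h
    · exact absurd (h.trans_le (hup z)) (not_lt.2 (le_rfl))
    · rw [mem_ball, dist_eq_norm] at h
      exact absurd h (not_lt.2 (hlow z))
  · intro t
    ext
    simp [e0, h2 _ (hp t)]
  · intro t
    ext
    simp [e1, h2 _ (hq t)]
  · intro s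
    ext
    simp only [e2, h2 _ (hp 0)]
    simp
  · intro s
    ext
    simp only [e3, h2 _ (hp 1)]
    simp

end Homotopy

section Tree

open Set Metric

/-- The function `z ↦ (z - z₁) / (z - z₂)` has a continuous logarithm on `T`, for all `z₁, z₂ ∉ T`. -/
def HasLogs (T : Set ℂ) : Prop :=
  ∀ z₁ ∉ T, ∀ z₂ ∉ T, ∃ L : ℂ → ℂ, ContinuousOn L T ∧ ∀ z ∈ T, Complex.exp (L z) = (z - z₁) / (z - z₂)

/-- The complement of the open disc of radius `R` about the origin. -/
def far (R : ℝ) : Set ℂ := {z | R ≤ ‖z‖}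

theorem isClosed_far (R : ℝ) : IsClosed (far R) := isClosed_le continuous_const continuous_norm

theorem isPreconnected_far {R : ℝ} (hR : 0 < R) : IsPreconnected (far R) := by
  have := isPreconnected_polar (S := Ici R) isPreconnected_Ici (fun r hr => hR.trans_le hr) 0
  simpa [far] using this

theorem one_sub_div_mem_slitPlane {z w : ℂ} (h : ‖w‖ < ‖z‖) : 1 - w / z ∈ Complex.slitPlane := by
  rw [sub_eq_add_neg]
  refine Complex.mem_slitPlane_of_norm_lt_one ?_
  rw [norm_neg, norm_div]
  exact (div_lt_one ((norm_nonneg w).trans_lt h)).2 h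

theorem hasLogs_far (R : ℝ) : HasLogs (far R) := by
  intro z₁ h₁ z₂ h₂
  have h₁' : ∀ z ∈ far R, ‖z₁‖ < ‖z‖ := fun z hz => (not_le.1 h₁).trans_le hz
  have h₂' : ∀ z ∈ far R, ‖z₂‖ < ‖z‖ := fun z hz => (not_le.1 h₂).trans_le hz
  have h0 : ∀ z ∈ far R, z ≠ 0 := fun z hz => norm_pos_iff.1 ((norm_nonneg _).trans_lt (h₁' z hz))
  refine ⟨fun z => Complex.log (1 - z₁ / z) - Complex.log (1 - z₂ / z), ?_, fun z hz => ?_⟩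
  · refine ContinuousOn.sub (ContinuousOn.clog ?_ fun z hz => one_sub_div_mem_slitPlane (h₁' z hz))
      (ContinuousOn.clog ?_ fun z hz => one_sub_div_mem_slitPlane (h₂' z hz)) <;>
    exact continuousOn_const.sub (continuousOn_const.div continuousOn_id h0)
  · have := h0 z hz
    rw [Complex.exp_sub, Complex.exp_log (Complex.slitPlane_ne_zero (one_sub_div_mem_slitPlane (h₁' z hz))),
      Complex.exp_log (Complex.slitPlane_ne_zero (one_sub_div_mem_slitPlane (h₂' z hz)))]
    rw [one_sub_div this, one_sub_div this, div_div_div_cancel_right₀ this]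

theorem continuousOn_invFunOn_Icc {a : ℝ → ℂ} (ha : Continuous a) (hinj : InjOn a (Icc 0 1)) :
    ContinuousOn (Function.invFunOn a (Icc 0 1)) (a '' Icc 0 1) := by
  rw [continuousOn_iff_isClosed]
  intro t ht
  refine ⟨a '' (t ∩ Icc 0 1), ((isCompact_Icc.inter_left ht).image ha).isClosed, ?_⟩
  ext z
  constructor
  · rintro ⟨h, x, hx, rfl⟩
    refine ⟨⟨x, ⟨?_, hx⟩, rfl⟩, x, hx, rfl⟩
    rwa [mem_preimage, hinj.leftInvOn_invFunOn hx] at h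
  · rintro ⟨⟨x, ⟨hxt, hx⟩, rfl⟩, -⟩
    exact ⟨by rwa [mem_preimage, hinj.leftInvOn_invFunOn hx], x, hx, rfl⟩

theorem HasLogs.union_arc {T : Set ℂ} (hT : IsClosed T) (h : HasLogs T) {a : ℝ → ℂ} (ha : Continuous a)
    (hinj : InjOn a (Icc 0 1)) (h1 : a 1 ∈ T) (hd : ∀ t ∈ Ico (0 : ℝ) 1, a t ∉ T) :
    HasLogs (T ∪ a '' Icc 0 1) := by
  classical
  intro z₁ hz₁ z₂ hz₂
  obtain ⟨L, hL, hLe⟩ := h z₁ (fun h => hz₁ (Or.inl h)) z₂ (fun h => hz₂ (Or.inl h))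
  have hne : ∀ t ∈ Icc (0 : ℝ) 1, a t - z₁ ≠ 0 ∧ a t - z₂ ≠ 0 := fun t ht =>
    ⟨sub_ne_zero.2 fun h => hz₁ (Or.inr ⟨t, ht, h⟩), sub_ne_zero.2 fun h => hz₂ (Or.inr ⟨t, ht, h⟩)⟩
  obtain ⟨l, hl, hle⟩ := exists_continuousOn_log_Icc (f := fun t => (a t - z₁) / (a t - z₂)) zero_le_one
    (ContinuousOn.div (by fun_prop) (by fun_prop) fun t ht => (hne t ht).2)
    (fun t ht => div_ne_zero (hne t ht).1 (hne t ht).2)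
  have h11 : (1 : ℝ) ∈ Icc (0 : ℝ) 1 := right_mem_Icc.2 zero_le_one
  have hc : Complex.exp (L (a 1) - l 1) = 1 := by
    rw [Complex.exp_sub, hLe _ h1, hle 1 h11, div_self]
    exact div_ne_zero (hne 1 h11).1 (hne 1 h11).2
  let g : ℂ → ℂ := fun z => l (Function.invFunOn a (Icc 0 1) z) + (L (a 1) - l 1)
  have hg : ∀ t ∈ Icc (0 : ℝ) 1, g (a t) = l t + (L (a 1) - l 1) := fun t ht => by
    simp only [g, hinj.leftInvOn_invFunOn ht]
  have hagree : ∀ z ∈ T, z ∈ a '' Icc 0 1 → L z = g z := by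
    rintro _ hz ⟨t, ht, rfl⟩
    obtain rfl : t = 1 := by
      by_contra hne
      exact hd t ⟨ht.1, lt_of_le_of_ne ht.2 hne⟩ hz
    rw [hg 1 ht]; ring
  have hgT : ∀ z ∈ a '' Icc 0 1, T.piecewise L g z = g z := by
    intro z hz
    by_cases h : z ∈ T
    · rw [piecewise_eq_of_mem _ _ _ h, hagree z h hz]
    · rw [piecewise_eq_of_notMem _ _ _ h]
  refine ⟨T.piecewise L g, ?_, ?_⟩
  · refine ContinuousOn.union_of_isClosed ?_ ?_ hT (isCompact_Icc.image ha).isClosed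
    · exact hL.congr fun z hz => piecewise_eq_of_mem _ _ _ hz
    · refine ContinuousOn.congr ?_ hgT
      exact (hl.comp_continuousOn (continuousOn_invFunOn_Icc ha hinj)).add continuousOn_const
  · rintro z (hz | hz)
    · rw [piecewise_eq_of_mem _ _ _ hz, hLe z hz]
    · rw [hgT z hz]
      obtain ⟨t, ht, rfl⟩ := hz
      rw [hg t ht, Complex.exp_add, hc, mul_one, hle t ht]

theorem HasLogs.isPreconnected_compl {T : Set ℂ} {R : ℝ} (hT : IsClosed T) (hfar : far R ⊆ T)
    (h : HasLogs T) : IsPreconnected Tᶜ := by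
  classical
  by_contra hcon
  obtain ⟨z₁, hz₁, z₂, hz₂, hz⟩ : ∃ z₁ ∈ Tᶜ, ∃ z₂ ∈ Tᶜ, z₂ ∉ connectedComponentIn Tᶜ z₁ := by
    by_contra! hall
    refine hcon (isPreconnected_of_forall_pair fun x hx y hy => ?_)
    exact ⟨connectedComponentIn Tᶜ x, connectedComponentIn_subset _ _, mem_connectedComponentIn hx,
      hall x hx y hy, isPreconnected_connectedComponentIn⟩
  set O := connectedComponentIn Tᶜ z₁ with hO
  have hOo : IsOpen O := hT.isOpen_compl.connectedComponentIn
  have hz₁O : z₁ ∈ O := mem_connectedComponentIn hz₁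
  have hOT : O ⊆ Tᶜ := connectedComponentIn_subset _ _
  have hfr : ∀ z ∈ frontier O, z ∈ T := by
    intro z hz
    by_contra hzT
    have hzc : z ∈ closure O := frontier_subset_closure hz
    have hzO : z ∉ O := by rw [hOo.frontier_eq] at hz; exact hz.2
    have ho : IsOpen (connectedComponentIn Tᶜ z) := hT.isOpen_compl.connectedComponentIn
    obtain ⟨y, hy, hy'⟩ := mem_closure_iff.1 hzc _ ho (mem_connectedComponentIn hzT)
    apply hzO
    rw [hO, connectedComponentIn_eq hy', ← connectedComponentIn_eq hy]
    exact mem_connectedComponentIn hzT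
  obtain ⟨L₀, hL₀, hL₀e⟩ := h z₁ hz₁ z₂ hz₂
  obtain ⟨L, hL⟩ := ContinuousMap.exists_restrict_eq hT ⟨T.domRestrict L₀, hL₀.domRestrict⟩
  have hLT : ∀ z ∈ T, Complex.exp (L z) = (z - z₁) / (z - z₂) := fun z hz => by
    rw [← hL₀e z hz]
    exact congrArg Complex.exp (DFunLike.congr_fun hL ⟨z, hz⟩)
  let H : ℂ → ℂ := fun z => if z ∈ O then (z - z₂) * Complex.exp (L z) else z - z₁
  have hHT : ∀ z ∈ T, (z - z₂) * Complex.exp (L z) = z - z₁ := fun z hz => by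
    rw [hLT z hz, mul_div_cancel₀]
    exact sub_ne_zero.2 fun h => hz₂ (h ▸ hz)
  have hHc : Continuous H := by
    refine Continuous.if (fun z hz => hHT z (hfr z hz)) ?_ ?_
    · exact (continuous_id.sub continuous_const).mul (Complex.continuous_exp.comp L.continuous)
    · exact continuous_id.sub continuous_const
  have hH0 : ∀ z, H z ≠ 0 := by
    intro z
    by_cases hzO : z ∈ O
    · simp only [H, if_pos hzO]
      exact mul_ne_zero (sub_ne_zero.2 fun h => hz (h ▸ hzO)) (Complex.exp_ne_zero _)
    · simp only [H, if_neg hzO]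
      exact sub_ne_zero.2 fun h => hzO (h ▸ hz₁O)
  obtain ⟨M, hM, hMe⟩ := exists_continuous_log hHc hH0
  set ρ := max R (‖z₁‖ + 1)
  have hρ0 : 0 < ρ := lt_of_lt_of_le (by positivity) (le_max_right _ _)
  let γ : I → ℂ := fun t => ρ * Complex.exp (2 * Real.pi * Complex.I * (t : ℝ))
  have hγn : ∀ t, ‖γ t‖ = ρ := fun t => by
    have : (2 * Real.pi * Complex.I * (t : ℝ) : ℂ) = ((2 * Real.pi * (t : ℝ) : ℝ) : ℂ) * Complex.I := by
      push_cast; ring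
    simp only [γ]
    rw [norm_mul, this, Complex.norm_exp_ofReal_mul_I, mul_one, Complex.norm_real, Real.norm_of_nonneg hρ0.le]
  have hγ0 : ∀ t, γ t ≠ 0 := fun t => norm_pos_iff.1 (by rw [hγn]; exact hρ0)
  have hγz : ∀ t, ‖z₁‖ < ‖γ t‖ := fun t => by
    rw [hγn]; exact (lt_add_one _).trans_le (le_max_right _ _)
  have hγc : Continuous γ := by fun_prop
  have hγ01 : γ 0 = γ 1 := by simp [γ, Complex.exp_two_pi_mul_I]
  have hw0 : HasWinding γ z₁ 0 := by
    refine ⟨fun t => M (γ t), hM.comp hγc, fun t => ?_, by simp [hγ01]⟩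
    have hO' : γ t ∉ O := fun h => hOT h (hfar (by
      show R ≤ ‖γ t‖
      rw [hγn]; exact le_max_left _ _))
    rw [hMe]; simp [H, hO']
  have hw1 : HasWinding γ z₁ (2 * Real.pi * Complex.I) := by
    refine ⟨fun t => 2 * Real.pi * Complex.I * (t : ℝ) + Complex.log ρ + Complex.log (1 - z₁ / γ t), ?_, ?_, ?_⟩
    · refine Continuous.add (by fun_prop) (Continuous.clog ?_ fun t => one_sub_div_mem_slitPlane (hγz t))
      exact continuous_const.sub (continuous_const.div hγc hγ0)
    · intro t
      rw [Complex.exp_add, Complex.exp_add, Complex.exp_log (by exact_mod_cast hρ0.ne'),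
        Complex.exp_log (Complex.slitPlane_ne_zero (one_sub_div_mem_slitPlane (hγz t)))]
      have : Complex.exp (2 * Real.pi * Complex.I * (t : ℝ)) * ρ = γ t := by simp only [γ]; ring
      rw [this, mul_sub, mul_div_cancel₀ _ (hγ0 t), mul_one]
    · simp only [hγ01]; simp
  have := hw0.unique hw1
  exact Complex.two_pi_I_ne_zero this.symm

end Tree

section Letters

open Set Metric

theorem HasWinding.of_isPreconnected {γ : I → ℂ} (hγc : Continuous γ) (hγ : γ 0 = γ 1) {T : Set ℂ}
    (hT : IsPreconnected T) (hd : Disjoint T (range γ)) {c c' d : ℂ} (hc : c ∈ T) (hc' : c' ∈ T)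
    (h : HasWinding γ c d) : HasWinding γ c' d := by
  obtain ⟨O, hO, hOc, hOΓ, hTO, -⟩ := exists_component (isCompact_range hγc).isClosed hT hd hc
  have hp : IsPathConnected O := hO.isConnected_iff_isPathConnected.1 ⟨⟨c, hTO hc⟩, hOc⟩
  obtain ⟨p, hp⟩ := hp.joinedIn c (hTO hc) c' (hTO hc')
  have := HasWinding.of_joined (A := p.extend) hγc hγ zero_le_one p.continuous_extend.continuousOn
    (fun s hs t ht => by
      rw [p.extend_apply hs] at ht
      exact disjoint_left.1 hOΓ (hp _) ⟨t, ht⟩) (d := d)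
  simpa using this (by simpa using h)

theorem JoinedFar.hasWinding {γ : I → ℂ} (hγc : Continuous γ) (hγ : γ 0 = γ 1) {c : ℂ}
    (h : JoinedFar (range γ) c) : HasWinding γ c 0 := by
  obtain ⟨T, hT, hc, hd, z, hz, hfar⟩ := h
  exact HasWinding.of_isPreconnected hγc hγ hT hd hz hc
    (HasWinding.of_norm_lt hγc hγ fun t => hfar _ ⟨t, rfl⟩)

/-- The union of the strands `a p` over `p ∈ A`. -/
def strands (a : ℂ → ℝ → ℂ) (A : Finset ℂ) : Set ℂ := ⋃ p ∈ A, a p '' Icc 0 1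

/-- A tree of arcs in the plane, rooted at the complement of a disc of radius `R`: every node `p ∈ N` is
joined to its parent by the arc `a p`, and `anc p` is the set of its ancestors, including itself. -/
structure ArcTree (R : ℝ) (N : Finset ℂ) (a : ℂ → ℝ → ℂ) (anc : ℂ → Finset ℂ) : Prop where
  pos : 0 < R
  cont : ∀ p ∈ N, Continuous (a p)
  inj : ∀ p ∈ N, InjOn (a p) (Icc 0 1)
  zero : ∀ p ∈ N, a p 0 = p
  norm_lt : ∀ p ∈ N, ∀ t ∈ Ico (0 : ℝ) 1, ‖a p t‖ < R
  disj : ∀ p ∈ N, ∀ q ∈ N, ∀ t ∈ Ioo (0 : ℝ) 1, ∀ s ∈ Icc (0 : ℝ) 1, a p t = a q s → p = q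
  anc_subset : ∀ p ∈ N, anc p ⊆ N
  mem_anc : ∀ p ∈ N, p ∈ anc p
  anc_trans : ∀ p ∈ N, ∀ i ∈ anc p, anc i ⊆ anc p
  anc_total : ∀ p ∈ N, ∀ i ∈ anc p, ∀ j ∈ anc p, i ∈ anc j ∨ j ∈ anc i
  root : ∀ p ∈ N, IsPreconnected (far R ∪ strands a (anc p))
  parent : ∀ p ∈ N, IsPreconnected (far R ∪ strands a ((anc p).erase p)) ∧
    a p 1 ∈ far R ∪ strands a ((anc p).erase p)
  between : ∀ p ∈ N, ∀ i ∈ anc p, IsPreconnected ({i} ∪ strands a (anc p \ anc i)) ∧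
    p ∈ {i} ∪ strands a (anc p \ anc i)
  logs : HasLogs (far R ∪ strands a N)

variable {R : ℝ} {N : Finset ℂ} {a : ℂ → ℝ → ℂ} {anc : ℂ → Finset ℂ}

theorem strands_mono {A B : Finset ℂ} (h : A ⊆ B) : strands a A ⊆ strands a B :=
  biUnion_subset_biUnion_left h

theorem isClosed_strands {A : Finset ℂ} (h : ∀ p ∈ A, Continuous (a p)) : IsClosed (strands a A) :=
  A.finite_toSet.isClosed_biUnion fun p hp => (isCompact_Icc.image (h p hp)).isClosed

namespace ArcTree

theorem isClosed (hT : ArcTree R N a anc) : IsClosed (far R ∪ strands a N) :=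
  (isClosed_far R).union (isClosed_strands hT.cont)

theorem isPreconnected_compl (hT : ArcTree R N a anc) : IsPreconnected (far R ∪ strands a N)ᶜ :=
  hT.logs.isPreconnected_compl hT.isClosed subset_union_left

theorem mem_strands (hT : ArcTree R N a anc) {p : ℂ} {A : Finset ℂ} (hp : p ∈ A) (hA : A ⊆ N) :
    p ∈ strands a A :=
  mem_biUnion hp ⟨0, by simp, hT.zero p (hA hp)⟩

theorem joinedFar (hT : ArcTree R N a anc) {Γ : Set ℂ} (hΓ : IsCompact Γ) {p : ℂ} (hp : p ∈ N)
    (hd : Disjoint (far R ∪ strands a (anc p)) Γ) : JoinedFar Γ p := by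
  obtain ⟨r, hr⟩ := hΓ.isBounded.exists_norm_le
  refine ⟨_, hT.root p hp, Or.inr (hT.mem_strands (hT.mem_anc p hp) (hT.anc_subset p hp)), hd,
    ((max R (r + 1) : ℝ) : ℂ), Or.inl ?_, fun z hz => ?_⟩
  · rw [far, mem_ofPred_eq, Complex.norm_real]
    exact (le_max_left _ _).trans (le_abs_self _)
  · rw [Complex.norm_real]
    exact (((hr z hz).trans_lt (lt_add_one r)).trans_le (le_max_right R _)).trans_le (le_abs_self _)

/-- The set `Γ` meets the tree only in the single point `a j s`, interior to a strand. -/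
def MeetsOnce (R : ℝ) (N : Finset ℂ) (a : ℂ → ℝ → ℂ) (Γ : Set ℂ) (j : ℂ) (s : ℝ) : Prop :=
  j ∈ N ∧ s ∈ Ioo (0 : ℝ) 1 ∧ ∀ z ∈ Γ, z ∈ far R ∪ strands a N → z = a j s

section

variable {Γ : Set ℂ} {j : ℂ} {s : ℝ}

theorem disjoint_of_notMem (hT : ArcTree R N a anc) (h : MeetsOnce R N a Γ j s) {A : Finset ℂ}
    (hA : A ⊆ N) (hj : j ∉ A) : Disjoint (far R ∪ strands a A) Γ := by
  rw [disjoint_left]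
  intro z hz hzΓ
  have := h.2.2 z hzΓ (hz.imp_right fun h => strands_mono hA h)
  subst this
  rcases hz with hz | hz
  · exact absurd (hT.norm_lt j h.1 s ⟨h.2.1.1.le, h.2.1.2⟩) (not_lt.2 (show R ≤ _ from hz))
  · obtain ⟨q, hq, t, ht, he⟩ := mem_iUnion₂.1 hz
    exact hj (hT.disj j h.1 q (hA hq) s h.2.1 t ht he.symm ▸ hq)

theorem node_notMem (hT : ArcTree R N a anc) (h : MeetsOnce R N a Γ j s) {p : ℂ} (hp : p ∈ N) :
    p ∉ Γ := by
  intro hpΓ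
  have h1 := h.2.2 p hpΓ (Or.inr (hT.mem_strands hp subset_rfl))
  have h2 := hT.disj j h.1 p hp s h.2.1 0 (by simp) (by rw [hT.zero p hp, ← h1])
  subst h2
  rw [← hT.zero j h.1] at h1
  exact h.2.1.1.ne (hT.inj j h.1 (by simp) ⟨h.2.1.1.le, h.2.1.2.le⟩ (by simpa [hT.zero j h.1] using h1))

theorem disjoint_between (hT : ArcTree R N a anc) (h : MeetsOnce R N a Γ j s) {p i : ℂ} (hp : p ∈ N)
    (hi : i ∈ anc p) (hj : j ∈ anc i) : Disjoint ({i} ∪ strands a (anc p \ anc i)) Γ := by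
  rw [disjoint_union_left]
  constructor
  · rw [disjoint_singleton_left]
    exact hT.node_notMem h (hT.anc_subset p hp hi)
  · exact (disjoint_union_left.1 (hT.disjoint_of_notMem h
      (Finset.sdiff_subset.trans (hT.anc_subset p hp)) (by simp [hj]))).2

end

variable {V : Set ℂ} {b : ↥Vᶜ}

/-- A loop that meets the tree at a single time, in the interior of the strand `a j`. -/
def IsLetterAt (R : ℝ) (N : Finset ℂ) (a : ℂ → ℝ → ℂ) (κ : Path b b) (j : ℂ) : Prop :=
  j ∈ N ∧ ∃ s ∈ Ioo (0 : ℝ) 1, ∃ t₀ : I, (κ t₀ : ℂ) = a j s ∧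
    ∀ t, (κ t : ℂ) ∈ far R ∪ strands a N → t = t₀

theorem IsLetterAt.meetsOnce {κ : Path b b} {j : ℂ} (h : IsLetterAt R N a κ j) :
    ∃ s, MeetsOnce R N a (range fun t => (κ t : ℂ)) j s := by
  obtain ⟨hj, s, hs, t₀, h0, h⟩ := h
  refine ⟨s, hj, hs, ?_⟩
  rintro _ ⟨t, rfl⟩ ht
  rw [h t ht, ← h0]

theorem IsLetterAt.exists_winding (hT : ArcTree R N a anc) (hb : (b : ℂ) ∉ far R ∪ strands a N)
    {κ : Path b b} {j : ℂ} (h : IsLetterAt R N a κ j) :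
    ∃ k ∈ Finset.Icc (-1 : ℤ) 1, HasWinding (fun t => (κ t : ℂ)) j (k * (2 * Real.pi * Complex.I)) := by
  have hκ : Continuous fun t => (κ t : ℂ) := by fun_prop
  have hl : (κ 0 : ℂ) = κ 1 := by simp
  obtain ⟨s', hm⟩ := h.meetsOnce
  obtain ⟨hj, s, hs, t₀, h0, h⟩ := h
  obtain ⟨d, hd⟩ := exists_hasWinding hκ (c := j) fun t ht => hT.node_notMem hm hj ⟨t, ht⟩
  obtain ⟨k, rfl⟩ := hd.exists_int hl
  refine ⟨k, ?_, hd⟩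
  have h1 : HasWinding (fun t => (κ t : ℂ)) (a j 1) 0 := by
    apply JoinedFar.hasWinding hκ hl
    obtain ⟨hp, hmem⟩ := hT.parent j hj
    have hdisj := hT.disjoint_of_notMem hm ((Finset.erase_subset _ _).trans (hT.anc_subset j hj))
      (Finset.notMem_erase j (anc j))
    obtain ⟨r, hr⟩ := (isCompact_range hκ).isBounded.exists_norm_le
    refine ⟨_, hp, hmem, hdisj, ((max R (r + 1) : ℝ) : ℂ), Or.inl ?_, fun z hz => ?_⟩
    · rw [far, mem_ofPred_eq, Complex.norm_real]
      exact (le_max_left _ _).trans (le_abs_self _)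
    · rw [Complex.norm_real]
      exact (((hr z hz).trans_lt (lt_add_one r)).trans_le (le_max_right R _)).trans_le (le_abs_self _)
  have key := abs_im_winding_sub_lt (κ := fun t => (κ.extend t : ℂ)) (A := a j)
    (continuous_subtype_val.comp κ.continuous_extend) (hT.cont j hj) t₀.2 hs
    (by simp) (by simpa using h0) (by
      simp only [Path.extend_zero, Path.extend_extends']
      intro he
      refine hb ?_
      rw [he, h0]
      exact Or.inr (mem_biUnion hj ⟨s, Ioo_subset_Icc_self hs, rfl⟩))
    (by
      intro t ht u hu he
      rw [κ.extend_apply ht] at he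
      have := h ⟨t, ht⟩ (he ▸ Or.inr (mem_biUnion hj ⟨u, hu, rfl⟩))
      subst this
      exact ⟨rfl, hT.inj j hj hu ⟨hs.1.le, hs.2.le⟩ (he.symm.trans h0)⟩)
    (d := k * (2 * Real.pi * Complex.I)) (d' := 0)
    (by simpa [hT.zero j hj] using hd) (by simpa using h1)
  have him : (0 - (k : ℂ) * (2 * Real.pi * Complex.I)).im = -(k * (2 * Real.pi)) := by simp
  rw [him, abs_neg, abs_mul, abs_of_pos Real.two_pi_pos] at key
  have hk : |(k : ℝ)| < 2 := by nlinarith [Real.pi_pos]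
  have hk' : |k| < 2 := by exact_mod_cast hk
  rw [Finset.mem_Icc]
  rw [abs_lt] at hk'
  omega

theorem isCompact_pathsRange {x y : ↥Vᶜ} (p q : Path x y) : IsCompact (pathsRange p q) :=
  (isCompact_range (by fun_prop)).union (isCompact_range (by fun_prop))

theorem homotopic_of_isLetterAt (hT : ArcTree R N a anc) (hV : V.Finite) (hVN : ∀ w ∈ V, w ∈ N)
    {κ κ' : Path b b} {j j' : ℂ} {d : ℂ} (h : IsLetterAt R N a κ j) (h' : IsLetterAt R N a κ' j')
    (hlab : ∀ w ∈ V, j ∈ anc w ↔ j' ∈ anc w)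
    (hd : HasWinding (fun t => (κ t : ℂ)) j d) (hd' : HasWinding (fun t => (κ' t : ℂ)) j' d) :
    κ.Homotopic κ' := by
  obtain ⟨s, hm⟩ := h.meetsOnce
  obtain ⟨s', hm'⟩ := h'.meetsOnce
  have hout : ∀ w ∈ V, j ∉ anc w → JoinedFar (pathsRange κ κ') w := fun w hw hj =>
    hT.joinedFar (isCompact_pathsRange _ _) (hVN w hw) (disjoint_union_right.2
      ⟨hT.disjoint_of_notMem hm (hT.anc_subset w (hVN w hw)) hj,
        hT.disjoint_of_notMem hm' (hT.anc_subset w (hVN w hw)) fun h => hj ((hlab w hw).2 h)⟩)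
  by_cases hex : ∃ w ∈ V, j ∈ anc w
  swap
  · push Not at hex
    exact homotopic_of_joinedFar hV _ _ fun w hw => hout w hw (hex w hw)
  obtain ⟨w₀, hw₀, hj₀⟩ := hex
  wlog hjj : j ∈ anc j' generalizing κ κ' j j' s s'
  · refine (this h' h (fun w hw => (hlab w hw).symm) hd' hd s' hm' s hm ?_
      ((hlab w₀ hw₀).1 hj₀) ?_).symm
    · intro w hw hj
      have := hout w hw (fun h => hj ((hlab w hw).1 h))
      rwa [pathsRange, union_comm] at this
    · exact (hT.anc_total w₀ (hVN w₀ hw₀) j hj₀ j' ((hlab w₀ hw₀).1 hj₀)).resolve_left hjj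
  have hjN : j' ∈ N := h'.1
  have hκ : Continuous fun t => (κ t : ℂ) := by fun_prop
  have hb := hT.between j' hjN j hjj
  have hdj : HasWinding (fun t => (κ t : ℂ)) j' d :=
    HasWinding.of_isPreconnected hκ (by simp) hb.1
      (hT.disjoint_between hm hjN hjj (hT.mem_anc j h.1)) (Or.inl rfl) hb.2 hd
  refine homotopic_of_hasWinding hV κ κ' (fun w hw => ?_) hdj hd'
  by_cases hj : j ∈ anc w
  · right
    have hj' := (hlab w hw).1 hj
    obtain ⟨hc, hmem⟩ := hT.between w (hVN w hw) j' hj'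
    exact ⟨_, hc, hmem, Or.inl rfl, disjoint_union_right.2
      ⟨hT.disjoint_between hm (hVN w hw) hj' hjj,
        hT.disjoint_between hm' (hVN w hw) hj' (hT.mem_anc j' hjN)⟩⟩
  · exact Or.inl (hout w hw hj)

/-- There are at most `3 · 2 ^ |V|` homotopy classes of loops crossing the tree once. -/
theorem exists_letters (hT : ArcTree R N a anc) (hV : V.Finite) (hVN : ∀ w ∈ V, w ∈ N)
    (hb : (b : ℂ) ∉ far R ∪ strands a N) :
    ∃ S : Finset (Path.Homotopic.Quotient b b), S.card ≤ 3 * 2 ^ V.ncard ∧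
      ∀ (κ : Path b b) (j : ℂ), IsLetterAt R N a κ j → .mk κ ∈ S := by
  classical
  let A := {κ : Path b b // ∃ j, IsLetterAt R N a κ j}
  choose j hj using fun κ : A => κ.2
  choose k hk hkw using fun κ : A => (hj κ).exists_winding hT hb
  let lab : A → Finset ℂ × ℤ := fun κ => (hV.toFinset.filter fun w => j κ ∈ anc w, k κ)
  have hlab : ∀ κ κ' : A, lab κ = lab κ' →
      (Path.Homotopic.Quotient.mk κ.1 : Path.Homotopic.Quotient b b) = .mk κ'.1 := by
    intro κ κ' h
    obtain ⟨h1, h2⟩ := Prod.ext_iff.1 h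
    refine Path.Homotopic.Quotient.eq.2 (homotopic_of_isLetterAt hT hV hVN (hj κ) (hj κ') ?_ (hkw κ) ?_)
    · intro w hw
      have := Finset.ext_iff.1 h1 w
      simpa [lab, hw] using this
    · have h2' : k κ = k κ' := h2
      rw [h2']
      exact hkw κ'
  have hfac : ∃ g : Finset ℂ × ℤ → Path.Homotopic.Quotient b b, ∀ κ : A, g (lab κ) = .mk κ.1 := by
    refine ⟨fun l => if h : ∃ κ, lab κ = l then .mk (h.choose).1 else .refl b, fun κ => ?_⟩
    have h : ∃ κ', lab κ' = lab κ := ⟨κ, rfl⟩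
    simp only [dif_pos h]
    exact hlab _ _ h.choose_spec
  obtain ⟨g, hg⟩ := hfac
  refine ⟨(hV.toFinset.powerset ×ˢ Finset.Icc (-1 : ℤ) 1).image g, ?_, fun κ i hi => ?_⟩
  · refine Finset.card_image_le.trans ?_
    rw [Finset.card_product, Finset.card_powerset, ← ncard_eq_toFinset_card V hV]
    simp [mul_comm]
  · have := hg ⟨κ, i, hi⟩
    rw [← this]
    exact Finset.mem_image_of_mem _ (Finset.mem_product.2
      ⟨Finset.mem_powerset.2 (Finset.filter_subset _ _), hk _⟩)

end ArcTree

end Letters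

section Words

open Set Metric
open scoped Pointwise

/-- The straight path from `s` to `t`. -/
def segPath (s t : ℝ) : Path s t where
  toFun u := s + u * (t - s)
  continuous_toFun := by fun_prop
  source' := by simp
  target' := by simp

theorem segPath_mem {s t : ℝ} (h : s ≤ t) (u : I) : segPath s t u ∈ Icc s t :=
  ⟨by
    have := u.2.1
    show s ≤ s + u * (t - s)
    nlinarith, by
    have := u.2.2
    show s + u * (t - s) ≤ t
    nlinarith⟩

variable {V : Set ℂ}

/-- The piece of the curve `γ` between times `s` and `t`. -/
def piece (γ : ℝ → ℂ) (hγ : Continuous γ) {s t : ℝ} (hst : s ≤ t) (h : ∀ x ∈ Icc s t, γ x ∉ V) :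
    Path (⟨γ s, h s (left_mem_Icc.2 hst)⟩ : ↥Vᶜ) ⟨γ t, h t (right_mem_Icc.2 hst)⟩ where
  toFun u := ⟨γ (segPath s t u), h _ (segPath_mem hst u)⟩
  continuous_toFun := (hγ.comp (segPath s t).continuous).subtype_mk _
  source' := by simp
  target' := by simp

theorem piece_trans (γ : ℝ → ℂ) (hγ : Continuous γ) {s t u : ℝ} (hst : s ≤ t) (htu : t ≤ u)
    (h : ∀ x ∈ Icc s u, γ x ∉ V) :
    (piece γ hγ (hst.trans htu) h).Homotopic
      ((piece γ hγ hst fun x hx => h x ⟨hx.1, hx.2.trans htu⟩).trans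
        (piece γ hγ htu fun x hx => h x ⟨hst.trans hx.1, hx.2⟩)) := by
  let φ : Path s u := (segPath s t).trans (segPath t u)
  have hφ : ∀ v, φ v ∈ Icc s u := by
    intro v
    simp only [φ, Path.trans_apply]
    split_ifs
    · exact ⟨(segPath_mem hst _).1, (segPath_mem hst _).2.trans htu⟩
    · exact ⟨hst.trans (segPath_mem htu _).1, (segPath_mem htu _).2⟩
  have hmem : ∀ z : I × I, (1 - (z.1 : ℝ)) * segPath s u z.2 + z.1 * φ z.2 ∈ Icc s u := fun z =>
    (convex_Icc s u) (segPath_mem (hst.trans htu) z.2) (hφ z.2) (by linarith [z.1.2.2]) z.1.2.1 (by ring)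
  refine Path.Homotopic.of_continuous
    (fun z => ⟨γ ((1 - (z.1 : ℝ)) * segPath s u z.2 + z.1 * φ z.2), h _ (hmem z)⟩) ?_ ?_ ?_ ?_ ?_
  · refine Continuous.subtype_mk (hγ.comp ?_) _
    have := φ.continuous
    have := (segPath s u).continuous
    fun_prop
  · intro v; simp [piece]
  · intro v
    apply Subtype.ext
    simp only [piece, φ, Path.trans_apply]
    split_ifs <;> simp
  · intro v; apply Subtype.ext; simp only [Path.source]; congr 1; ring
  · intro v; apply Subtype.ext; simp only [Path.target]; congr 1; ring

theorem homotopic_of_convex {C : Set ℂ} (hC : Convex ℝ C) (hCV : Disjoint C V) {x y : ↥Vᶜ} (p q : Path x y)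
    (hp : ∀ t, (p t : ℂ) ∈ C) (hq : ∀ t, (q t : ℂ) ∈ C) : p.Homotopic q := by
  have hmem : ∀ z : I × I, ((1 - (z.1 : ℝ)) • (p z.2 : ℂ) + (z.1 : ℝ) • (q z.2 : ℂ)) ∈ C := fun z =>
    hC (hp _) (hq _) (by linarith [z.1.2.2]) z.1.2.1 (by ring)
  refine Path.Homotopic.of_continuous
    (fun z => ⟨(1 - (z.1 : ℝ)) • (p z.2 : ℂ) + (z.1 : ℝ) • (q z.2 : ℂ), disjoint_left.1 hCV (hmem z)⟩)
    ?_ ?_ ?_ ?_ ?_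
  · refine Continuous.subtype_mk ?_ _
    fun_prop
  · intro v; simp
  · intro v; simp
  · intro v; apply Subtype.ext; simp only [Path.source]; rw [← add_smul]; simp
  · intro v; apply Subtype.ext; simp only [Path.target]; rw [← add_smul]; simp

/-- The class of a loop in the fundamental group. -/
noncomputable def loopClass {b : ↥Vᶜ} (κ : Path b b) : FundamentalGroup ↥Vᶜ b := Path.Homotopic.Quotient.mk κ

/-- `Λ` contains the classes of the loops crossing `T` once, the crossing being in `T'` itself. -/
structure Alphabet (b : ↥Vᶜ) (T T' : Set ℂ) (Λ : Set (FundamentalGroup ↥Vᶜ b)) : Prop where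
  sub : V ⊆ T
  sub' : T' ⊆ T
  one_mem : 1 ∈ Λ
  null : ∀ κ : Path b b, (∀ t, (κ t : ℂ) ∉ T) → loopClass κ = 1
  letter : ∀ (κ : Path b b) (t₀ : I), (κ t₀ : ℂ) ∈ T' → (∀ t, (κ t : ℂ) ∈ T → t = t₀) →
    loopClass κ ∈ Λ
  joined : ∀ x : ↥Vᶜ, (x : ℂ) ∉ T → ∃ α : Path b x, ∀ t, (α t : ℂ) ∉ T

variable {b : ↥Vᶜ} {T T' : Set ℂ} {Λ : Set (FundamentalGroup ↥Vᶜ b)}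

/-- A path with ends off `T` is a word of length `k` if closing it up off `T` gives a product of `k`
elements of `Λ`. -/
def IsWord (T : Set ℂ) (Λ : Set (FundamentalGroup ↥Vᶜ b)) (k : ℕ) {x y : ↥Vᶜ} (p : Path x y) : Prop :=
  ∀ (α : Path b x) (β : Path b y), (∀ t, (α t : ℂ) ∉ T) → (∀ t, (β t : ℂ) ∉ T) →
    loopClass (α.trans (p.trans β.symm)) ∈ Λ ^ k

section

variable {x y z : ↥Vᶜ} {k l : ℕ} {p : Path x y} {q : Path y z}

theorem IsWord.congr {p' : Path x y} (h : IsWord T Λ k p) (hp : p.Homotopic p') : IsWord T Λ k p' := by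
  intro α β hα hβ
  have := h α β hα hβ
  rwa [loopClass, Path.Homotopic.Quotient.eq.2 ((Path.Homotopic.refl α).hcomp (hp.hcomp (Path.Homotopic.refl _)))] at this

theorem IsWord.mono (hA : Alphabet b T T' Λ) (h : IsWord T Λ k p) (hkl : k ≤ l) : IsWord T Λ l p :=
  fun α β hα hβ => Set.pow_subset_pow_right hA.one_mem hkl (h α β hα hβ)

theorem IsWord.trans (hA : Alphabet b T T' Λ) (hy : (y : ℂ) ∉ T) (hp : IsWord T Λ k p) (hq : IsWord T Λ l q) :
    IsWord T Λ (k + l) (p.trans q) := by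
  intro α β hα hβ
  obtain ⟨δ, hδ⟩ := hA.joined y hy
  have h1 := hp α δ hα hδ
  have h2 := hq δ β hδ hβ
  have key : loopClass (α.trans ((p.trans q).trans β.symm)) =
      loopClass (δ.trans (q.trans β.symm)) *
      loopClass (α.trans (p.trans δ.symm)) := by
    rw [FundamentalGroup.mul_def]
    simp only [loopClass, Path.Homotopic.Quotient.mk_trans, Path.Homotopic.Quotient.mk_symm,
      Path.Homotopic.Quotient.trans_assoc]
    rw [← Path.Homotopic.Quotient.trans_assoc (.symm _) (.mk δ)]
    simp
  rw [key, add_comm, pow_add]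
  exact Set.mul_mem_mul h2 h1

theorem IsWord.of_disjoint (hA : Alphabet b T T' Λ) (h : ∀ t, (p t : ℂ) ∉ T) : IsWord T Λ 0 p := by
  intro α β hα hβ
  rw [pow_zero, Set.mem_one]
  apply hA.null
  intro t
  simp only [Path.trans_apply]
  split_ifs
  · exact hα _
  · exact h _
  · exact hβ _

theorem IsWord.of_letter (hA : Alphabet b T T' Λ) (hx : (x : ℂ) ∉ T) {t₀ : I} (h₀ : (p t₀ : ℂ) ∈ T')
    (h : ∀ t, (p t : ℂ) ∈ T → t = t₀) : IsWord T Λ 1 p := by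
  intro α β hα hβ
  rw [pow_one]
  have h0 : (t₀ : ℝ) ∈ Icc (0 : ℝ) 1 := t₀.2
  have hsub : ∀ t : I, ((α.trans (p.trans β.symm)) t : ℂ) ∈ T → (t : ℝ) = 1 / 2 + t₀ / 4 := by
    intro t
    simp only [Path.trans_apply]
    split_ifs with h1 h2
    · exact fun h => absurd h (hα _)
    · intro hT
      have := congrArg Subtype.val (h _ hT)
      simp only at this
      linarith
    · exact fun h => absurd h (hβ _)
  have hmem : (1 / 2 + (t₀ : ℝ) / 4) ∈ Icc (0 : ℝ) 1 := ⟨by linarith [h0.1], by linarith [h0.2]⟩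
  have hz : (t₀ : ℝ) ≠ 0 := fun hz => by
    have h0 : t₀ = 0 := Subtype.ext hz
    subst h0
    exact hx (by simpa using hA.sub' h₀)
  refine hA.letter _ ⟨1 / 2 + t₀ / 4, hmem⟩ ?_ fun t ht => Subtype.ext (hsub t ht)
  have e1 : ¬ (1 / 2 + (t₀ : ℝ) / 4) ≤ 1 / 2 := by
    have := lt_of_le_of_ne h0.1 (Ne.symm hz)
    linarith
  have e2 : 2 * (1 / 2 + (t₀ : ℝ) / 4) - 1 ≤ 1 / 2 := by linarith [h0.2]
  simp only [Path.trans_apply]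
  rw [dif_neg e1, dif_pos e2]
  convert h₀ using 3
  apply Subtype.ext
  simp only
  ring

end

end Words

section Words

open Set Metric
open scoped Pointwise

variable {V : Set ℂ} {b : ↥Vᶜ} {T T' : Set ℂ} {Λ : Set (FundamentalGroup ↥Vᶜ b)}

theorem piece_apply_exists {γ : ℝ → ℂ} {hγ : Continuous γ} {s t : ℝ} {hst : s ≤ t}
    {h : ∀ x ∈ Icc s t, γ x ∉ V} (u : I) : ∃ x ∈ Icc s t, (piece γ hγ hst h u : ℂ) = γ x :=
  ⟨_, segPath_mem hst u, rfl⟩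

theorem isWord_piece_of_finite (hA : Alphabet b T T' Λ) {γ : ℝ → ℂ} (hγ : Continuous γ) {s t : ℝ}
    (hst : s ≤ t) (h : ∀ x ∈ Icc s t, γ x ∉ V) (hs : γ s ∉ T) (ht : γ t ∉ T) (Z : Finset ℝ)
    (hZ : ∀ x ∈ Icc s t, γ x ∈ T → x ∈ Z ∧ γ x ∈ T') :
    IsWord T Λ Z.card (piece γ hγ hst h) := by
  classical
  induction hn : Z.card generalizing s Z with
  | zero =>
    rw [Finset.card_eq_zero] at hn
    subst hn
    refine IsWord.of_disjoint hA fun u hu => ?_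
    obtain ⟨x, hx, he⟩ := piece_apply_exists (hγ := hγ) (hst := hst) (h := h) u
    simpa using (hZ x hx (he ▸ hu)).1
  | succ n ih =>
    set Z' := Z.filter fun x => x ∈ Icc s t ∧ γ x ∈ T with hZ'
    by_cases hne : Z'.Nonempty
    swap
    · refine (IsWord.of_disjoint hA fun u hu => ?_).mono hA (Nat.zero_le _)
      obtain ⟨x, hx, he⟩ := piece_apply_exists (hγ := hγ) (hst := hst) (h := h) u
      exact hne ⟨x, Finset.mem_filter.2 ⟨(hZ x hx (he ▸ hu)).1, hx, he ▸ hu⟩⟩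
    set z := Z'.min' hne with hz
    have hzm := Finset.mem_filter.1 (Z'.min'_mem hne)
    rw [← hz] at hzm
    obtain ⟨hzZ, hzI, hzT⟩ := hzm
    have hzs : s < z := lt_of_le_of_ne hzI.1 fun e => hs (e ▸ hzT)
    have hzt : z < t := lt_of_le_of_ne hzI.2 fun e => ht (e ▸ hzT)
    have hfirst : ∀ x ∈ Icc s t, γ x ∈ T → z ≤ x := fun x hx hxT =>
      Z'.min'_le x (Finset.mem_filter.2 ⟨(hZ x hx hxT).1, hx, hxT⟩)
    set Y := insert t (Z'.erase z) with hY
    have hYne : Y.Nonempty := Finset.insert_nonempty _ _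
    have hYlt : ∀ y ∈ Y, z < y := by
      intro y hy
      rcases Finset.mem_insert.1 hy with rfl | hy
      · exact hzt
      · obtain ⟨h1, h2⟩ := Finset.mem_erase.1 hy
        exact lt_of_le_of_ne (Z'.min'_le y h2) (Ne.symm h1)
    set m := (z + Y.min' hYne) / 2 with hm
    have hzY := hYlt _ (Y.min'_mem hYne)
    have hzm : z < m := by linarith
    have hmY : ∀ y ∈ Y, m < y := fun y hy => by
      have := Y.min'_le y hy
      linarith
    have hmt : m < t := hmY t (Finset.mem_insert_self _ _)
    have honly : ∀ x ∈ Icc s m, γ x ∈ T → x = z := by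
      intro x hx hxT
      by_contra hne
      have hxI : x ∈ Icc s t := ⟨hx.1, hx.2.trans hmt.le⟩
      exact absurd hx.2 (not_le.2 (hmY x (Finset.mem_insert_of_mem (Finset.mem_erase.2
        ⟨hne, Finset.mem_filter.2 ⟨(hZ x hxI hxT).1, hxI, hxT⟩⟩))))
    have hmT : γ m ∉ T := fun hT => hzm.ne' (honly m ⟨(hzs.trans hzm).le, le_rfl⟩ hT)
    have hsm : s ≤ m := (hzs.trans hzm).le
    have w1 : IsWord T Λ 1 (piece γ hγ hsm fun x hx => h x ⟨hx.1, hx.2.trans hmt.le⟩) := by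
      have hpos : 0 < m - s := by linarith
      have hmem : (z - s) / (m - s) ∈ Icc (0 : ℝ) 1 :=
        ⟨div_nonneg (by linarith) hpos.le, (div_le_one hpos).2 (by linarith)⟩
      refine IsWord.of_letter hA hs (t₀ := ⟨_, hmem⟩) ?_ ?_
      · have : segPath s m ⟨_, hmem⟩ = z := by
          show s + (z - s) / (m - s) * (m - s) = z
          rw [div_mul_cancel₀ _ hpos.ne']; ring
        show γ (segPath s m ⟨_, hmem⟩) ∈ T'
        rw [this]
        exact (hZ z hzI hzT).2
      · intro u hu
        have h1 : s + u * (m - s) = z := honly _ (segPath_mem hsm u) hu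
        apply Subtype.ext
        show (u : ℝ) = (z - s) / (m - s)
        rw [eq_div_iff hpos.ne']
        linarith
    have w2 := ih hmt.le (fun x hx => h x ⟨hsm.trans hx.1, hx.2⟩) hmT (Z.erase z)
      (fun x hx hxT => by
        obtain ⟨h1, h2⟩ := hZ x ⟨hsm.trans hx.1, hx.2⟩ hxT
        exact ⟨Finset.mem_erase.2 ⟨(hzm.trans_le hx.1).ne', h1⟩, h2⟩)
      (by rw [Finset.card_erase_of_mem hzZ, hn]; rfl)
    have := IsWord.trans hA hmT w1 w2
    rw [add_comm] at this
    exact this.congr (piece_trans γ hγ hsm hmt.le h).symm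

theorem exists_isWord_arc (hA : Alphabet b T T' Λ) {p : ℂ} {r : ℝ} (hr : 0 < r) (hV : Disjoint (sphere p r) V)
    (hT : sphere p r ∩ T ⊆ T') (hfin : (sphere p r ∩ T).Finite) {x y : ↥Vᶜ}
    (hx : (x : ℂ) ∈ sphere p r) (hy : (y : ℂ) ∈ sphere p r) (hxT : (x : ℂ) ∉ T) (hyT : (y : ℂ) ∉ T) :
    ∃ q : Path x y, (∀ t, (q t : ℂ) ∈ sphere p r) ∧ IsWord T Λ (sphere p r ∩ T).ncard q := by
  obtain ⟨x, hxV⟩ := x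
  obtain ⟨y, hyV⟩ := y
  simp only at hx hy hxT hyT
  have hrange : range (circleMap p r) = sphere p r := by rw [range_circleMap, abs_of_pos hr]
  obtain ⟨θ₁, rfl⟩ := hrange.symm ▸ hx
  obtain ⟨θ₂', rfl⟩ := hrange.symm ▸ hy
  obtain ⟨θ₂, hθ₂, he⟩ := (periodic_circleMap p r).exists_mem_Ico Real.two_pi_pos θ₂' θ₁
  have hmem : ∀ θ, circleMap p r θ ∈ sphere p r := fun θ => hrange ▸ mem_range_self θ
  have hinj : InjOn (circleMap p r) (Ico θ₁ (θ₁ + 2 * Real.pi)) :=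
    injOn_circleMap_of_abs_sub_le' hr.ne' (by linarith)
  have hIco : Icc θ₁ θ₂ ⊆ Ico θ₁ (θ₁ + 2 * Real.pi) := fun θ hθ => ⟨hθ.1, hθ.2.trans_lt hθ₂.2⟩
  have hinj' : InjOn (circleMap p r) (Icc θ₁ θ₂ ∩ circleMap p r ⁻¹' (sphere p r ∩ T)) :=
    hinj.mono (inter_subset_left.trans hIco)
  have hZfin : (Icc θ₁ θ₂ ∩ circleMap p r ⁻¹' (sphere p r ∩ T)).Finite :=
    Set.Finite.of_finite_image (f := circleMap p r)
      (hfin.subset (by rintro _ ⟨θ, hθ, rfl⟩; exact hθ.2))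
      hinj'
  have hcard : hZfin.toFinset.card ≤ (sphere p r ∩ T).ncard := by
    rw [← ncard_eq_toFinset_card _ hZfin]
    exact ncard_le_ncard_of_injOn (circleMap p r) (fun θ hθ => hθ.2) hinj' hfin
  have hav : ∀ θ ∈ Icc θ₁ θ₂, circleMap p r θ ∉ V := fun θ _ => disjoint_left.1 hV (hmem θ)
  have hw := isWord_piece_of_finite hA (continuous_circleMap p r) hθ₂.1 hav hxT (he ▸ hyT) hZfin.toFinset
    (fun θ hθ hθT => ⟨by simpa using ⟨hθ, by simpa using hmem θ, hθT⟩, hT ⟨hmem θ, hθT⟩⟩)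
  have hw := hw.mono hA hcard
  have key : ∀ y' (hy' : y' ∈ Vᶜ) (hyy : circleMap p r θ₂ = y'),
      ∃ q : Path (⟨circleMap p r θ₁, hxV⟩ : ↥Vᶜ) ⟨y', hy'⟩, (∀ t, (q t : ℂ) ∈ sphere p r) ∧
        IsWord T Λ (sphere p r ∩ T).ncard q := by
    rintro _ hy' rfl
    refine ⟨_, fun t => ?_, hw⟩
    exact hmem _
  exact key _ hyV he.symm

theorem isWord_piece_node (hA : Alphabet b T T' Λ) {γ : ℝ → ℂ} (hγ : Continuous γ) {p : ℂ} {r R₀ : ℝ}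
    (hr : 0 < r) (hrR : r < R₀) (hV : Disjoint (ball p R₀) V)
    (hT : sphere p r ∩ T ⊆ T') (hfin : (sphere p r ∩ T).Finite) {s t τ : ℝ} (hst : s ≤ t)
    (h : ∀ x ∈ Icc s t, γ x ∉ V) (hτ : τ ∈ Icc s t) (hτp : γ τ = p)
    (hs : γ s ∉ ball p R₀) (ht : γ t ∉ ball p R₀) (hTr : ∀ x ∈ Icc s t, γ x ∈ T → γ x ∈ ball p r)
    (hnear : ∀ x ∈ Icc s t, γ x ∈ closedBall p r → ∀ y ∈ uIcc x τ, γ y ∈ ball p R₀) :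
    IsWord T Λ (sphere p r ∩ T).ncard (piece γ hγ hst h) := by
  have hφ : Continuous fun x => dist (γ x) p := by fun_prop
  have hKc : IsCompact (Icc s t ∩ {x | dist (γ x) p ≤ r}) :=
    isCompact_Icc.inter_right (isClosed_le hφ continuous_const)
  have hτK : τ ∈ Icc s t ∩ {x | dist (γ x) p ≤ r} := ⟨hτ, by simp [hτp, hr.le]⟩
  obtain ⟨t₁, ⟨ht₁, ht₁r⟩, hleast⟩ := hKc.exists_isLeast ⟨τ, hτK⟩
  obtain ⟨t₂, ⟨ht₂, ht₂r⟩, hgreat⟩ := hKc.exists_isGreatest ⟨τ, hτK⟩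
  have ht₁τ : t₁ ≤ τ := hleast hτK
  have hτt₂ : τ ≤ t₂ := hgreat hτK
  rw [mem_ball, not_lt] at hs ht
  have e₁ : dist (γ t₁) p = r := by
    obtain ⟨x, hx, hxe⟩ := intermediate_value_Icc' ht₁.1 hφ.continuousOn (show r ∈ Icc _ _ from
      ⟨ht₁r, hrR.le.trans hs⟩)
    have := hleast ⟨⟨hx.1, hx.2.trans ht₁.2⟩, hxe.le⟩
    rwa [le_antisymm hx.2 this] at hxe
  have e₂ : dist (γ t₂) p = r := by
    obtain ⟨x, hx, hxe⟩ := intermediate_value_Icc ht₂.2 hφ.continuousOn (show r ∈ Icc _ _ from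
      ⟨ht₂r, hrR.le.trans ht⟩)
    have := hgreat ⟨⟨ht₂.1.trans hx.1, hx.2⟩, hxe.le⟩
    rwa [le_antisymm this hx.1] at hxe
  have h₁ : ∀ x ∈ Icc s t₁, γ x ∉ T := fun x hx hxT => by
    have hd := hTr x ⟨hx.1, hx.2.trans ht₁.2⟩ hxT
    have := hleast ⟨⟨hx.1, hx.2.trans ht₁.2⟩, (mem_ball.1 hd).le⟩
    rw [le_antisymm hx.2 this, mem_ball, e₁] at hd
    exact lt_irrefl _ hd
  have h₂ : ∀ x ∈ Icc t₂ t, γ x ∉ T := fun x hx hxT => by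
    have hd := hTr x ⟨ht₂.1.trans hx.1, hx.2⟩ hxT
    have := hgreat ⟨⟨ht₂.1.trans hx.1, hx.2⟩, (mem_ball.1 hd).le⟩
    rw [le_antisymm this hx.1, mem_ball, e₂] at hd
    exact lt_irrefl _ hd
  have hmid : ∀ x ∈ Icc t₁ t₂, γ x ∈ ball p R₀ := fun x hx => by
    rcases le_total x τ with hxτ | hxτ
    · exact hnear t₁ ht₁ ht₁r x (by rw [uIcc_of_le ht₁τ]; exact ⟨hx.1, hxτ⟩)
    · exact hnear t₂ ht₂ ht₂r x (by rw [uIcc_of_ge hτt₂]; exact ⟨hxτ, hx.2⟩)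
  have h₁₂ := ht₁τ.trans hτt₂
  have w₁ : IsWord T Λ 0 (piece γ hγ ht₁.1 fun x hx => h x ⟨hx.1, hx.2.trans ht₁.2⟩) :=
    IsWord.of_disjoint hA fun u => h₁ _ (segPath_mem ht₁.1 u)
  have w₂ : IsWord T Λ 0 (piece γ hγ ht₂.2 fun x hx => h x ⟨ht₂.1.trans hx.1, hx.2⟩) :=
    IsWord.of_disjoint hA fun u => h₂ _ (segPath_mem ht₂.2 u)
  have hf₁ := h₁ t₁ (right_mem_Icc.2 ht₁.1)
  have hf₂ := h₂ t₂ (left_mem_Icc.2 ht₂.2)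
  have hsphere : sphere p r ⊆ ball p R₀ := fun z hz => by
    rw [mem_ball, mem_sphere.1 hz]; exact hrR
  have w₃ : IsWord T Λ (sphere p r ∩ T).ncard
      (piece γ hγ h₁₂ fun x hx => h x ⟨ht₁.1.trans hx.1, hx.2.trans ht₂.2⟩) := by
    obtain ⟨q, hq, hqw⟩ := exists_isWord_arc hA hr (hV.mono_left hsphere) hT hfin
      (x := ⟨γ t₁, h t₁ ht₁⟩) (y := ⟨γ t₂, h t₂ ht₂⟩) e₁ e₂ hf₁ hf₂
    exact hqw.congr (homotopic_of_convex (convex_ball p R₀) hV _ _ (fun u => hsphere (hq u))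
      fun u => hmid _ (segPath_mem h₁₂ u))
  have := (w₁.trans hA hf₁ w₃).congr (piece_trans γ hγ ht₁.1 h₁₂
    fun x hx => h x ⟨hx.1, hx.2.trans ht₂.2⟩).symm
  have := (this.trans hA hf₂ w₂).congr (piece_trans γ hγ (ht₁.1.trans h₁₂) ht₂.2 h).symm
  simpa using this

/-- A curve hitting the nodes only at the times in `Z` is a word whose length is controlled by the number
of strands at these nodes. -/
theorem isWord_piece_of_nodes (hA : Alphabet b T T' Λ) {γ : ℝ → ℂ} (hγ : Continuous γ) {P : Finset ℂ}
    {r R₀ : ℝ} (hr : 0 < r) (hrR : r < R₀) (hV : ∀ p ∈ P, p ∉ V → Disjoint (ball p R₀) V)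
    (hT : ∀ p ∈ P, sphere p r ∩ T ⊆ T') (hfin : ∀ p ∈ P, (sphere p r ∩ T).Finite) {s t : ℝ} (hst : s ≤ t)
    (h : ∀ x ∈ Icc s t, γ x ∉ V)
    (hs : ∀ p ∈ P, γ s ∉ ball p R₀) (ht : ∀ p ∈ P, γ t ∉ ball p R₀)
    (hTr : ∀ x ∈ Icc s t, γ x ∈ T → ∃ p ∈ P, γ x ∈ ball p r)
    (hnear : ∀ p ∈ P, ∀ x ∈ Icc s t, γ x ∈ closedBall p r →
      ∃ x₀, γ x₀ = p ∧ ∀ y ∈ uIcc x x₀, γ y ∈ ball p R₀)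
    (hgood : ∀ x ∈ Icc s t, ∀ x' ∈ Icc s t, x < x' → γ x ∈ P → γ x' ∈ P →
      ∃ y ∈ Ioo x x', ∀ p ∈ P, γ y ∉ ball p R₀)
    (Z : Finset ℝ) (hZ : ∀ x ∈ Icc s t, γ x ∈ P → x ∈ Z) :
    IsWord T Λ (∑ z ∈ Z, (sphere (γ z) r ∩ T).ncard) (piece γ hγ hst h) := by
  classical
  have hnear' : ∀ p ∈ P, ∀ x ∈ Icc s t, γ x ∈ closedBall p r →
      ∃ x₀ ∈ Icc s t, γ x₀ = p ∧ ∀ y ∈ uIcc x x₀, γ y ∈ ball p R₀ := by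
    intro p hp x hx hxr
    obtain ⟨x₀, h0, h1⟩ := hnear p hp x hx hxr
    refine ⟨x₀, ⟨?_, ?_⟩, h0, h1⟩
    · by_contra! hlt
      exact hs p hp (h1 s (mem_uIcc.2 (Or.inr ⟨hlt.le, hx.1⟩)))
    · by_contra! hlt
      exact ht p hp (h1 t (mem_uIcc.2 (Or.inl ⟨hx.2, hlt.le⟩)))
  have hoff : ∀ x, (∀ p ∈ P, γ x ∉ ball p R₀) → x ∈ Icc s t → γ x ∉ T := fun x hx hxI hxT => by
    obtain ⟨p, hp, hp'⟩ := hTr x hxI hxT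
    exact hx p hp (ball_subset_ball hrR.le hp')
  induction hn : Z.card generalizing s Z with
  | zero =>
    rw [Finset.card_eq_zero] at hn
    subst hn
    refine IsWord.of_disjoint hA fun u hu => ?_
    obtain ⟨x, hx, he⟩ := piece_apply_exists (hγ := hγ) (hst := hst) (h := h) u
    obtain ⟨p, hp, hxp⟩ := hTr x hx (he ▸ hu)
    obtain ⟨x₀, hx₀, h0, -⟩ := hnear' p hp x hx (ball_subset_closedBall hxp)
    simpa using hZ x₀ hx₀ (h0 ▸ hp)
  | succ n ih =>
    set Z' := Z.filter fun x => x ∈ Icc s t ∧ γ x ∈ P with hZ'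
    by_cases hne : Z'.Nonempty
    swap
    · refine (IsWord.of_disjoint hA fun u hu => ?_).mono hA (Nat.zero_le _)
      obtain ⟨x, hx, he⟩ := piece_apply_exists (hγ := hγ) (hst := hst) (h := h) u
      obtain ⟨p, hp, hxp⟩ := hTr x hx (he ▸ hu)
      obtain ⟨x₀, hx₀, h0, -⟩ := hnear' p hp x hx (ball_subset_closedBall hxp)
      exact hne ⟨x₀, Finset.mem_filter.2 ⟨hZ x₀ hx₀ (h0 ▸ hp), hx₀, h0 ▸ hp⟩⟩
    set z := Z'.min' hne with hz
    have hzm := Finset.mem_filter.1 (Z'.min'_mem hne)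
    rw [← hz] at hzm
    obtain ⟨hzZ, hzI, hzP⟩ := hzm
    have hzself : γ z ∈ ball (γ z) R₀ := mem_ball_self (hr.trans hrR)
    have hzt : z < t := lt_of_le_of_ne hzI.2 fun e => ht _ hzP (e ▸ hzself)
    obtain ⟨m, hzm, hmt, hmg, hmlt⟩ : ∃ m, z < m ∧ m ≤ t ∧ (∀ p ∈ P, γ m ∉ ball p R₀) ∧
        ∀ x ∈ Icc s m, γ x ∈ P → x = z := by
      by_cases hY : (Z'.erase z).Nonempty
      · set y := (Z'.erase z).min' hY with hy
        have hym := (Z'.erase z).min'_mem hY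
        rw [← hy] at hym
        obtain ⟨hyz, hyZ⟩ := Finset.mem_erase.1 hym
        obtain ⟨-, hyI, hyP⟩ := Finset.mem_filter.1 hyZ
        have hzy : z < y := lt_of_le_of_ne (Z'.min'_le y hyZ) (Ne.symm hyz)
        obtain ⟨m, hm, hmg⟩ := hgood z hzI y hyI hzy hzP hyP
        refine ⟨m, hm.1, hm.2.le.trans hyI.2, hmg, fun x hx hxP => ?_⟩
        by_contra hxz
        have hxI : x ∈ Icc s t := ⟨hx.1, hx.2.trans (hm.2.le.trans hyI.2)⟩
        have := (Z'.erase z).min'_le x (Finset.mem_erase.2 ⟨hxz, Finset.mem_filter.2 ⟨hZ x hxI hxP, hxI, hxP⟩⟩)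
        exact absurd (this.trans hx.2) (not_le.2 hm.2)
      · refine ⟨t, hzt, le_rfl, ht, fun x hx hxP => ?_⟩
        by_contra hxz
        exact hY ⟨x, Finset.mem_erase.2 ⟨hxz, Finset.mem_filter.2 ⟨hZ x hx hxP, hx, hxP⟩⟩⟩
    have hsm : s ≤ m := hzI.1.trans hzm.le
    have hmT := hoff m hmg ⟨hsm, hmt⟩
    have hzV : γ z ∉ V := h z hzI
    have huniq : ∀ p ∈ P, ∀ x ∈ Icc s m, γ x ∈ closedBall p r →
        p = γ z ∧ ∀ y ∈ uIcc x z, γ y ∈ ball (γ z) R₀ := by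
      intro p hp x hx hxr
      obtain ⟨x₀, h0, h0p, h1⟩ := hnear' p hp x ⟨hx.1, hx.2.trans hmt⟩ hxr
      have hx₀m : x₀ ≤ m := by
        by_contra! hlt
        exact hmg p hp (h1 m (mem_uIcc.2 (Or.inl ⟨hx.2, hlt.le⟩)))
      have := hmlt x₀ ⟨h0.1, hx₀m⟩ (h0p ▸ hp)
      subst this
      exact ⟨h0p.symm, h0p ▸ h1⟩
    have w₁ := isWord_piece_node hA hγ (p := γ z) hr hrR (hV _ hzP hzV) (hT _ hzP) (hfin _ hzP) hsm
      (fun x hx => h x ⟨hx.1, hx.2.trans hmt⟩) (τ := z) ⟨hzI.1, hzm.le⟩ rfl (hs _ hzP) (hmg _ hzP)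
      (fun x hx hxT => by
        obtain ⟨p, hp, hxp⟩ := hTr x ⟨hx.1, hx.2.trans hmt⟩ hxT
        exact (huniq p hp x hx (ball_subset_closedBall hxp)).1 ▸ hxp)
      (fun x hx hxr => (huniq _ hzP x hx hxr).2)
    have hsub : ∀ x ∈ Icc m t, x ∈ Icc s t := fun x hx => ⟨hsm.trans hx.1, hx.2⟩
    have w₂ := ih hmt (fun x hx => h x (hsub x hx)) hmg
      (fun x hx => hTr x (hsub x hx)) (fun p hp x hx => hnear p hp x (hsub x hx))
      (fun x hx x' hx' => hgood x (hsub x hx) x' (hsub x' hx')) (Z.erase z)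
      (fun x hx hxP => Finset.mem_erase.2 ⟨(hzm.trans_le hx.1).ne', hZ x (hsub x hx) hxP⟩)
      (fun p hp x hx hxr => by
        obtain ⟨x₀, h0, h1⟩ := hnear p hp x (hsub x hx) hxr
        refine ⟨x₀, ⟨?_, ?_⟩, h0, h1⟩
        · by_contra! hlt
          exact hmg p hp (h1 m (mem_uIcc.2 (Or.inr ⟨hlt.le, hx.1⟩)))
        · by_contra! hlt
          exact ht p hp (h1 t (mem_uIcc.2 (Or.inl ⟨hx.2, hlt.le⟩))))
      (fun x hx hxI => hoff x hx (hsub x hxI))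
      (by rw [Finset.card_erase_of_mem hzZ, hn]; rfl)
    rw [← Finset.add_sum_erase _ _ hzZ]
    exact (w₁.trans hA hmT w₂).congr (piece_trans γ hγ hsm hmt h).symm

end Words

section TreeAlphabet

open Set Metric

variable {R : ℝ} {N : Finset ℂ} {a : ℂ → ℝ → ℂ} {anc : ℂ → Finset ℂ} {V : Set ℂ} {b : ↥Vᶜ}

/-- The relative interiors of the strands. -/
def openStrands (a : ℂ → ℝ → ℂ) (N : Finset ℂ) : Set ℂ := ⋃ p ∈ N, a p '' Ioo 0 1

theorem ArcTree.exists_alphabet (hT : ArcTree R N a anc) (hV : V.Finite) (hVN : ∀ w ∈ V, w ∈ N)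
    (hb : (b : ℂ) ∉ far R ∪ strands a N) :
    ∃ Λ : Set (FundamentalGroup ↥Vᶜ b), Λ.Finite ∧ Λ.ncard ≤ 3 * 2 ^ V.ncard + 1 ∧
      Alphabet b (far R ∪ strands a N) (openStrands a N) Λ := by
  classical
  obtain ⟨S, hS, h⟩ := hT.exists_letters hV hVN hb
  have hVT : V ⊆ far R ∪ strands a N := fun w hw => Or.inr (hT.mem_strands (hVN w hw) subset_rfl)
  let S' : Set (FundamentalGroup ↥Vᶜ b) := (S : Set (Path.Homotopic.Quotient b b))
  have hS' : S'.Finite := S.finite_toSet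
  refine ⟨insert 1 S', hS'.insert 1, (ncard_insert_le _ _).trans
    (Nat.add_le_add_right ?_ 1), hVT, ?_, mem_insert _ _, ?_, ?_, ?_⟩
  · refine le_trans (le_of_eq ?_) hS
    exact ncard_coe_finset S
  · exact fun z hz => Or.inr (iUnion₂_mono (fun p _ => image_mono Ioo_subset_Icc_self) hz)
  · intro κ hκ
    refine Path.Homotopic.Quotient.eq.2 (homotopic_of_joinedFar hV κ (Path.refl b) fun w hw => ?_)
    refine hT.joinedFar (isCompact_pathsRange _ _) (hVN w hw) ?_
    rw [disjoint_left]
    intro z hz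
    have hz' : z ∈ far R ∪ strands a N :=
      hz.imp_right fun h => strands_mono (hT.anc_subset w (hVN w hw)) h
    rintro (⟨t, rfl⟩ | ⟨t, rfl⟩)
    · exact hκ t hz'
    · exact hb hz'
  · intro κ t₀ h₀ ht
    obtain ⟨j, hj, s, hs, he⟩ := mem_iUnion₂.1 h₀
    exact Or.inr (h κ j ⟨hj, s, hs, t₀, he.symm, ht⟩)
  · intro x hx
    have ho : IsOpen (far R ∪ strands a N)ᶜ := hT.isClosed.isOpen_compl
    have hp : IsPathConnected (far R ∪ strands a N)ᶜ :=
      ho.isConnected_iff_isPathConnected.1 ⟨⟨b, hb⟩, hT.isPreconnected_compl⟩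
    obtain ⟨p, hp⟩ := hp.joinedIn b hb x hx
    refine ⟨⟨⟨fun t => ⟨p t, fun hv => hp t (hVT hv)⟩, by fun_prop⟩, ?_, ?_⟩, hp⟩
    · exact Subtype.ext p.source
    · exact Subtype.ext p.target

end TreeAlphabet

section Grow

open Set Metric

variable {R : ℝ} {N : Finset ℂ} {a : ℂ → ℝ → ℂ} {anc : ℂ → Finset ℂ}

theorem strands_insert (p : ℂ) (A : Finset ℂ) :
    strands a (insert p A) = strands a A ∪ a p '' Icc 0 1 := by
  rw [strands, Finset.set_biUnion_insert, union_comm]; rfl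

theorem strands_update {p : ℂ} {A : Finset ℂ} (hp : p ∉ A) (α : ℝ → ℂ) :
    strands (Function.update a p α) A = strands a A :=
  iUnion₂_congr fun i hi => by rw [Function.update_of_ne fun h : i = p => hp (h ▸ hi)]

theorem arcTree_empty (hR : 0 < R) (a : ℂ → ℝ → ℂ) (anc : ℂ → Finset ℂ) : ArcTree R ∅ a anc where
  pos := hR
  cont := by simp
  inj := by simp
  zero := by simp
  norm_lt := by simp
  disj := by simp
  anc_subset := by simp
  mem_anc := by simp
  anc_trans := by simp
  anc_total := by simp
  root := by simp
  parent := by simp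
  between := by simp
  logs := by simpa [strands] using hasLogs_far R

namespace ArcTree

theorem grow (hT : ArcTree R N a anc) {p : ℂ} (hp : p ∉ N) {α : ℝ → ℂ} (hα : Continuous α)
    (hinj : InjOn α (Icc 0 1)) (h0 : α 0 = p) (hd : ∀ t ∈ Ico (0 : ℝ) 1, α t ∉ far R ∪ strands a N)
    {A : Finset ℂ} (hA : A ⊆ N) (hanc : ∀ i ∈ A, anc i ⊆ A)
    (htot : ∀ i ∈ A, ∀ j ∈ A, i ∈ anc j ∨ j ∈ anc i) (hroot : IsPreconnected (far R ∪ strands a A))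
    (h1 : α 1 ∈ far R ∪ strands a A)
    (hbet : ∀ i ∈ A, IsPreconnected ({i} ∪ strands a (A \ anc i)) ∧ α 1 ∈ {i} ∪ strands a (A \ anc i))
    (hend : ∀ j ∈ N, ∀ t ∈ Ioo (0 : ℝ) 1, a j t ≠ α 1) :
    ArcTree R (insert p N) (Function.update a p α) (Function.update anc p (insert p A)) := by
  have hα1 : α 1 ∈ α '' Icc 0 1 := ⟨1, by simp, rfl⟩
  have hα0 : p ∈ α '' Icc 0 1 := ⟨0, by simp, h0⟩
  have harc : IsPreconnected (α '' Icc 0 1) := isPreconnected_Icc.image _ hα.continuousOn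
  have hpA : p ∉ A := fun h => hp (hA h)
  have hne : ∀ {i}, i ∈ N → i ≠ p := fun hi h => hp (h ▸ hi)
  have hancN : ∀ {i}, i ∈ N → Function.update anc p (insert p A) i = anc i := fun hi =>
    Function.update_of_ne (hne hi) _ _
  have haN : ∀ {i}, i ∈ N → Function.update a p α i = a i := fun hi =>
    Function.update_of_ne (hne hi) _ _
  have hsub : ∀ {B : Finset ℂ}, B ⊆ N → strands (Function.update a p α) B = strands a B := fun hB =>
    strands_update (fun h => hp (hB h)) α
  have hins : ∀ {B : Finset ℂ}, B ⊆ N → strands (Function.update a p α) (insert p B) =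
      strands a B ∪ α '' Icc 0 1 := fun hB => by
    rw [strands_insert, hsub hB, Function.update_self]
  refine ⟨hT.pos, ?_, ?_, ?_, ?_, ?_, ?_, ?_, ?_, ?_, ?_, ?_, ?_, ?_⟩
  · rw [Finset.forall_mem_insert, Function.update_self]
    exact ⟨hα, fun i hi => by rw [haN hi]; exact hT.cont i hi⟩
  · rw [Finset.forall_mem_insert, Function.update_self]
    exact ⟨hinj, fun i hi => by rw [haN hi]; exact hT.inj i hi⟩
  · rw [Finset.forall_mem_insert, Function.update_self]
    exact ⟨h0, fun i hi => by rw [haN hi]; exact hT.zero i hi⟩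
  · rw [Finset.forall_mem_insert, Function.update_self]
    exact ⟨fun t ht => not_le.1 fun h => hd t ht (Or.inl h),
      fun i hi => by rw [haN hi]; exact hT.norm_lt i hi⟩
  · rw [Finset.forall_mem_insert]
    constructor
    · rw [Finset.forall_mem_insert, Function.update_self]
      refine ⟨fun _ _ _ _ _ => rfl, fun q hq t ht s hs he => ?_⟩
      rw [haN hq] at he
      exact (hd t ⟨ht.1.le, ht.2⟩ (Or.inr (mem_biUnion hq ⟨s, hs, he.symm⟩))).elim
    · intro j hj
      rw [Finset.forall_mem_insert, Function.update_self]
      constructor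
      · intro t ht s hs he
        rw [haN hj] at he
        rcases hs.2.lt_or_eq with h | rfl
        · exact (hd s ⟨hs.1, h⟩ (Or.inr (mem_biUnion hj ⟨t, Ioo_subset_Icc_self ht, he⟩))).elim
        · exact absurd he (hend j hj t ht)
      · intro q hq
        rw [haN hj, haN hq]
        exact hT.disj j hj q hq
  · rw [Finset.forall_mem_insert, Function.update_self]
    exact ⟨Finset.insert_subset_insert _ hA, fun i hi => by
      rw [hancN hi]; exact (hT.anc_subset i hi).trans (Finset.subset_insert _ _)⟩
  · rw [Finset.forall_mem_insert, Function.update_self]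
    exact ⟨Finset.mem_insert_self _ _, fun i hi => by rw [hancN hi]; exact hT.mem_anc i hi⟩
  · rw [Finset.forall_mem_insert, Function.update_self]
    refine ⟨?_, fun j hj i hi => ?_⟩
    · rw [Finset.forall_mem_insert, Function.update_self]
      exact ⟨subset_rfl, fun i hi => by
        rw [hancN (hA hi)]; exact (hanc i hi).trans (Finset.subset_insert _ _)⟩
    · rw [hancN hj] at hi ⊢
      rw [hancN (hT.anc_subset j hj hi)]
      exact hT.anc_trans j hj i hi
  · rw [Finset.forall_mem_insert, Function.update_self]
    refine ⟨?_, fun q hq i hi j hj => ?_⟩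
    · intro i hi j hj
      rcases Finset.mem_insert.1 hi with rfl | hi'
      · right
        rwa [Function.update_self]
      · rcases Finset.mem_insert.1 hj with rfl | hj'
        · left
          rwa [Function.update_self]
        · rw [hancN (hA hi'), hancN (hA hj')]
          exact htot i hi' j hj'
    · rw [hancN hq] at hi hj
      rw [hancN (hT.anc_subset q hq hi), hancN (hT.anc_subset q hq hj)]
      exact hT.anc_total q hq i hi j hj
  · rw [Finset.forall_mem_insert, Function.update_self]
    refine ⟨?_, fun i hi => ?_⟩
    · rw [hins hA, ← union_assoc]
      exact hroot.union (α 1) h1 hα1 harc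
    · rw [hancN hi, hsub (hT.anc_subset i hi)]
      exact hT.root i hi
  · rw [Finset.forall_mem_insert, Function.update_self, Function.update_self,
      Finset.erase_insert hpA, hsub hA]
    refine ⟨⟨hroot, h1⟩, fun i hi => ?_⟩
    rw [hancN hi, haN hi, hsub ((Finset.erase_subset _ _).trans (hT.anc_subset i hi))]
    exact hT.parent i hi
  · rw [Finset.forall_mem_insert, Function.update_self]
    refine ⟨?_, fun q hq i hi => ?_⟩
    · rw [Finset.forall_mem_insert, Function.update_self]
      refine ⟨?_, fun i hi => ?_⟩
      · simpa [strands] using isPreconnected_singleton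
      · have : insert p A \ anc i = insert p (A \ anc i) :=
          Finset.insert_sdiff_of_notMem _ fun h => hp (hT.anc_subset i (hA hi) h)
        rw [hancN (hA hi), this, hins (Finset.sdiff_subset.trans hA), ← union_assoc]
        obtain ⟨hc, hm⟩ := hbet i hi
        exact ⟨hc.union (α 1) hm hα1 harc, Or.inr hα0⟩
    · rw [hancN hq] at hi ⊢
      rw [hancN (hT.anc_subset q hq hi), hsub (Finset.sdiff_subset.trans (hT.anc_subset q hq))]
      exact hT.between q hq i hi
  · rw [hins subset_rfl, ← union_assoc]
    refine hT.logs.union_arc hT.isClosed hα hinj ?_ hd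
    exact h1.imp_right fun h => strands_mono hA h

theorem exists_grow (hT : ArcTree R N a anc) {p : ℂ} (hp : p ∉ N) {α : ℝ → ℂ}
    (hα : Continuous α) (hinj : InjOn α (Icc 0 1)) (h0 : α 0 = p)
    (hd : ∀ t ∈ Ico (0 : ℝ) 1, α t ∉ far R ∪ strands a N) (h1 : α 1 ∈ N ∨ α 1 ∈ far R) :
    ∃ anc', ArcTree R (insert p N) (Function.update a p α) anc' := by
  rcases h1 with h1 | h1
  · refine ⟨_, hT.grow hp hα hinj h0 hd (hT.anc_subset _ h1) (hT.anc_trans _ h1) (hT.anc_total _ h1)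
      (hT.root _ h1) (Or.inr (hT.mem_strands (hT.mem_anc _ h1) (hT.anc_subset _ h1)))
      (hT.between _ h1) fun j hj t ht he => ?_⟩
    have h2 := hT.disj j hj _ h1 t ht 0 (by simp) (by rw [hT.zero _ h1, he])
    exact ht.1.ne' (hT.inj j hj (Ioo_subset_Icc_self ht) (by simp) (by rw [he, ← h2, hT.zero j hj]))
  · refine ⟨_, hT.grow (A := ∅) hp hα hinj h0 hd (by simp) (by simp) (by simp)
      ?_ (Or.inl h1) (by simp) fun j hj t ht he => ?_⟩
    · simpa [strands] using isPreconnected_far hT.pos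
    · exact absurd (hT.norm_lt j hj t ⟨ht.1.le, ht.2⟩) (not_lt.2 (he ▸ h1))

end ArcTree

end Grow

section Radii

open Set Metric Filter Topology

variable {ι : Type*} {g : ι → ℝ → ℂ} {P : Finset ℂ} {r R₀ : ℝ}

/-- A family of curves parametrized by `[0, 1]` that coincide with each other, and with themselves, only in
the finite set `P`, which each of them meets finitely often. -/
structure CurveSystem (g : ι → ℝ → ℂ) (P : Finset ℂ) : Prop where
  cont : ∀ i, Continuous (g i)
  coincide : ∀ i j, ∀ t ∈ Icc (0 : ℝ) 1, ∀ s ∈ Icc (0 : ℝ) 1, g i t = g j s →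
    g i t ∈ P ∨ (i = j ∧ t = s)
  finite : ∀ i, {t ∈ Icc (0 : ℝ) 1 | g i t ∈ P}.Finite

/-- Radii `r < R₀` of discs around the points of `P` that the curves only enter near these points. -/
structure Radii (g : ι → ℝ → ℂ) (P : Finset ℂ) (r R₀ : ℝ) : Prop where
  pos : 0 < r
  lt : r < R₀
  sep : ∀ p ∈ P, ∀ q ∈ P, p ≠ q → 2 * R₀ ≤ dist p q
  near : ∀ i, ∀ p ∈ P, ∀ t ∈ Icc (0 : ℝ) 1, g i t ∈ closedBall p r →
    ∃ t₀ ∈ Icc (0 : ℝ) 1, g i t₀ = p ∧ ∀ y ∈ uIcc t t₀, g i y ∈ ball p R₀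
  good : ∀ i, ∀ t ∈ Icc (0 : ℝ) 1, ∀ t' ∈ Icc (0 : ℝ) 1, t < t' → g i t ∈ P → g i t' ∈ P →
    ∃ y ∈ Ioo t t', ∀ p ∈ P, g i y ∉ ball p R₀

theorem exists_near {γ : ℝ → ℂ} (hγ : Continuous γ) (p : ℂ) (hR : 0 < R₀) :
    ∀ᶠ r in 𝓝[>] (0 : ℝ), ∀ t ∈ Icc (0 : ℝ) 1, γ t ∈ closedBall p r →
      ∃ t₀ ∈ Icc (0 : ℝ) 1, γ t₀ = p ∧ ∀ y ∈ uIcc t t₀, γ y ∈ ball p R₀ := by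
  obtain ⟨δ, hδ, hu⟩ := Metric.uniformContinuousOn_iff.1
    (isCompact_Icc.uniformContinuousOn_of_continuous (s := Icc (0 : ℝ) 1) hγ.continuousOn) R₀ hR
  let O : Set ℝ := thickening δ {t ∈ Icc (0 : ℝ) 1 | γ t = p}
  have hO : ∀ t ∈ Icc (0 : ℝ) 1, t ∈ O →
      ∃ t₀ ∈ Icc (0 : ℝ) 1, γ t₀ = p ∧ ∀ y ∈ uIcc t t₀, γ y ∈ ball p R₀ := by
    intro t ht htO
    obtain ⟨t₀, ⟨ht₀, hp⟩, hd⟩ := mem_thickening_iff.1 htO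
    refine ⟨t₀, ht₀, hp, fun y hy => ?_⟩
    rw [mem_ball, ← hp]
    refine hu y (uIcc_subset_Icc ht ht₀ hy) t₀ ht₀ (lt_of_le_of_lt ?_ hd)
    rw [dist_comm, dist_comm t, Real.dist_eq, Real.dist_eq, abs_sub_comm t₀ t]
    exact (abs_sub_right_of_mem_uIcc hy).trans (le_of_eq (abs_sub_comm _ _))
  have hK : IsCompact (Icc (0 : ℝ) 1 \ O) := isCompact_Icc.diff isOpen_thickening
  rcases (Icc (0 : ℝ) 1 \ O).eq_empty_or_nonempty with h | h
  · exact Eventually.of_forall fun r t ht _ => hO t ht (by_contra fun h' => (h ▸ ⟨ht, h'⟩ : t ∈ (∅ : Set ℝ)))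
  · obtain ⟨x, hx, hmin⟩ := hK.exists_isMinOn h (f := fun t => dist (γ t) p)
      (by fun_prop)
    have hpos : 0 < dist (γ x) p := by
      rw [dist_pos]
      exact fun he => hx.2 (self_subset_thickening hδ _ ⟨hx.1, he⟩)
    filter_upwards [Ioo_mem_nhdsGT hpos] with r hr t ht htr
    refine hO t ht (by_contra fun h' => ?_)
    have : dist (γ x) p ≤ dist (γ t) p := hmin ⟨ht, h'⟩
    exact absurd (this.trans (mem_closedBall.1 htr)) (not_le.2 hr.2)

theorem eventually_notMem_ball {z : ℂ} (hz : z ∉ P) : ∀ᶠ R in 𝓝[>] (0 : ℝ), ∀ p ∈ P, z ∉ ball p R := by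
  rw [P.eventually_all]
  intro p hp
  have hpos : 0 < dist z p := dist_pos.2 fun h => hz (h ▸ hp)
  filter_upwards [Ioo_mem_nhdsGT hpos] with R hR
  rw [mem_ball, not_lt]
  exact hR.2.le

theorem CurveSystem.exists_radii [Finite ι] (h : CurveSystem g P) : ∃ r R₀, Radii g P r R₀ := by
  have hsep : ∀ᶠ R in 𝓝[>] (0 : ℝ), ∀ p ∈ P, ∀ q ∈ P, p ≠ q → 2 * R ≤ dist p q := by
    simp only [P.eventually_all, eventually_imp_distrib_left]
    intro p hp q hq hpq
    filter_upwards [Ioo_mem_nhdsGT (half_pos (dist_pos.2 hpq))] with R hR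
    linarith [hR.2]
  have hgood : ∀ᶠ R in 𝓝[>] (0 : ℝ), ∀ i, ∀ t ∈ (h.finite i).toFinset, ∀ t' ∈ (h.finite i).toFinset, t < t' →
      ∃ y ∈ Ioo t t', ∀ p ∈ P, g i y ∉ ball p R := by
    simp only [eventually_all, Finset.eventually_all]
    intro i t ht t' ht' htt
    obtain ⟨y, hy, hyP⟩ := (Ioo_infinite htt).exists_notMem_finite (h.finite i)
    rw [Finite.mem_toFinset] at ht ht'
    have : g i y ∉ P := fun h' => hyP ⟨⟨ht.1.1.trans hy.1.le, hy.2.le.trans ht'.1.2⟩, h'⟩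
    filter_upwards [eventually_notMem_ball this] with R hR
    exact ⟨y, hy, hR⟩
  obtain ⟨R₀, h1, h2, hR⟩ := (hsep.and (hgood.and self_mem_nhdsWithin)).exists
  have hnear : ∀ᶠ r in 𝓝[>] (0 : ℝ), ∀ i, ∀ p ∈ P, ∀ t ∈ Icc (0 : ℝ) 1, g i t ∈ closedBall p r →
      ∃ t₀ ∈ Icc (0 : ℝ) 1, g i t₀ = p ∧ ∀ y ∈ uIcc t t₀, g i y ∈ ball p R₀ := by
    simp only [eventually_all, Finset.eventually_all]
    exact fun i p _ => exists_near (h.cont i) p hR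
  obtain ⟨r, h3, hr⟩ := (hnear.and (Ioo_mem_nhdsGT hR)).exists
  refine ⟨r, R₀, hr.1, hr.2, h1, h3, fun i t ht t' ht' htt hp hp' => ?_⟩
  exact h2 i t (by simpa using ⟨ht, hp⟩) t' (by simpa using ⟨ht', hp'⟩) htt

theorem Radii.eq_of_dist_le (h : Radii g P r R₀) {x p q : ℂ} (hp : p ∈ P) (hq : q ∈ P) (hxp : dist x p ≤ r)
    (hxq : dist x q < R₀) : p = q := by
  by_contra hne
  have := h.sep p hp q hq hne
  have := dist_triangle_left p q x
  linarith [h.lt]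

/-- The times `τ < τ'` are consecutive times at which `γ` is in `P`. -/
def Consec (γ : ℝ → ℂ) (P : Finset ℂ) (τ τ' : ℝ) : Prop :=
  τ ∈ Icc (0 : ℝ) 1 ∧ τ' ∈ Icc (0 : ℝ) 1 ∧ τ < τ' ∧ γ τ ∈ P ∧ γ τ' ∈ P ∧ ∀ x ∈ Ioo τ τ', γ x ∉ P

/-- `u < v` are the last exit time from the disc about `γ τ` and the first entry time into the disc
about `γ τ'` as well. -/
structure Exits (γ : ℝ → ℂ) (P : Finset ℂ) (r R₀ τ τ' u v : ℝ) : Prop where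
  lt_left : τ < u
  lt : u < v
  lt_right : v < τ'
  dist_left : dist (γ u) (γ τ) = r
  dist_right : dist (γ v) (γ τ') = r
  near_left : ∀ x ∈ Ico τ u, γ x ∈ ball (γ τ) R₀
  near_right : ∀ x ∈ Ioc v τ', γ x ∈ ball (γ τ') R₀
  eq : ∀ x ∈ Icc u v, ∀ p ∈ P, dist (γ x) p ≤ r → (x = u ∧ p = γ τ) ∨ (x = v ∧ p = γ τ')
  good : ∃ y ∈ Ioo u v, ∀ p ∈ P, γ y ∉ ball p R₀

theorem Radii.exists_exits (h : Radii g P r R₀) (hg : ∀ i, Continuous (g i)) {i : ι} {τ τ' : ℝ}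
    (hc : Consec (g i) P τ τ') : ∃ u v, Exits (g i) P r R₀ τ τ' u v := by
  obtain ⟨hτ, hτ', hlt, hp, hq, hno⟩ := hc
  obtain ⟨y, hy, hyg⟩ := h.good i τ hτ τ' hτ' hlt hp hq
  have hφ : ∀ p, Continuous fun x => dist (g i x) p := fun p => by have := hg i; fun_prop
  have hyd : ∀ p ∈ P, r < dist (g i y) p := fun p hp =>
    h.lt.trans_le (not_lt.1 fun h' => hyg p hp h')
  obtain ⟨u, ⟨⟨hu1, hu2⟩, hur⟩, hmax⟩ := (isCompact_Icc.inter_right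
    (isClosed_le (hφ (g i τ)) continuous_const)).exists_isGreatest (s := Icc τ y ∩ {x | dist (g i x) (g i τ) ≤ r})
    ⟨τ, ⟨le_rfl, hy.1.le⟩, by simp [h.pos.le]⟩
  obtain ⟨v, ⟨⟨hv1, hv2⟩, hvr⟩, hmin⟩ := (isCompact_Icc.inter_right
    (isClosed_le (hφ (g i τ')) continuous_const)).exists_isLeast (s := Icc y τ' ∩ {x | dist (g i x) (g i τ') ≤ r})
    ⟨τ', ⟨hy.2.le, le_rfl⟩, by simp [h.pos.le]⟩
  rw [mem_ofPred_eq] at hur hvr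
  have huy : u < y := hu2.lt_of_ne fun h' => absurd hur (not_le.2 (h' ▸ hyd _ hp))
  have hyv : y < v := hv1.lt_of_ne fun h' => absurd hvr (not_le.2 (h' ▸ hyd _ hq))
  have hur' : dist (g i u) (g i τ) = r := by
    refine hur.eq_of_not_lt fun hlt' => ?_
    have := ((hφ (g i τ)).continuousAt.eventually_lt continuousAt_const hlt')
    obtain ⟨x, hx, hxu⟩ := ((this.filter_mono nhdsWithin_le_nhds).and (Ioo_mem_nhdsGT huy)).exists
    exact absurd (hmax ⟨⟨hu1.trans hxu.1.le, hxu.2.le⟩, hx.le⟩) (not_le.2 hxu.1)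
  have hvr' : dist (g i v) (g i τ') = r := by
    refine hvr.eq_of_not_lt fun hlt' => ?_
    have := ((hφ (g i τ')).continuousAt.eventually_lt continuousAt_const hlt')
    obtain ⟨x, hx, hxv⟩ := ((this.filter_mono nhdsWithin_le_nhds).and (Ioo_mem_nhdsLT hyv)).exists
    exact absurd (hmin ⟨⟨hxv.1.le, hxv.2.le.trans hv2⟩, hx.le⟩) (not_le.2 hxv.2)
  have hτu : τ < u := hu1.lt_of_ne fun h' => by subst h'; simp at hur'; exact h.pos.ne hur'
  have hvτ : v < τ' := hv2.lt_of_ne fun h' => by subst h'; simp at hvr'; exact h.pos.ne hvr'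
  have hside : ∀ x ∈ Icc τ τ', ∀ p ∈ P, dist (g i x) p ≤ r →
      (x < y ∧ p = g i τ ∧ ∀ z ∈ Icc τ x, g i z ∈ ball p R₀) ∨
      (y < x ∧ p = g i τ' ∧ ∀ z ∈ Icc x τ', g i z ∈ ball p R₀) := by
    intro x hx p hpP hd
    obtain ⟨t₀, ht₀, he, hb⟩ := h.near i p hpP x ⟨hτ.1.trans hx.1, hx.2.trans hτ'.2⟩ hd
    have ht : t₀ ≤ τ ∨ τ' ≤ t₀ := by
      by_contra! hcon
      exact hno t₀ hcon (he ▸ hpP)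
    rcases ht with ht | ht
    · left
      have hxy : x < y := by
        by_contra! hcon
        exact hyg p hpP (hb y (mem_uIcc.2 (Or.inr ⟨ht.trans hy.1.le, hcon⟩)))
      have hz : ∀ z ∈ Icc τ x, g i z ∈ ball p R₀ := fun z hz => hb z (mem_uIcc.2 (Or.inr ⟨ht.trans hz.1, hz.2⟩))
      refine ⟨hxy, ?_, hz⟩
      exact (h.eq_of_dist_le hp hpP (by simp [h.pos.le]) (hz τ ⟨le_rfl, hx.1⟩)).symm
    · right
      have hxy : y < x := by
        by_contra! hcon
        exact hyg p hpP (hb y (mem_uIcc.2 (Or.inl ⟨hcon, hy.2.le.trans ht⟩)))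
      have hz : ∀ z ∈ Icc x τ', g i z ∈ ball p R₀ := fun z hz => hb z (mem_uIcc.2 (Or.inl ⟨hz.1, hz.2.trans ht⟩))
      refine ⟨hxy, ?_, hz⟩
      exact (h.eq_of_dist_le hq hpP (by simp [h.pos.le]) (hz τ' ⟨hx.2, le_rfl⟩)).symm
  have hul : ∀ z ∈ Icc τ u, g i z ∈ ball (g i τ) R₀ := by
    rcases hside u ⟨hu1, huy.le.trans hy.2.le⟩ _ hp hur with h1 | h1
    · exact h1.2.2
    · exact absurd h1.1 (not_lt.2 hu2)
  have hvl : ∀ z ∈ Icc v τ', g i z ∈ ball (g i τ') R₀ := by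
    rcases hside v ⟨hy.1.le.trans hv1, hv2⟩ _ hq hvr with h1 | h1
    · exact absurd h1.1 (not_lt.2 hv1)
    · exact h1.2.2
  refine ⟨u, v, hτu, huy.trans hyv, hvτ, hur', hvr', fun x hx => hul x ⟨hx.1, hx.2.le⟩,
    fun x hx => hvl x ⟨hx.1.le, hx.2⟩, fun x hx p hpP hd => ?_, y, ⟨huy, hyv⟩, hyg⟩
  rcases hside x ⟨hu1.trans hx.1, hx.2.trans hv2⟩ p hpP hd with ⟨h1, rfl, -⟩ | ⟨h1, rfl, -⟩
  · exact Or.inl ⟨le_antisymm (hmax ⟨⟨hu1.trans hx.1, h1.le⟩, hd⟩) hx.1, rfl⟩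
  · exact Or.inr ⟨le_antisymm hx.2 (hmin ⟨⟨h1.le, hx.2.trans hv2⟩, hd⟩), rfl⟩

end Radii

section Strands

open Set Metric

/-- `S` is an arc from `x` to `y`. -/
def IsArc (S : Set ℂ) (x y : ℂ) : Prop :=
  ∃ α : ℝ → ℂ, Continuous α ∧ InjOn α (Icc 0 1) ∧ α '' Icc 0 1 = S ∧ α 0 = x ∧ α 1 = y

theorem IsArc.symm {S : Set ℂ} {x y : ℂ} (h : IsArc S x y) : IsArc S y x := by
  obtain ⟨α, hα, hi, rfl, rfl, rfl⟩ := h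
  have hmem : ∀ t ∈ Icc (0 : ℝ) 1, 1 - t ∈ Icc (0 : ℝ) 1 := fun t ht =>
    ⟨by linarith [ht.2], by linarith [ht.1]⟩
  refine ⟨fun t => α (1 - t), by fun_prop, fun s hs t ht he => ?_, ?_, by simp, by simp⟩
  · linarith [hi (hmem s hs) (hmem t ht) he]
  · ext z
    constructor
    · rintro ⟨t, ht, rfl⟩
      exact ⟨1 - t, hmem t ht, rfl⟩
    · rintro ⟨t, ht, rfl⟩
      exact ⟨1 - t, hmem t ht, by simp⟩

theorem IsArc.trans {S S' : Set ℂ} {x y z : ℂ} (h : IsArc S x y) (h' : IsArc S' y z)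
    (hd : ∀ w ∈ S, w ∈ S' → w = y) : IsArc (S ∪ S') x z := by
  obtain ⟨α, hα, hi, rfl, rfl, rfl⟩ := h
  obtain ⟨β, hβ, hi', rfl, h0, rfl⟩ := h'
  have h1 : ∀ t ∈ Icc (0 : ℝ) 1, t ≤ 1 / 2 → 2 * t ∈ Icc (0 : ℝ) 1 := fun t ht h =>
    ⟨by linarith [ht.1], by linarith⟩
  have h2 : ∀ t ∈ Icc (0 : ℝ) 1, ¬ t ≤ 1 / 2 → 2 * t - 1 ∈ Icc (0 : ℝ) 1 := fun t ht h =>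
    ⟨by linarith [not_le.1 h], by linarith [ht.2]⟩
  have key : ∀ s ∈ Icc (0 : ℝ) 1, ∀ t ∈ Icc (0 : ℝ) 1, s ≤ 1 / 2 → ¬ t ≤ 1 / 2 → α (2 * s) ≠ β (2 * t - 1) := by
    intro s hs t ht hs' ht' he
    have := hd _ ⟨_, h1 s hs hs', rfl⟩ ⟨_, h2 t ht ht', he.symm⟩
    rw [he, ← h0] at this
    linarith [hi' (h2 t ht ht') (by simp) this, not_le.1 ht']
  refine ⟨fun t => if t ≤ 1 / 2 then α (2 * t) else β (2 * t - 1), ?_, ?_, ?_, ?_, ?_⟩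
  · refine Continuous.if_le (by fun_prop) (by fun_prop) continuous_id continuous_const ?_
    rintro t rfl
    norm_num [h0]
  · intro s hs t ht he
    simp only at he
    split_ifs at he with a b b
    · linarith [hi (h1 s hs a) (h1 t ht b) he]
    · exact absurd he (key s hs t ht a b)
    · exact absurd he.symm (key t ht s hs b a)
    · linarith [hi' (h2 s hs a) (h2 t ht b) he]
  · ext w
    constructor
    · rintro ⟨t, ht, rfl⟩
      simp only
      split_ifs with a
      · exact Or.inl ⟨_, h1 t ht a, rfl⟩
      · exact Or.inr ⟨_, h2 t ht a, rfl⟩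
    · rintro (⟨t, ht, rfl⟩ | ⟨t, ht, rfl⟩)
      · refine ⟨t / 2, ⟨by linarith [ht.1], by linarith [ht.2]⟩, ?_⟩
        simp only
        rw [if_pos (by linarith [ht.2])]
        congr 1; ring
      · rcases ht.1.eq_or_lt with rfl | hlt
        · exact ⟨1 / 2, by norm_num, by norm_num [h0]⟩
        · refine ⟨(t + 1) / 2, ⟨by linarith, by linarith [ht.2]⟩, ?_⟩
          simp only
          rw [if_neg (by linarith)]
          congr 1; ring
  · norm_num
  · norm_num

theorem isArc_segment {x y : ℂ} (h : x ≠ y) : IsArc (segment ℝ x y) x y := by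
  refine ⟨fun t => x + t • (y - x), by fun_prop, fun s _ t _ he => ?_, (segment_eq_image' ℝ x y).symm,
    by simp, by simp⟩
  simpa [sub_ne_zero.2 h.symm] using he

theorem isArc_image {γ : ℝ → ℂ} (hγ : Continuous γ) {u v : ℝ} (huv : u < v) (hi : InjOn γ (Icc u v)) :
    IsArc (γ '' Icc u v) (γ u) (γ v) := by
  have hmem : ∀ t ∈ Icc (0 : ℝ) 1, u + t * (v - u) ∈ Icc u v := fun t ht =>
    ⟨by nlinarith [ht.1], by nlinarith [ht.2]⟩
  refine ⟨fun t => γ (u + t * (v - u)), by fun_prop, fun s hs t ht he => ?_, ?_, by simp, by simp⟩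
  · have := hi (hmem s hs) (hmem t ht) he
    have := mul_right_cancel₀ (sub_ne_zero.2 huv.ne') (add_left_cancel this)
    exact this
  · ext z
    constructor
    · rintro ⟨t, ht, rfl⟩
      exact ⟨_, hmem t ht, rfl⟩
    · rintro ⟨t, ht, rfl⟩
      have h0 : 0 < v - u := sub_pos.2 huv
      refine ⟨(t - u) / (v - u), ⟨div_nonneg (by linarith [ht.1]) h0.le, (div_le_one h0).2 (by linarith [ht.2])⟩, ?_⟩
      simp only
      rw [div_mul_cancel₀ _ h0.ne']
      congr 1; ring

theorem dist_of_mem_segment {p y x : ℂ} {r : ℝ} (hy : dist y p = r) (hx : x ∈ segment ℝ p y) :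
    ∃ θ ∈ Icc (0 : ℝ) 1, x = p + θ • (y - p) ∧ dist x p = θ * r := by
  rw [segment_eq_image'] at hx
  obtain ⟨θ, hθ, rfl⟩ := hx
  refine ⟨θ, hθ, rfl, ?_⟩
  simp only [dist_eq_norm] at hy ⊢
  rw [add_sub_cancel_left, norm_smul, hy, Real.norm_of_nonneg hθ.1]

theorem dist_le_of_mem_segment {p y x : ℂ} {r : ℝ} (hr : 0 < r) (hy : dist y p = r) (hx : x ∈ segment ℝ p y) :
    dist x p < r ∨ x = y := by
  obtain ⟨θ, hθ, rfl, hd⟩ := dist_of_mem_segment hy hx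
  rcases hθ.2.lt_or_eq with h | rfl
  · left; rw [hd]; nlinarith
  · right; simp

theorem eq_of_mem_segments {p y y' x : ℂ} {r : ℝ} (hr : 0 < r) (hy : dist y p = r) (hy' : dist y' p = r)
    (hx : x ∈ segment ℝ p y) (hx' : x ∈ segment ℝ p y') (hxp : x ≠ p) : y = y' := by
  obtain ⟨θ, hθ, h1, hd⟩ := dist_of_mem_segment hy hx
  obtain ⟨θ', hθ', h2, hd'⟩ := dist_of_mem_segment hy' hx'
  have he : θ = θ' := mul_right_cancel₀ hr.ne' (hd.symm.trans hd')
  subst he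
  have h0 : θ ≠ 0 := fun h => hxp (by simpa [h] using h1)
  have := add_left_cancel (h1.symm.trans h2)
  exact sub_left_injective (smul_right_injective ℂ h0 this)

variable {ι : Type*} {g : ι → ℝ → ℂ} {P : Finset ℂ} {r R₀ : ℝ}

/-- The curve `γ` from time `τ` to `τ'`, made radial before time `u` and after time `v`. -/
def strand (γ : ℝ → ℂ) (τ τ' u v : ℝ) : Set ℂ :=
  segment ℝ (γ τ) (γ u) ∪ (γ '' Icc u v ∪ segment ℝ (γ τ') (γ v))

/-- The times defining a strand. -/
def IsStrand (g : ι → ℝ → ℂ) (P : Finset ℂ) (r R₀ : ℝ) (i : ι) (τ τ' u v : ℝ) : Prop :=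
  Consec (g i) P τ τ' ∧ Exits (g i) P r R₀ τ τ' u v

theorem Consec.unique {γ : ℝ → ℂ} {τ τ' ρ' : ℝ} (h : Consec γ P τ τ') (h' : Consec γ P τ ρ') : τ' = ρ' := by
  by_contra hne
  rcases lt_or_gt_of_ne hne with hlt | hlt
  · exact h'.2.2.2.2.2 τ' ⟨h.2.2.1, hlt⟩ h.2.2.2.2.1
  · exact h.2.2.2.2.2 ρ' ⟨h'.2.2.1, hlt⟩ h'.2.2.2.2.1

theorem Consec.unique_right {γ : ℝ → ℂ} {τ τ' ρ : ℝ} (h : Consec γ P τ τ') (h' : Consec γ P ρ τ') : τ = ρ := by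
  by_contra hne
  rcases lt_or_gt_of_ne hne with hlt | hlt
  · exact h.2.2.2.2.2 ρ ⟨hlt, h'.2.2.1⟩ h'.2.2.2.1
  · exact h'.2.2.2.2.2 τ ⟨hlt, h.2.2.1⟩ h.2.2.2.1

theorem Exits.unique {γ : ℝ → ℂ} {τ τ' u v u' v' : ℝ} (hp : γ τ ∈ P) (hq : γ τ' ∈ P)
    (h : Exits γ P r R₀ τ τ' u v)
    (h' : Exits γ P r R₀ τ τ' u' v') : u = u' ∧ v = v' := by
  obtain ⟨y, hy, hyg⟩ := h.good
  obtain ⟨y', hy', hyg'⟩ := h'.good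
  have h1 : u' ≤ y := not_lt.1 fun hlt => hyg _ hp (h'.near_left y ⟨(h.lt_left.trans hy.1).le, hlt⟩)
  have h1' : u ≤ y' := not_lt.1 fun hlt => hyg' _ hp (h.near_left y' ⟨(h'.lt_left.trans hy'.1).le, hlt⟩)
  have h2 : y ≤ v' := not_lt.1 fun hlt => hyg _ hq (h'.near_right y ⟨hlt, (hy.2.trans h.lt_right).le⟩)
  have h2' : y' ≤ v := not_lt.1 fun hlt => hyg' _ hq (h.near_right y' ⟨hlt, (hy'.2.trans h'.lt_right).le⟩)
  constructor
  · rcases le_total u u' with hle | hle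
    · rcases h.eq u' ⟨hle, h1.trans hy.2.le⟩ _ hp h'.dist_left.le with h3 | h3
      · exact h3.1.symm
      · linarith [hy.2]
    · rcases h'.eq u ⟨hle, h1'.trans hy'.2.le⟩ _ hp h.dist_left.le with h3 | h3
      · exact h3.1
      · linarith [hy'.2]
  · rcases le_total v v' with hle | hle
    · rcases h'.eq v ⟨hy'.1.le.trans h2', hle⟩ _ hq h.dist_right.le with h3 | h3
      · linarith [hy'.1]
      · exact h3.1
    · rcases h.eq v' ⟨hy.1.le.trans h2, hle⟩ _ hq h'.dist_right.le with h3 | h3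
      · linarith [hy.1]
      · exact h3.1.symm

namespace IsStrand

variable {i : ι} {τ τ' u v : ℝ}

theorem mem_Ioo (h : IsStrand g P r R₀ i τ τ' u v) {t : ℝ} (ht : t ∈ Icc u v) : t ∈ Ioo τ τ' :=
  ⟨h.2.lt_left.trans_le ht.1, ht.2.trans_lt h.2.lt_right⟩

theorem mem_Icc (h : IsStrand g P r R₀ i τ τ' u v) {t : ℝ} (ht : t ∈ Icc u v) : t ∈ Icc (0 : ℝ) 1 :=
  ⟨h.1.1.1.trans (h.mem_Ioo ht).1.le, (h.mem_Ioo ht).2.le.trans h.1.2.1.2⟩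

theorem notMem (h : IsStrand g P r R₀ i τ τ' u v) {t : ℝ} (ht : t ∈ Icc u v) : g i t ∉ P :=
  h.1.2.2.2.2.2 t (h.mem_Ioo ht)

theorem near (hR : Radii g P r R₀) (h : IsStrand g P r R₀ i τ τ' u v) {x p : ℂ}
    (hx : x ∈ strand (g i) τ τ' u v) (hp : p ∈ P) (hd : dist x p ≤ r) :
    (p = g i τ ∧ x ∈ segment ℝ p (g i u)) ∨ (p = g i τ' ∧ x ∈ segment ℝ p (g i v)) := by
  rcases hx with hx | ⟨t, ht, rfl⟩ | hx
  · left
    have h1 : dist x (g i τ) < R₀ := by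
      rcases dist_le_of_mem_segment hR.pos h.2.dist_left hx with h1 | rfl
      · exact h1.trans hR.lt
      · rw [h.2.dist_left]; exact hR.lt
    have := hR.eq_of_dist_le hp h.1.2.2.2.1 hd h1
    subst this
    exact ⟨rfl, hx⟩
  · rcases h.2.eq t ht p hp hd with ⟨rfl, rfl⟩ | ⟨rfl, rfl⟩
    · exact Or.inl ⟨rfl, right_mem_segment _ _ _⟩
    · exact Or.inr ⟨rfl, right_mem_segment _ _ _⟩
  · right
    have h1 : dist x (g i τ') < R₀ := by
      rcases dist_le_of_mem_segment hR.pos h.2.dist_right hx with h1 | rfl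
      · exact h1.trans hR.lt
      · rw [h.2.dist_right]; exact hR.lt
    have := hR.eq_of_dist_le hp h.1.2.2.2.2.1 hd h1
    subst this
    exact ⟨rfl, hx⟩

theorem mid_or_near (hR : Radii g P r R₀) (h : IsStrand g P r R₀ i τ τ' u v) {x : ℂ}
    (hx : x ∈ strand (g i) τ τ' u v) : (∃ t ∈ Icc u v, g i t = x) ∨ ∃ p ∈ P, dist x p < r := by
  rcases hx with hx | ⟨t, ht, rfl⟩ | hx
  · rcases dist_le_of_mem_segment hR.pos h.2.dist_left hx with h1 | rfl
    · exact Or.inr ⟨_, h.1.2.2.2.1, h1⟩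
    · exact Or.inl ⟨u, ⟨le_rfl, h.2.lt.le⟩, rfl⟩
  · exact Or.inl ⟨t, ht, rfl⟩
  · rcases dist_le_of_mem_segment hR.pos h.2.dist_right hx with h1 | rfl
    · exact Or.inr ⟨_, h.1.2.2.2.2.1, h1⟩
    · exact Or.inl ⟨v, ⟨h.2.lt.le, le_rfl⟩, rfl⟩

theorem sphere (hR : Radii g P r R₀) (h : IsStrand g P r R₀ i τ τ' u v) {x p : ℂ}
    (hx : x ∈ strand (g i) τ τ' u v) (hp : p ∈ P) (hd : dist x p = r) :
    (p = g i τ ∧ x = g i u) ∨ (p = g i τ' ∧ x = g i v) := by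
  rcases h.near hR hx hp hd.le with ⟨rfl, hs⟩ | ⟨rfl, hs⟩
  · exact Or.inl ⟨rfl, (dist_le_of_mem_segment hR.pos h.2.dist_left hs).resolve_left hd.not_lt⟩
  · exact Or.inr ⟨rfl, (dist_le_of_mem_segment hR.pos h.2.dist_right hs).resolve_left hd.not_lt⟩

theorem mem_P (hR : Radii g P r R₀) (h : IsStrand g P r R₀ i τ τ' u v) {p : ℂ}
    (hx : p ∈ strand (g i) τ τ' u v) (hp : p ∈ P) : p = g i τ ∨ p = g i τ' := by
  rcases h.near hR hx hp (by simp [hR.pos.le]) with h | h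
  · exact Or.inl h.1
  · exact Or.inr h.1

theorem curve_near (hg : CurveSystem g P) (hR : Radii g P r R₀) (h : IsStrand g P r R₀ i τ τ' u v) {j : ι} {s : ℝ}
    (hs : s ∈ Icc (0 : ℝ) 1) (hij : i ≠ j) (hx : g j s ∈ strand (g i) τ τ' u v) : ∃ p ∈ P, dist (g j s) p < r := by
  rcases h.mid_or_near hR hx with ⟨t, ht, he⟩ | h1
  · exact ((hg.coincide i j t (h.mem_Icc ht) s hs he).elim (h.notMem ht) fun h => hij h.1).elim
  · exact h1

theorem eq_of_mem (hg : CurveSystem g P) (hR : Radii g P r R₀) (h : IsStrand g P r R₀ i τ τ' u v) {j : ι}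
    {ρ ρ' u' v' : ℝ} (h' : IsStrand g P r R₀ j ρ ρ' u' v') {x : ℂ} (hx : x ∈ strand (g i) τ τ' u v)
    (hx' : x ∈ strand (g j) ρ ρ' u' v') (hxP : x ∉ P) : i = j ∧ τ = ρ ∧ τ' = ρ' := by
  have mid : ∀ t ∈ Icc u v, ∀ s ∈ Icc u' v', g i t = g j s → i = j ∧ τ = ρ ∧ τ' = ρ' := by
    intro t ht s hs he
    obtain ⟨rfl, rfl⟩ := (hg.coincide i j t (h.mem_Icc ht) s (h'.mem_Icc hs) he).resolve_left (h.notMem ht)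
    have h1 := h.mem_Ioo ht
    have h2 := h'.mem_Ioo hs
    have hle : ∀ {a a' b b' : ℝ}, Consec (g i) P a a' → Consec (g i) P b b' → t ∈ Ioo a a' → t ∈ Ioo b b' →
        a ≤ b := fun ha hb hta htb => not_lt.1 fun hlt =>
      hb.2.2.2.2.2 _ ⟨hlt, hta.1.trans htb.2⟩ ha.2.2.2.1
    have he : τ = ρ := le_antisymm (hle h.1 h'.1 h1 h2) (hle h'.1 h.1 h2 h1)
    subst he
    exact ⟨rfl, rfl, h.1.unique h'.1⟩
  have huI : u ∈ Icc u v := ⟨le_rfl, h.2.lt.le⟩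
  have hvI : v ∈ Icc u v := ⟨h.2.lt.le, le_rfl⟩
  have huI' : u' ∈ Icc u' v' := ⟨le_rfl, h'.2.lt.le⟩
  have hvI' : v' ∈ Icc u' v' := ⟨h'.2.lt.le, le_rfl⟩
  by_cases hnear : ∃ p ∈ P, dist x p < r
  · obtain ⟨p, hp, hd⟩ := hnear
    have hxp : x ≠ p := fun h => hxP (h ▸ hp)
    have e1 : ∃ t ∈ Icc u v, dist (g i t) p = r ∧ x ∈ segment ℝ p (g i t) := by
      rcases h.near hR hx hp hd.le with ⟨rfl, hs⟩ | ⟨rfl, hs⟩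
      · exact ⟨u, huI, h.2.dist_left, hs⟩
      · exact ⟨v, hvI, h.2.dist_right, hs⟩
    have e2 : ∃ t ∈ Icc u' v', dist (g j t) p = r ∧ x ∈ segment ℝ p (g j t) := by
      rcases h'.near hR hx' hp hd.le with ⟨rfl, hs⟩ | ⟨rfl, hs⟩
      · exact ⟨u', huI', h'.2.dist_left, hs⟩
      · exact ⟨v', hvI', h'.2.dist_right, hs⟩
    obtain ⟨t, ht, hdt, hst⟩ := e1
    obtain ⟨t', ht', hdt', hst'⟩ := e2
    exact mid t ht t' ht' (eq_of_mem_segments hR.pos hdt hdt' hst hst' hxp)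
  · obtain ⟨t, ht, he⟩ := (h.mid_or_near hR hx).resolve_right hnear
    obtain ⟨t', ht', he'⟩ := (h'.mid_or_near hR hx').resolve_right hnear
    exact mid t ht t' ht' (he.trans he'.symm)

theorem isArc (hg : CurveSystem g P) (hR : Radii g P r R₀) (h : IsStrand g P r R₀ i τ τ' u v)
    (hne : g i τ ≠ g i τ') : IsArc (strand (g i) τ τ' u v) (g i τ) (g i τ') := by
  have hinj : InjOn (g i) (Icc u v) := fun s hs t ht he =>
    ((hg.coincide i i s (h.mem_Icc hs) t (h.mem_Icc ht) he).resolve_left (h.notMem hs)).2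
  have hl : g i τ ≠ g i u := fun he => by
    have := h.2.dist_left
    rw [he, dist_self] at this
    exact hR.pos.ne this
  have hr : g i τ' ≠ g i v := fun he => by
    have := h.2.dist_right
    rw [he, dist_self] at this
    exact hR.pos.ne this
  have hsl : ∀ x ∈ segment ℝ (g i τ) (g i u), dist x (g i τ) ≤ r := fun x hx => by
    rcases dist_le_of_mem_segment hR.pos h.2.dist_left hx with h1 | rfl
    · exact h1.le
    · exact h.2.dist_left.le
  have hsr : ∀ x ∈ segment ℝ (g i τ') (g i v), dist x (g i τ') ≤ r := fun x hx => by
    rcases dist_le_of_mem_segment hR.pos h.2.dist_right hx with h1 | rfl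
    · exact h1.le
    · exact h.2.dist_right.le
  refine (isArc_segment hl).trans ((isArc_image (hg.cont i) h.2.lt hinj).trans (isArc_segment hr).symm ?_) ?_
  · rintro _ ⟨t, ht, rfl⟩ hw
    rcases h.2.eq t ht _ h.1.2.2.2.2.1 (hsr _ hw) with h1 | h1
    · exact absurd h1.2.symm hne
    · rw [h1.1]
  · rintro w hw (⟨t, ht, rfl⟩ | hw')
    · rcases h.2.eq t ht _ h.1.2.2.2.1 (hsl _ hw) with h1 | h1
      · rw [h1.1]
      · exact absurd h1.2 hne
    · exact absurd (hR.eq_of_dist_le h.1.2.2.2.1 h.1.2.2.2.2.1 (hsl w hw) ((hsr w hw').trans_lt hR.lt)) hne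

end IsStrand

end Strands

section GrowTree

open Set Metric

variable {ι : Type*} {g : ι → ℝ → ℂ} {P : Finset ℂ} {r R₀ R : ℝ}

namespace CurveSystem

theorem exists_next (hg : CurveSystem g P) {i : ι} {τ τ' : ℝ} (hτ : τ ∈ Icc (0 : ℝ) 1) (hτ' : τ' ∈ Icc (0 : ℝ) 1)
    (hlt : τ < τ') (hp : g i τ ∈ P) (hq : g i τ' ∈ P) : ∃ x ≤ τ', Consec (g i) P τ x := by
  have hfin : ({t ∈ Icc (0 : ℝ) 1 | g i t ∈ P} ∩ Ioi τ).Finite := (hg.finite i).inter_of_left _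
  obtain ⟨x, ⟨⟨hx1, hx2⟩, hx3⟩, hmin⟩ := exists_min_image _ id hfin ⟨τ', ⟨hτ', hq⟩, hlt⟩
  refine ⟨x, hmin τ' ⟨⟨hτ', hq⟩, hlt⟩, hτ, hx1, hx3, hp, hx2, fun y hy hyP => ?_⟩
  exact absurd (hmin y ⟨⟨⟨hτ.1.trans hy.1.le, hy.2.le.trans hx1.2⟩, hyP⟩, hy.1⟩) (not_le.2 hy.2)

theorem exists_prev (hg : CurveSystem g P) {i : ι} {τ τ' : ℝ} (hτ : τ ∈ Icc (0 : ℝ) 1) (hτ' : τ' ∈ Icc (0 : ℝ) 1)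
    (hlt : τ < τ') (hp : g i τ ∈ P) (hq : g i τ' ∈ P) : ∃ x ≥ τ, Consec (g i) P x τ' := by
  have hfin : ({t ∈ Icc (0 : ℝ) 1 | g i t ∈ P} ∩ Iio τ').Finite := (hg.finite i).inter_of_left _
  obtain ⟨x, ⟨⟨hx1, hx2⟩, hx3⟩, hmax⟩ := exists_max_image _ id hfin ⟨τ, ⟨hτ, hp⟩, hlt⟩
  refine ⟨x, hmax τ ⟨⟨hτ, hp⟩, hlt⟩, hx1, hτ', hx3, hx2, hq, fun y hy hyP => ?_⟩
  exact absurd (hmax y ⟨⟨⟨hx1.1.trans hy.1.le, hy.2.le.trans hτ'.2⟩, hyP⟩, hy.2⟩) (not_le.2 hy.1)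

theorem exists_consec_change (hg : CurveSystem g P) {i : ι} {τ τ' : ℝ} (hτ : τ ∈ Icc (0 : ℝ) 1)
    (hτ' : τ' ∈ Icc (0 : ℝ) 1) (hlt : τ < τ') (hp : g i τ ∈ P) (hq : g i τ' ∈ P) {Q : ℂ → Prop}
    (hQ : Q (g i τ)) (hQ' : ¬ Q (g i τ')) :
    ∃ x y, Consec (g i) P x y ∧ Q (g i x) ∧ ¬ Q (g i y) := by
  have hfin : ({t ∈ Icc (0 : ℝ) 1 | g i t ∈ P} ∩ {t | t < τ' ∧ Q (g i t)}).Finite :=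
    (hg.finite i).inter_of_left _
  obtain ⟨x, ⟨⟨hx1, hx2⟩, hx3, hxQ⟩, hmax⟩ := exists_max_image _ id hfin ⟨τ, ⟨hτ, hp⟩, hlt, hQ⟩
  obtain ⟨y, hy, hc⟩ := hg.exists_next hx1 hτ' hx3 hx2 hq
  refine ⟨x, y, hc, hxQ, fun hyQ => ?_⟩
  rcases hy.lt_or_eq with hlt' | rfl
  · exact absurd (hmax y ⟨⟨hc.2.1, hc.2.2.2.2.1⟩, hlt', hyQ⟩) (not_le.2 hc.2.2.1)
  · exact hQ' hyQ

end CurveSystem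

theorem strand_subset {C : Set ℂ} (hC : Convex ℝ C) {γ : ℝ → ℂ} {τ τ' u v : ℝ} (hτ : γ τ ∈ C) (hτ' : γ τ' ∈ C)
    (h : ∀ t ∈ Icc u v, γ t ∈ C) (huv : u ≤ v) : strand γ τ τ' u v ⊆ C := by
  rintro x (hx | ⟨t, ht, rfl⟩ | hx)
  · exact hC.segment_subset hτ (h u ⟨le_rfl, huv⟩) hx
  · exact h t ht
  · exact hC.segment_subset hτ' (h v ⟨huv, le_rfl⟩) hx

theorem IsStrand.subset {C : Set ℂ} (hC : Convex ℝ C) {i : ι} {τ τ' u v : ℝ} (h : IsStrand g P r R₀ i τ τ' u v)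
    (hgC : ∀ t ∈ Icc (0 : ℝ) 1, g i t ∈ C) : strand (g i) τ τ' u v ⊆ C :=
  strand_subset hC (hgC _ h.1.1) (hgC _ h.1.2.1) (fun t ht => hgC t (h.mem_Icc ht)) h.2.lt.le

theorem dist_le_dist_add_ofReal {z p : ℂ} (h : p.re ≤ z.re) {s : ℝ} (hs : 0 ≤ s) :
    dist z p ≤ dist (z + s) p := by
  rw [Complex.dist_eq, Complex.dist_eq, ← abs_of_nonneg (norm_nonneg (z - p)),
    ← abs_of_nonneg (norm_nonneg (z + s - p)), ← sq_le_sq, Complex.sq_norm, Complex.sq_norm,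
    Complex.normSq_apply, Complex.normSq_apply]
  simp
  nlinarith [sub_nonneg.2 h, mul_nonneg hs (sub_nonneg.2 h)]

/-- The tree `a` consists of a horizontal segment `[z, z + ρ]` and of strands of the curves in `F`. -/
structure IsGrown (g : ι → ℝ → ℂ) (P : Finset ℂ) (r R₀ : ℝ) (F : Set ι) (z : ℂ) (ρ : ℝ) (N : Finset ℂ)
    (a : ℂ → ℝ → ℂ) : Prop where
  subset : N ⊆ P
  mem : z ∈ N
  root : ∀ t, a z t = z + t * ρ
  other : ∀ p ∈ N, p ≠ z → ∃ i ∈ F, ∃ τ τ' u v, IsStrand g P r R₀ i τ τ' u v ∧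
    a p '' Icc 0 1 = strand (g i) τ τ' u v ∧ a p 1 ∈ N ∧ g i τ ∈ N ∧ g i τ' ∈ N

/-- The curves and discs lie in the disc of radius `R`, to the left of the ray `[z, z + ρ]`, which ends on the
boundary of this disc. -/
structure Frame (g : ι → ℝ → ℂ) (P : Finset ℂ) (R₀ R : ℝ) (z : ℂ) (ρ : ℝ) : Prop where
  mem : z ∈ P
  pos : 0 < ρ
  norm_lt : ∀ i, ∀ t ∈ Icc (0 : ℝ) 1, ‖g i t‖ < R
  norm_le : ∀ p ∈ P, ‖p‖ + R₀ ≤ R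
  re_le : ∀ i, ∀ t ∈ Icc (0 : ℝ) 1, (g i t).re ≤ z.re
  re_le' : ∀ p ∈ P, p.re ≤ z.re
  ray : ∀ t ∈ Ico (0 : ℝ) 1, ‖z + t * ρ‖ < R
  ray_end : ‖z + ρ‖ = R

theorem convex_re_le (x : ℝ) : Convex ℝ {w : ℂ | w.re ≤ x} :=
  convex_halfSpace_le Complex.reLm.isLinear x

variable {F : Set ι} {z : ℂ} {ρ : ℝ} {N : Finset ℂ} {a : ℂ → ℝ → ℂ} {anc : ℂ → Finset ℂ}

theorem Frame.strand_re_le (hF : Frame g P R₀ R z ρ) {i : ι} {τ τ' u v : ℝ} (h : IsStrand g P r R₀ i τ τ' u v)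
    {x : ℂ} (hx : x ∈ strand (g i) τ τ' u v) : x.re ≤ z.re :=
  h.subset (convex_re_le _) (hF.re_le i) hx

theorem Frame.strand_norm_lt (hF : Frame g P R₀ R z ρ) {i : ι} {τ τ' u v : ℝ} (h : IsStrand g P r R₀ i τ τ' u v)
    {x : ℂ} (hx : x ∈ strand (g i) τ τ' u v) : ‖x‖ < R := by
  have := h.subset (convex_ball 0 R) (fun t ht => by simpa using hF.norm_lt i t ht) hx
  simpa using this

theorem Frame.eq_of_ray (hF : Frame g P R₀ R z ρ) {x : ℂ} (hx : x.re ≤ z.re) {t : ℝ} (ht : 0 ≤ t)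
    (he : z + t * ρ = x) : x = z := by
  subst he
  have h1 : t * ρ ≤ 0 := by simpa using hx
  have : t = 0 := le_antisymm (by nlinarith [hF.pos]) ht
  simp [this]

namespace IsGrown

theorem mem_strands (h : IsGrown g P r R₀ F z ρ N a) {x : ℂ} (hx : x ∈ strands a N) :
    (∃ t ∈ Icc (0 : ℝ) 1, z + t * ρ = x) ∨ ∃ i ∈ F, ∃ τ τ' u v, IsStrand g P r R₀ i τ τ' u v ∧
      x ∈ strand (g i) τ τ' u v ∧ g i τ ∈ N ∧ g i τ' ∈ N := by
  obtain ⟨p, hp, hx⟩ := mem_iUnion₂.1 hx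
  by_cases hpz : p = z
  · subst hpz
    obtain ⟨t, ht, rfl⟩ := hx
    exact Or.inl ⟨t, ht, (h.root t).symm⟩
  · obtain ⟨i, hi, τ, τ', u, v, hs, he, -, h1, h2⟩ := h.other p hp hpz
    exact Or.inr ⟨i, hi, τ, τ', u, v, hs, he ▸ hx, h1, h2⟩

theorem eq_of_mem (hg : CurveSystem g P) (hR : Radii g P r R₀) (hF : Frame g P R₀ R z ρ)
    (h : IsGrown g P r R₀ F z ρ N a) {i : ι} {τ τ' u v : ℝ} (hs : IsStrand g P r R₀ i τ τ' u v)
    (hnot : ¬ (g i τ ∈ N ∧ g i τ' ∈ N)) {x : ℂ} (hx : x ∈ strand (g i) τ τ' u v)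
    (hxT : x ∈ far R ∪ strands a N) : x ∈ N ∧ (x = g i τ ∨ x = g i τ') := by
  rcases hxT with hxT | hxT
  · exact absurd (hF.strand_norm_lt hs hx) (not_lt.2 hxT)
  · have hxN : x ∈ N := by
      rcases h.mem_strands hxT with ⟨t, ht, he⟩ | ⟨j, -, κ, κ', u', v', hs', hx', h1, h2⟩
      · rw [hF.eq_of_ray (hF.strand_re_le hs hx) ht.1 he]
        exact h.mem
      · by_cases hxP : x ∈ P
        · rcases hs'.mem_P hR hx' hxP with rfl | rfl
          exacts [h1, h2]
        · obtain ⟨rfl, rfl, rfl⟩ := hs.eq_of_mem hg hR hs' hx hx' hxP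
          exact absurd ⟨h1, h2⟩ hnot
    exact ⟨hxN, hs.mem_P hR hx (h.subset hxN)⟩

theorem exists_grow (hg : CurveSystem g P) (hR : Radii g P r R₀) (hF : Frame g P R₀ R z ρ)
    (h : IsGrown g P r R₀ F z ρ N a) (hT : ArcTree R N a anc) {i : ι} (hi : i ∈ F) {τ τ' u v : ℝ}
    (hs : IsStrand g P r R₀ i τ τ' u v) (hnot : ¬ (g i τ ∈ N ↔ g i τ' ∈ N)) :
    ∃ N' a' anc', N ⊂ N' ∧ IsGrown g P r R₀ F z ρ N' a' ∧ ArcTree R N' a' anc' := by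
  have hne : g i τ ≠ g i τ' := fun he => hnot (by rw [he])
  obtain ⟨p, q, hp, hq, hpP, hpq, harc⟩ : ∃ p q, p ∉ N ∧ q ∈ N ∧ p ∈ P ∧
      ((p = g i τ ∧ q = g i τ') ∨ (p = g i τ' ∧ q = g i τ)) ∧ IsArc (strand (g i) τ τ' u v) p q := by
    by_cases h1 : g i τ ∈ N
    · have h2 : g i τ' ∉ N := fun h2 => hnot (by simp [h1, h2])
      exact ⟨_, _, h2, h1, hs.1.2.2.2.2.1, Or.inr ⟨rfl, rfl⟩, (hs.isArc hg hR hne).symm⟩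
    · have h2 : g i τ' ∈ N := by_contra fun h2 => hnot (by simp [h1, h2])
      exact ⟨_, _, h1, h2, hs.1.2.2.2.1, Or.inl ⟨rfl, rfl⟩, hs.isArc hg hR hne⟩
  obtain ⟨α, hα, hinj, himg, h0, h1⟩ := harc
  have hd : ∀ t ∈ Ico (0 : ℝ) 1, α t ∉ far R ∪ strands a N := by
    intro t ht hmem
    obtain ⟨hN, he⟩ := h.eq_of_mem hg hR hF hs (fun hh => hnot (by simp [hh]))
      (himg ▸ mem_image_of_mem α ⟨ht.1, ht.2.le⟩) hmem
    have heq : α t = q := by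
      rcases hpq with ⟨rfl, rfl⟩ | ⟨rfl, rfl⟩ <;> rcases he with he | he
      · exact absurd (he ▸ hN) hp
      · exact he
      · exact he
      · exact absurd (he ▸ hN) hp
    rw [← h1] at heq
    exact ht.2.ne (hinj ⟨ht.1, ht.2.le⟩ (by simp) heq)
  obtain ⟨anc', hT'⟩ := hT.exists_grow hp hα hinj h0 hd (Or.inl (h1 ▸ hq))
  have hsub : N ⊆ insert p N := Finset.subset_insert _ _
  refine ⟨insert p N, _, anc', Finset.ssubset_insert hp, ⟨Finset.insert_subset hpP h.subset,
    hsub h.mem, fun t => ?_, ?_⟩, hT'⟩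
  · rw [Function.update_of_ne (fun he : z = p => hp (he ▸ h.mem))]
    exact h.root t
  · rw [Finset.forall_mem_insert]
    constructor
    · intro _
      refine ⟨i, hi, τ, τ', u, v, hs, by rw [Function.update_self]; exact himg, ?_, ?_⟩
      · rw [Function.update_self, h1]
        exact hsub hq
      · rcases hpq with ⟨rfl, rfl⟩ | ⟨rfl, rfl⟩ <;> simp [hq]
    · intro j hj hjz
      obtain ⟨i, hi, τ, τ', u, v, hs, he, h1, h2, h3⟩ := h.other j hj hjz
      refine ⟨i, hi, τ, τ', u, v, hs, ?_, ?_, hsub h2, hsub h3⟩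
      · rw [Function.update_of_ne (fun he : j = p => hp (he ▸ hj))]
        exact he
      · rw [Function.update_of_ne (fun he : j = p => hp (he ▸ hj))]
        exact hsub h1

theorem exists_root (hR : Radii g P r R₀) (hF : Frame g P R₀ R z ρ) :
    ∃ N a anc, IsGrown g P r R₀ F z ρ N a ∧ ArcTree R N a anc := by
  have hpos : 0 < R := by
    have := hF.norm_le z hF.mem
    linarith [norm_nonneg z, hR.pos, hR.lt]
  obtain ⟨anc', hT⟩ := (arcTree_empty hpos (fun _ _ => 0) fun _ => ∅).exists_grow (p := z) (by simp)
    (α := fun t : ℝ => z + t * ρ) (by fun_prop) (fun s _ t _ he => by simpa [hF.pos.ne'] using he) (by simp)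
    (fun t ht => by simpa [strands, far] using hF.ray t ht) (Or.inr (by simp [far, hF.ray_end]))
  refine ⟨_, _, _, ⟨?_, Finset.mem_insert_self _ _, fun t => by rw [Function.update_self], ?_⟩, hT⟩
  · simpa using hF.mem
  · intro p hp hpz
    simp at hp
    exact absurd hp hpz

theorem exists_tree (hg : CurveSystem g P) (hR : Radii g P r R₀) (hF : Frame g P R₀ R z ρ) {V : Set ℂ}
    (hconn : ∀ N : Finset ℂ, N ⊆ P → z ∈ N → (∀ i ∈ F, ∀ τ ∈ Icc (0 : ℝ) 1, ∀ τ' ∈ Icc (0 : ℝ) 1,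
      g i τ ∈ N → g i τ' ∈ P → g i τ' ∈ N) → ∀ w ∈ V, w ∈ N) :
    ∃ N a anc, IsGrown g P r R₀ F z ρ N a ∧ ArcTree R N a anc ∧ ∀ w ∈ V, w ∈ N := by
  classical
  let A : Finset (Finset ℂ) := P.powerset.filter fun N => ∃ a anc, IsGrown g P r R₀ F z ρ N a ∧ ArcTree R N a anc
  have hA : A.Nonempty := by
    obtain ⟨N, a, anc, h, hT⟩ := exists_root (F := F) hR hF
    exact ⟨N, Finset.mem_filter.2 ⟨Finset.mem_powerset.2 h.subset, a, anc, h, hT⟩⟩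
  obtain ⟨N, hN, hmax⟩ := A.exists_max_image Finset.card hA
  obtain ⟨-, a, anc, h, hT⟩ := Finset.mem_filter.1 hN
  have hclosed : ∀ i ∈ F, ∀ τ τ', Consec (g i) P τ τ' → (g i τ ∈ N ↔ g i τ' ∈ N) := by
    intro i hi τ τ' hc
    by_contra hnot
    obtain ⟨u, v, he⟩ := hR.exists_exits hg.cont hc
    obtain ⟨N', a', anc', hlt, h', hT'⟩ := h.exists_grow hg hR hF hT hi ⟨hc, he⟩ hnot
    exact absurd (hmax N' (Finset.mem_filter.2 ⟨Finset.mem_powerset.2 h'.subset, a', anc', h', hT'⟩))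
      (not_le.2 (Finset.card_lt_card hlt))
  refine ⟨N, a, anc, h, hT, hconn N h.subset h.mem ?_⟩
  intro i hi τ hτ τ' hτ' hN hP
  by_contra hN'
  rcases lt_trichotomy τ τ' with hlt | rfl | hlt
  · obtain ⟨x, y, hc, hx, hy⟩ := hg.exists_consec_change hτ hτ' hlt (h.subset hN) hP (Q := (· ∈ N)) hN hN'
    exact hy ((hclosed i hi x y hc).1 hx)
  · exact hN' hN
  · obtain ⟨x, y, hc, hx, hy⟩ := hg.exists_consec_change hτ' hτ hlt hP (h.subset hN) (Q := (· ∉ N)) hN'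
      (not_not.2 hN)
    exact hx ((hclosed i hi x y hc).2 (not_not.1 hy))

theorem curve_near (hg : CurveSystem g P) (hR : Radii g P r R₀) (hF : Frame g P R₀ R z ρ)
    (h : IsGrown g P r R₀ F z ρ N a) {i : ι} (hi : i ∉ F) {t : ℝ} (ht : t ∈ Icc (0 : ℝ) 1)
    (hT : g i t ∈ far R ∪ strands a N) : ∃ p ∈ P, g i t ∈ ball p r := by
  rcases hT with hT | hT
  · exact absurd (hF.norm_lt i t ht) (not_lt.2 hT)
  · rcases h.mem_strands hT with ⟨s, hs, he⟩ | ⟨j, hj, τ, τ', u, v, hs, hx, -⟩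
    · exact ⟨z, hF.mem, by rw [hF.eq_of_ray (hF.re_le i t ht) hs.1 he]; exact mem_ball_self hR.pos⟩
    · exact hs.curve_near hg hR ht (fun he => hi (he ▸ hj)) hx

theorem notMem_far (hR : Radii g P r R₀) (hF : Frame g P R₀ R z ρ) {p x : ℂ} (hp : p ∈ P)
    (hx : x ∈ closedBall p r) : x ∉ far R := by
  intro hxR
  have h1 : R ≤ ‖x‖ := hxR
  have h2 := hF.norm_le p hp
  have h3 := norm_le_norm_add_norm_sub' x p
  rw [mem_closedBall, dist_eq_norm] at hx
  linarith [hR.lt]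

theorem sphere_subset_openStrands (hR : Radii g P r R₀) (hF : Frame g P R₀ R z ρ)
    (h : IsGrown g P r R₀ F z ρ N a) (hT : ArcTree R N a anc) {p : ℂ} (hp : p ∈ P) :
    sphere p r ∩ (far R ∪ strands a N) ⊆ openStrands a N := by
  rintro x ⟨hx, hxT⟩
  have hxR := notMem_far hR hF hp (sphere_subset_closedBall hx)
  have hxP : x ∉ P := fun hxP => by
    have := hR.eq_of_dist_le hp hxP (mem_sphere.1 hx).le (by simp [hR.pos.trans hR.lt])
    subst this
    simp at hx
    exact hR.pos.ne hx
  obtain ⟨j, hj, t, ht, rfl⟩ := mem_iUnion₂.1 (hxT.resolve_left hxR)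
  refine mem_biUnion hj ⟨t, ⟨ht.1.lt_of_ne ?_, ht.2.lt_of_ne ?_⟩, rfl⟩
  · rintro rfl
    rw [hT.zero j hj] at hxP
    exact hxP (h.subset hj)
  · rintro rfl
    by_cases hjz : j = z
    · subst hjz
      apply hxR
      rw [h.root]
      simp [far, hF.ray_end]
    · obtain ⟨i, hi, τ, τ', u, v, hs, he, h1, -⟩ := h.other j hj hjz
      exact hxP (h.subset h1)

/-- The curves of `F` through `p`, with the times at which they pass there. -/
def _root_.passages (g : ι → ℝ → ℂ) (F : Set ι) (p : ℂ) : Set (ι × ℝ) :=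
  {x | x.1 ∈ F ∧ x.2 ∈ Icc (0 : ℝ) 1 ∧ g x.1 x.2 = p}

theorem _root_.CurveSystem.finite_passages [Finite ι] (hg : CurveSystem g P) {p : ℂ} (hp : p ∈ P) :
    (passages g F p).Finite := by
  refine (Set.finite_iUnion fun i => ((hg.finite i).image (Prod.mk i))).subset ?_
  rintro ⟨i, t⟩ ⟨-, ht, he⟩
  exact mem_iUnion.2 ⟨i, t, ⟨ht, he ▸ hp⟩, rfl⟩

theorem exists_sphere_subset (hR : Radii g P r R₀) (hF : Frame g P R₀ R z ρ)
    (h : IsGrown g P r R₀ F z ρ N a) {p : ℂ} (hp : p ∈ P) :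
    ∃ φ ψ : ι × ℝ → ℂ, sphere p r ∩ (far R ∪ strands a N) ⊆
      (φ '' passages g F p ∪ ψ '' passages g F p) ∪ {x | p = z ∧ x = z + r} := by
  classical
  let φ : ι × ℝ → ℂ := fun x => if hx : ∃ τ' u v, IsStrand g P r R₀ x.1 x.2 τ' u v then
    g x.1 hx.choose_spec.choose else 0
  let ψ : ι × ℝ → ℂ := fun x => if hx : ∃ τ v u, IsStrand g P r R₀ x.1 τ x.2 u v then
    g x.1 hx.choose_spec.choose else 0
  refine ⟨φ, ψ, ?_⟩
  rintro x ⟨hx, hxT⟩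
  have hxR := notMem_far hR hF hp (sphere_subset_closedBall hx)
  rw [mem_sphere] at hx
  rcases h.mem_strands (hxT.resolve_left hxR) with ⟨t, ht, rfl⟩ | ⟨i, hi, τ, τ', u, v, hs, hxs, -⟩
  · right
    have hρ : 0 ≤ t * ρ := mul_nonneg ht.1 hF.pos.le
    by_cases hpz : p = z
    · subst hpz
      refine ⟨rfl, ?_⟩
      rw [dist_eq_norm, add_sub_cancel_left, ← Complex.ofReal_mul, Complex.norm_real,
        Real.norm_of_nonneg hρ] at hx
      rw [← hx]
      push_cast
      rfl
    · have h1 := dist_le_dist_add_ofReal (hF.re_le' p hp) hρ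
      push_cast at h1
      have h2 := hR.sep z hF.mem p hp (Ne.symm hpz)
      linarith [hR.pos, hR.lt]
  · left
    rcases hs.sphere hR hxs hp hx with ⟨rfl, rfl⟩ | ⟨rfl, rfl⟩
    · refine Or.inl ⟨(i, τ), ⟨hi, hs.1.1, rfl⟩, ?_⟩
      have hex : ∃ τ' u v, IsStrand g P r R₀ i τ τ' u v := ⟨_, _, _, hs⟩
      have key : ∀ κ u' v', IsStrand g P r R₀ i τ κ u' v' → u' = u := by
        intro κ u' v' hs'
        obtain rfl := hs'.1.unique hs.1
        exact (hs'.2.unique hs.1.2.2.2.1 hs.1.2.2.2.2.1 hs.2).1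
      obtain ⟨v', hs'⟩ := hex.choose_spec.choose_spec
      simp only [φ, dif_pos hex]
      rw [key _ _ _ hs']
    · refine Or.inr ⟨(i, τ'), ⟨hi, hs.1.2.1, rfl⟩, ?_⟩
      have hex : ∃ τ v u, IsStrand g P r R₀ i τ τ' u v := ⟨_, _, _, hs⟩
      have key : ∀ κ v' u', IsStrand g P r R₀ i κ τ' u' v' → v' = v := by
        intro κ v' u' hs'
        obtain rfl := hs'.1.unique_right hs.1
        exact (hs'.2.unique hs.1.2.2.2.1 hs.1.2.2.2.2.1 hs.2).2
      obtain ⟨v', hs'⟩ := hex.choose_spec.choose_spec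
      simp only [ψ, dif_pos hex]
      rw [key _ _ _ hs']

theorem finite_sphere [Finite ι] (hg : CurveSystem g P) (hR : Radii g P r R₀) (hF : Frame g P R₀ R z ρ)
    (h : IsGrown g P r R₀ F z ρ N a) {p : ℂ} (hp : p ∈ P) : (sphere p r ∩ (far R ∪ strands a N)).Finite := by
  obtain ⟨φ, ψ, hsub⟩ := h.exists_sphere_subset hR hF hp
  have hfin := hg.finite_passages (F := F) hp
  exact (((hfin.image φ).union (hfin.image ψ)).union ((finite_singleton (z + r)).subset fun x hx => hx.2)).subset hsub

theorem ncard_sphere_le [Finite ι] (hg : CurveSystem g P) (hR : Radii g P r R₀) (hF : Frame g P R₀ R z ρ)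
    (h : IsGrown g P r R₀ F z ρ N a) {p : ℂ} (hp : p ∈ P) :
    (sphere p r ∩ (far R ∪ strands a N)).ncard ≤ 2 * (passages g F p).ncard + 1 := by
  obtain ⟨φ, ψ, hsub⟩ := h.exists_sphere_subset hR hF hp
  have hfin := hg.finite_passages (F := F) hp
  have hf1 : {x | p = z ∧ x = z + r}.Finite := (finite_singleton (z + r)).subset fun x hx => hx.2
  refine (ncard_le_ncard hsub (((hfin.image φ).union (hfin.image ψ)).union hf1)).trans ?_
  refine (ncard_union_le _ _).trans (add_le_add ((ncard_union_le _ _).trans ?_) ?_)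
  · have h1 := ncard_image_le (f := φ) hfin
    have h2 := ncard_image_le (f := ψ) hfin
    omega
  · refine (ncard_le_ncard (t := {z + (r : ℂ)}) (fun x hx => hx.2) (finite_singleton _)).trans ?_
    rw [ncard_singleton]

theorem sphere_eq_empty (hR : Radii g P r R₀) (hF : Frame g P R₀ R z ρ)
    (h : IsGrown g P r R₀ F z ρ N a) {p : ℂ} (hp : p ∈ P) (hpz : p ≠ z) (hpF : passages g F p = ∅) :
    sphere p r ∩ (far R ∪ strands a N) = ∅ := by
  obtain ⟨φ, ψ, hsub⟩ := h.exists_sphere_subset hR hF hp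
  simpa [hpF, hpz] using hsub

end IsGrown

end GrowTree

section PuncturedHomotopy

open Set Metric Topology Filter

variable {V : Set ℂ} {x y z w : ℂ}

/-- Homotopy of paths rel endpoints whose interiors avoid `V`. -/
def AvoidHomotopic (V : Set ℂ) (p q : Path x y) : Prop :=
  ∃ H : Path.Homotopy p q, ∀ s t : I, t ≠ 0 → t ≠ 1 → H (s, t) ∉ V

namespace AvoidHomotopic

variable {p q : Path x y}

theorem homotopicIn (h : AvoidHomotopic V p q) : HomotopicIn V p q := by
  obtain ⟨H, hH⟩ := h
  exact ⟨H, H.continuous, fun t => H.apply_zero t, fun t => H.apply_one t,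
    fun s => by rw [H.source, p.source], fun s => by rw [H.target, p.target],
    fun s t _ _ h0 h1 => hH s t h0 h1⟩

theorem symm (h : AvoidHomotopic V p q) : AvoidHomotopic V q p := by
  obtain ⟨H, hH⟩ := h
  exact ⟨H.symm, fun s t h0 h1 => hH (σ s) t h0 h1⟩

theorem trans {r : Path x y} (h : AvoidHomotopic V p q) (h' : AvoidHomotopic V q r) : AvoidHomotopic V p r := by
  obtain ⟨H, hH⟩ := h
  obtain ⟨H', hH'⟩ := h'
  refine ⟨H.trans H', fun s t h0 h1 => ?_⟩
  rw [Path.Homotopy.trans_apply]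
  split_ifs
  exacts [hH _ t h0 h1, hH' _ t h0 h1]

theorem hcomp {p' q' : Path y z} (hy : y ∉ V) (h : AvoidHomotopic V p q) (h' : AvoidHomotopic V p' q') :
    AvoidHomotopic V (p.trans p') (q.trans q') := by
  obtain ⟨H, hH⟩ := h
  obtain ⟨H', hH'⟩ := h'
  refine ⟨H.hcomp H', fun s t h0 h1 => ?_⟩
  have h0' : (t : ℝ) ≠ 0 := fun h => h0 (Subtype.ext h)
  have h1' : (t : ℝ) ≠ 1 := fun h => h1 (Subtype.ext h)
  rw [Path.Homotopy.hcomp_apply]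
  split_ifs with ht
  · by_cases he : (t : ℝ) = 1 / 2
    · have : (⟨2 * (t : ℝ), (unitInterval.mul_pos_mem_iff zero_lt_two).2 ⟨t.2.1, ht⟩⟩ : I) = 1 :=
        Subtype.ext (by simp [he])
      rw [this, Path.target]
      exact hy
    · refine hH _ _ (fun h => h0' ?_) (fun h => he ?_)
      · have := congrArg Subtype.val h
        simpa using this
      · have := congrArg Subtype.val h
        simp only [Icc.coe_one] at this
        linarith
  · refine hH' _ _ (fun h => ht ?_) (fun h => h1' ?_)
    · have := congrArg Subtype.val h
      simp only [Icc.coe_zero] at this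
      linarith
    · have := congrArg Subtype.val h
      simp only [Icc.coe_one] at this
      linarith

theorem reparam (hp : ∀ t, t ≠ 0 → t ≠ 1 → p t ∉ V) (φ : I → I) (hφ : Continuous φ) (h0 : φ 0 = 0) (h1 : φ 1 = 1)
    (h : ∀ t, t ≠ 0 → t ≠ 1 → φ t ≠ 0 ∧ φ t ≠ 1) : AvoidHomotopic V p (p.reparam φ hφ h0 h1) := by
  refine ⟨Path.Homotopy.reparam p φ hφ h0 h1, fun s t ht0 ht1 => ?_⟩
  obtain ⟨hp0, hp1⟩ := h t ht0 ht1
  have e0 := unitInterval.pos_iff_ne_zero.2 ht0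
  have e1 := unitInterval.lt_one_iff_ne_one.2 ht1
  have f0 := unitInterval.pos_iff_ne_zero.2 hp0
  have f1 := unitInterval.lt_one_iff_ne_one.2 hp1
  have e0' : (0 : ℝ) < t := e0
  have e1' : (t : ℝ) < 1 := e1
  have f0' : (0 : ℝ) < φ t := f0
  have f1' : (φ t : ℝ) < 1 := f1
  have hmem : (1 - (s : ℝ)) * t + s * φ t ∈ Ioo (0 : ℝ) 1 :=
    (convex_Ioo (0 : ℝ) 1) ⟨e0', e1'⟩ ⟨f0', f1'⟩ (by linarith [s.2.2]) s.2.1 (by ring)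
  refine hp ⟨_, hmem.1.le, hmem.2.le⟩ (fun h => ?_) (fun h => ?_)
  · have := congrArg Subtype.val h
    exact hmem.1.ne' this
  · have := congrArg Subtype.val h
    exact hmem.2.ne this

theorem refl (hp : ∀ t, t ≠ 0 → t ≠ 1 → p t ∉ V) : AvoidHomotopic V p p :=
  ⟨Path.Homotopy.refl p, fun _ t h0 h1 => hp t h0 h1⟩

theorem left (h : AvoidHomotopic V p q) : ∀ t, t ≠ 0 → t ≠ 1 → p t ∉ V := by
  obtain ⟨H, hH⟩ := h
  intro t h0 h1
  have he : H (0, t) = p t := H.apply_zero t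
  rw [← he]
  exact hH 0 t h0 h1

theorem symm₂ (h : AvoidHomotopic V p q) : AvoidHomotopic V p.symm q.symm := by
  obtain ⟨H, hH⟩ := h
  refine ⟨H.symm₂, fun s t h0 h1 => hH s (σ t) (fun h => h1 ?_) (fun h => h0 ?_)⟩
  · rwa [unitInterval.symm_eq_zero] at h
  · rwa [unitInterval.symm_eq_one] at h

theorem trans_assoc {q : Path y z} {r : Path z w} (hy : y ∉ V) (hz : z ∉ V) (hp : AvoidHomotopic V p p)
    (hq : AvoidHomotopic V q q) (hr : AvoidHomotopic V r r) :
    AvoidHomotopic V (p.trans (q.trans r)) ((p.trans q).trans r) := by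
  rw [Path.Homotopy.trans_assoc_reparam]
  refine reparam (hp.hcomp hy (hq.hcomp hz hr)).left _ _ _ _ fun t h0 h1 => ?_
  have h0' : (0 : ℝ) < t := unitInterval.pos_iff_ne_zero.2 h0
  have h1' : (t : ℝ) < 1 := unitInterval.lt_one_iff_ne_one.2 h1
  constructor <;> intro he <;> have := congrArg Subtype.val he <;>
    simp only [Path.Homotopy.transAssocReparamAux, Icc.coe_one, Icc.coe_zero] at this <;>
    split_ifs at this <;> linarith

theorem of_homotopic {x y : ↥Vᶜ} {p q : Path x y} (h : p.Homotopic q) :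
    AvoidHomotopic V (p.map continuous_subtype_val) (q.map continuous_subtype_val) :=
  ⟨h.some.map ⟨_, continuous_subtype_val⟩, fun s t _ _ => (h.some (s, t)).2⟩

/-- A path which leaves its starting point `x` for good, in a set star-shaped about `x`, unwinds to a segment. -/
theorem segment {C : Set ℂ} (hC : StarConvex ℝ x C) (hCV : ∀ w ∈ C, w ≠ x → w ∉ V)
    (hp : ∀ t, t ≠ 0 → p t ≠ x) (hpC : ∀ t, p t ∈ C) : AvoidHomotopic V p (Path.segment x y) := by
  let φ : I × I → ℝ := fun a => a.2 / max a.1 a.2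
  have hφ : ∀ a : I × I, φ a ∈ Icc (0 : ℝ) 1 := fun a =>
    ⟨div_nonneg a.2.2.1 (le_max_of_le_left a.1.2.1), div_le_one_of_le₀ (le_max_right _ _) (le_max_of_le_left a.1.2.1)⟩
  let K : I × I → ℂ := fun a => x + φ a * (p (max a.1 a.2) - x)
  have hK : Continuous K := by
    rw [continuous_iff_continuousAt]
    intro a
    by_cases ha : max a.1 a.2 = 0
    · have h0 : Tendsto (fun b : I × I => p (max b.1 b.2) - x) (𝓝 a) (𝓝 0) := by
        have : Continuous fun b : I × I => p (max b.1 b.2) - x := by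
          have := p.continuous
          fun_prop
        have h := this.tendsto a
        simpa [ha] using h
      have h1 : Tendsto (fun b : I × I => (φ b : ℂ) * (p (max b.1 b.2) - x)) (𝓝 a) (𝓝 0) := by
        refine squeeze_zero_norm (fun b => ?_) (tendsto_zero_iff_norm_tendsto_zero.1 h0)
        rw [norm_mul, Complex.norm_real, Real.norm_of_nonneg (hφ b).1]
        exact mul_le_of_le_one_left (norm_nonneg _) (hφ b).2
      have h2 : K a = x + 0 := by simp [K, ha]
      rw [ContinuousAt, h2]
      exact tendsto_const_nhds.add h1
    · have ha' : max (a.1 : ℝ) a.2 ≠ 0 := fun h => ha (Subtype.ext (by simpa using h))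
      have h1 : ContinuousAt φ a := by
        refine ContinuousAt.div ?_ ?_ ha' <;> fun_prop
      have := p.continuous
      have h2 : Continuous fun b : I × I => p (max b.1 b.2) - x := by fun_prop
      exact continuousAt_const.add ((Complex.continuous_ofReal.continuousAt.comp h1).mul h2.continuousAt)
  refine ⟨⟨⟨⟨K, hK⟩, fun t => ?_, fun t => ?_⟩, fun s t ht => ?_⟩, fun s t h0 h1 => ?_⟩
  · by_cases ht : t = 0
    · simp [K, φ, ht]
    · have ht' : (t : ℝ) ≠ 0 := fun h => ht (Subtype.ext h)
      simp [K, φ, t.2.1, ht']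
  · have ht : max 1 t = 1 := max_eq_left t.2.2
    have ht' : max 1 (t : ℝ) = 1 := max_eq_left t.2.2
    simp [K, φ, ht, ht', AffineMap.lineMap_apply]
    ring
  · rcases ht with rfl | rfl
    · simp [K, φ]
    · have hs : max s 1 = 1 := max_eq_right s.2.2
      have hs' : max (s : ℝ) 1 = 1 := max_eq_right s.2.2
      simp [K, φ, hs, hs']
  · have h0' : (0 : ℝ) < t := unitInterval.pos_iff_ne_zero.2 h0
    have hm : max s t ≠ 0 := fun h => h0 (le_antisymm (h ▸ le_max_right s t) t.2.1)
    have hne : p (max s t) - x ≠ 0 := sub_ne_zero.2 (hp _ hm)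
    have hφ0 : φ (s, t) ≠ 0 := (div_pos h0' (lt_of_lt_of_le h0' (le_max_right _ _))).ne'
    show K (s, t) ∉ V
    refine hCV _ ?_ ?_
    · have h := hC (hpC (max s t)) (sub_nonneg.2 (hφ (s, t)).2) (hφ (s, t)).1 (by ring)
      convert h using 1
      simp [K]
      ring
    · simp only [K]
      intro h
      rw [add_eq_left, mul_eq_zero] at h
      exact h.elim (fun h => hφ0 (by exact_mod_cast h)) hne

end AvoidHomotopic

/-- The curve `γ` restricted to `[s, t]` as a path with prescribed endpoints. -/
def curvePath (γ : ℝ → ℂ) (hγ : Continuous γ) {s t : ℝ} {x y : ℂ} (hx : γ s = x) (hy : γ t = y) : Path x y where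
  toFun u := γ (segPath s t u)
  continuous_toFun := hγ.comp (segPath s t).continuous
  source' := by simp [hx]
  target' := by simp [hy]

theorem curvePath_split {γ : ℝ → ℂ} (hγ : Continuous γ) {u v : ℝ} {x y : ℂ} (hx : γ 0 = x) (hy : γ 1 = y)
    (hu : 0 < u) (huv : u ≤ v) (hv : v < 1) (h : ∀ t ∈ Ioo (0 : ℝ) 1, γ t ∉ V) :
    AvoidHomotopic V (curvePath γ hγ hx hy)
      ((curvePath γ hγ hx rfl : Path x (γ u)).trans
        (((piece γ hγ huv fun t ht => h t ⟨hu.trans_le ht.1, ht.2.trans_lt hv⟩).map continuous_subtype_val).trans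
          (curvePath γ hγ rfl hy : Path (γ v) y))) := by
  let φ : Path (0 : ℝ) 1 := (segPath 0 u).trans ((segPath u v).trans (segPath v 1))
  have hφ : ∀ t : I, φ t ∈ Icc (0 : ℝ) 1 ∧ (t ≠ 0 → t ≠ 1 → φ t ∈ Ioo (0 : ℝ) 1) := by
    intro t
    have h1 : t ≠ 0 → (0 : ℝ) < t := fun h => unitInterval.pos_iff_ne_zero.2 h
    have h2 : t ≠ 1 → (t : ℝ) < 1 := fun h => unitInterval.lt_one_iff_ne_one.2 h
    have h0 := t.2.1
    have h0' := t.2.2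
    simp only [φ, Path.trans_apply, mem_Icc, mem_Ioo]
    split_ifs with h3 h4 <;> simp only [segPath, Path.coe_mk_mk] <;> try simp only [not_le] at h3 h4
    · refine ⟨⟨by nlinarith, by nlinarith⟩, fun a b => ⟨?_, by nlinarith⟩⟩
      have := mul_pos (h1 a) hu
      linarith
    · have h5 := mul_nonneg (by linarith : 0 ≤ 2 * (2 * (t : ℝ) - 1)) (by linarith : 0 ≤ v - u)
      have h6 := mul_nonneg (by linarith : 0 ≤ 1 - 2 * (2 * (t : ℝ) - 1)) (by linarith : 0 ≤ v - u)
      exact ⟨⟨by linarith, by linarith⟩, fun _ _ => ⟨by linarith, by linarith⟩⟩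
    · have h5 := mul_nonneg (by linarith : 0 ≤ (2 * (2 * (t : ℝ) - 1)) - 1) (by linarith : 0 ≤ 1 - v)
      have h6 := mul_nonneg (by linarith : 0 ≤ 1 - ((2 * (2 * (t : ℝ) - 1)) - 1)) (by linarith : 0 ≤ 1 - v)
      refine ⟨⟨by linarith, by linarith⟩, fun _ b => ⟨by linarith, ?_⟩⟩
      have := mul_pos (sub_pos.2 (h2 b)) (by linarith : 0 < 1 - v)
      linarith
  have hc : ∀ t : I, t ≠ 0 → t ≠ 1 → curvePath γ hγ hx hy t ∉ V := by
    intro t h0 h1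
    have h0' : (0 : ℝ) < t := unitInterval.pos_iff_ne_zero.2 h0
    have h1' : (t : ℝ) < 1 := unitInterval.lt_one_iff_ne_one.2 h1
    refine h _ ?_
    simpa [segPath] using And.intro h0' h1'
  convert AvoidHomotopic.reparam hc (fun t => ⟨φ t, (hφ t).1⟩) (φ.continuous.subtype_mk _)
    (Subtype.ext (by simp)) (Subtype.ext (by simp))
    (fun t h0 h1 => ⟨fun h => ((hφ t).2 h0 h1).1.ne' (congrArg Subtype.val h),
      fun h => ((hφ t).2 h0 h1).2.ne (congrArg Subtype.val h)⟩) using 1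
  ext t
  simp only [Path.trans_apply, Path.coe_reparam, Function.comp, φ, Path.map_coe]
  simp only [curvePath, piece, Path.coe_mk_mk, segPath]
  split_ifs <;> simp

theorem curvePath_standard {γ : ℝ → ℂ} (hγ : Continuous γ) {u v : ℝ} {x y : ℂ} (hx : γ 0 = x) (hy : γ 1 = y)
    (hu : 0 < u) (huv : u ≤ v) (hv : v < 1) (h : ∀ t ∈ Ioo (0 : ℝ) 1, γ t ∉ V) {C C' : Set ℂ}
    (hxV : x ∈ V) (hyV : y ∈ V)
    (hC : StarConvex ℝ x C) (hCV : ∀ w ∈ C, w ≠ x → w ∉ V) (hC' : StarConvex ℝ y C')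
    (hCV' : ∀ w ∈ C', w ≠ y → w ∉ V) (hγC : ∀ t ∈ Icc 0 u, γ t ∈ C) (hγC' : ∀ t ∈ Icc v 1, γ t ∈ C')
    {a b : ↥Vᶜ} (p : Path a ⟨γ u, h u ⟨hu, huv.trans_lt hv⟩⟩) (q : Path ⟨γ v, h v ⟨hu.trans_le huv, hv⟩⟩ b)
    (hp : ∀ t, (p t : ℂ) ∈ C) (hq : ∀ t, (q t : ℂ) ∈ C') :
    AvoidHomotopic V (curvePath γ hγ hx hy) ((Path.segment x (a : ℂ)).trans
      (((p.trans ((piece γ hγ huv fun t ht => h t ⟨hu.trans_le ht.1, ht.2.trans_lt hv⟩).trans q)).map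
        continuous_subtype_val).trans (Path.segment y (b : ℂ)).symm)) := by
  set κ := piece γ hγ huv fun t ht => h t ⟨hu.trans_le ht.1, ht.2.trans_lt hv⟩
  set p' := p.map continuous_subtype_val
  set q' := q.map continuous_subtype_val
  set κ' := κ.map continuous_subtype_val
  have haC : (a : ℂ) ∈ C := by simpa using hp 0
  have hbC : (b : ℂ) ∈ C' := by simpa using hq 1
  have seg : ∀ {x : ℂ} {C : Set ℂ} (a : ↥Vᶜ), x ∈ V → StarConvex ℝ x C → (a : ℂ) ∈ C →
      ∀ t : I, Path.segment x (a : ℂ) t ∈ C ∧ (t ≠ 0 → Path.segment x (a : ℂ) t ≠ x) := by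
    intro x C a hx hC ha t
    refine ⟨hC.segment_subset ha (Path.range_segment x (a : ℂ) ▸ mem_range_self t), fun h0 he => ?_⟩
    have hne : x ≠ (a : ℂ) := fun h => a.2 (h ▸ hx)
    exact h0 (Path.segment_injective_of_ne hne (he.trans (Path.source _).symm))
  have glue : ∀ {x : ℂ} {C : Set ℂ} {a c : ↥Vᶜ} (p : Path a c), x ∈ V → StarConvex ℝ x C → (∀ t, (p t : ℂ) ∈ C) →
      ∀ t : I, (Path.segment x (a : ℂ)).trans (p.map continuous_subtype_val) t ∈ C ∧
        (t ≠ 0 → (Path.segment x (a : ℂ)).trans (p.map continuous_subtype_val) t ≠ x) := by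
    intro x C a c p hx hC hp t
    rw [Path.trans_apply]
    split_ifs with ht
    · have hs := seg a hx hC (by simpa using hp 0) ⟨2 * t, (unitInterval.mul_pos_mem_iff zero_lt_two).2 ⟨t.2.1, ht⟩⟩
      refine ⟨hs.1, fun h0 => hs.2 fun h => h0 (Subtype.ext ?_)⟩
      have := congrArg Subtype.val h
      simpa using this
    · exact ⟨hp _, fun _ he => (p _).2 (by rw [Path.map_coe] at he; exact he ▸ hx)⟩
  have hs1 := AvoidHomotopic.segment hC hCV (p := Path.segment x (a : ℂ)) (fun t => (seg a hxV hC haC t).2)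
    fun t => (seg a hxV hC haC t).1
  have hs2 := AvoidHomotopic.segment hC' hCV' (p := Path.segment y (b : ℂ)) (fun t => (seg b hyV hC' hbC t).2)
    fun t => (seg b hyV hC' hbC t).1
  have e1 : AvoidHomotopic V (curvePath γ hγ hx rfl : Path x (γ u)) ((Path.segment x (a : ℂ)).trans p') := by
    refine AvoidHomotopic.trans (AvoidHomotopic.segment hC hCV (fun t h0 he => ?_) fun t => hγC _ (segPath_mem hu.le t))
      (AvoidHomotopic.segment hC hCV (fun t => (glue p hxV hC hp t).2) fun t => (glue p hxV hC hp t).1).symm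
    have h0' : (0 : ℝ) < t := unitInterval.pos_iff_ne_zero.2 h0
    refine h (segPath 0 u t) ⟨?_, (segPath_mem hu.le t).2.trans_lt (huv.trans_lt hv)⟩ ((show γ (segPath 0 u t) = x from he) ▸ hxV)
    simpa [segPath] using mul_pos h0' hu
  have e2 : AvoidHomotopic V (curvePath γ hγ rfl hy : Path (γ v) y) (q'.trans (Path.segment y (b : ℂ)).symm) := by
    have h1 : AvoidHomotopic V (curvePath γ hγ rfl hy : Path (γ v) y).symm
        ((Path.segment y (b : ℂ)).trans (q.symm.map continuous_subtype_val)) := by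
      refine AvoidHomotopic.trans (AvoidHomotopic.segment hC' hCV' (fun t h0 he => ?_)
        fun t => hγC' _ (segPath_mem hv.le (σ t)))
        (AvoidHomotopic.segment hC' hCV' (fun t => (glue q.symm hyV hC' (fun t => hq _) t).2)
          fun t => (glue q.symm hyV hC' (fun t => hq _) t).1).symm
      have h0' : (0 : ℝ) < t := unitInterval.pos_iff_ne_zero.2 h0
      refine h (segPath v 1 (σ t)) ⟨(hu.trans_le huv).trans_le (segPath_mem hv.le _).1, ?_⟩ ((show γ (segPath v 1 (σ t)) = y from he) ▸ hyV)
      simp [segPath]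
      nlinarith
    have h2 := h1.symm₂
    rwa [Path.symm_symm, Path.trans_symm, Path.map_symm, Path.symm_symm] at h2
  have r1 : AvoidHomotopic V p' p' := .refl fun t _ _ => (p t).2
  have r2 : AvoidHomotopic V q' q' := .refl fun t _ _ => (q t).2
  have r3 : AvoidHomotopic V κ' κ' := .refl fun t _ _ => (κ t).2
  have hγu := h u ⟨hu, huv.trans_lt hv⟩
  have hγv := h v ⟨hu.trans_le huv, hv⟩
  have s2 := hs2.trans hs2.symm |>.symm₂
  refine (curvePath_split hγ hx hy hu huv hv h).trans ((e1.hcomp hγu (r3.hcomp hγv e2)).trans ?_)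
  refine ((AvoidHomotopic.trans_assoc a.2 hγu (hs1.trans hs1.symm) r1 (r3.hcomp hγv (r2.hcomp b.2 s2))).symm).trans ?_
  refine (hs1.trans hs1.symm).hcomp a.2 ?_
  refine (r1.hcomp hγu (AvoidHomotopic.trans_assoc hγv b.2 r3 r2 s2)).trans ?_
  refine (AvoidHomotopic.trans_assoc hγu b.2 r1 (r3.hcomp hγv r2) s2).trans ?_
  rw [Path.map_trans, Path.map_trans]
  exact (r1.hcomp hγu (r3.hcomp hγv r2)).hcomp b.2 s2

end PuncturedHomotopy

section Ends

open Set Metric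
open scoped Pointwise

variable {ι : Type*} {g : ι → ℝ → ℂ} {P : Finset ℂ} {r R₀ : ℝ}

/-- Times `u ≤ m ≤ m' ≤ v` where `γ` leaves the disc about its start, is far from `P`, is again far from `P`, and
enters the disc about its end. -/
structure Ends (γ : ℝ → ℂ) (P : Finset ℂ) (r R₀ u m m' v : ℝ) : Prop where
  pos : 0 < u
  le_mid : u ≤ m
  mid_le : m ≤ m'
  mid_le' : m' ≤ v
  lt_one : v < 1
  dist_left : dist (γ u) (γ 0) = r
  dist_right : dist (γ v) (γ 1) = r
  near_left : ∀ x ∈ Icc 0 u, γ x ∈ ball (γ 0) R₀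
  near_right : ∀ x ∈ Icc v 1, γ x ∈ ball (γ 1) R₀
  mid : ∀ p ∈ P, γ m ∉ ball p R₀
  mid' : ∀ p ∈ P, γ m' ∉ ball p R₀
  off_left : ∀ x ∈ Icc u m, ∀ p ∈ P, γ x ∉ ball p r
  off_right : ∀ x ∈ Icc m' v, ∀ p ∈ P, γ x ∉ ball p r

theorem Exits.notMem_ball {γ : ℝ → ℂ} {τ τ' u v : ℝ} (h : Exits γ P r R₀ τ τ' u v) {x : ℝ} (hx : x ∈ Icc u v)
    {p : ℂ} (hp : p ∈ P) : γ x ∉ ball p r := by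
  intro hb
  rcases h.eq x hx p hp (mem_ball.1 hb).le with ⟨rfl, rfl⟩ | ⟨rfl, rfl⟩
  · exact (mem_ball.1 hb).ne h.dist_left
  · exact (mem_ball.1 hb).ne h.dist_right

theorem CurveSystem.exists_ends (hg : CurveSystem g P) (hR : Radii g P r R₀) {i : ι} (h0 : g i 0 ∈ P)
    (h1 : g i 1 ∈ P) : ∃ u m m' v, Ends (g i) P r R₀ u m m' v := by
  have hz : (0 : ℝ) ∈ Icc (0 : ℝ) 1 := by simp
  have ho : (1 : ℝ) ∈ Icc (0 : ℝ) 1 := by simp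
  obtain ⟨τ', hτ', hc⟩ := hg.exists_next hz ho one_pos h0 h1
  obtain ⟨τ, hτ, hc'⟩ := hg.exists_prev hz ho one_pos h0 h1
  obtain ⟨u, v₀, he⟩ := hR.exists_exits hg.cont hc
  obtain ⟨u₀, v, he'⟩ := hR.exists_exits hg.cont hc'
  have left : ∀ x ∈ Icc 0 u, g i x ∈ ball (g i 0) R₀ := fun x hx => hx.2.lt_or_eq.elim
    (fun h => he.near_left x ⟨hx.1, h⟩) (fun h => by rw [h, mem_ball, he.dist_left]; exact hR.lt)
  have right : ∀ x ∈ Icc v 1, g i x ∈ ball (g i 1) R₀ := fun x hx => hx.1.lt_or_eq.elim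
    (fun h => he'.near_right x ⟨h, hx.2⟩) (fun h => by rw [← h, mem_ball, he'.dist_right]; exact hR.lt)
  obtain ⟨m, m', hm, hm', hmm, hgm, hgm'⟩ : ∃ m m', m ∈ Ioo u v₀ ∧ m' ∈ Ioo u₀ v ∧ m ≤ m' ∧
      (∀ p ∈ P, g i m ∉ ball p R₀) ∧ ∀ p ∈ P, g i m' ∉ ball p R₀ := by
    obtain ⟨m, hm, hgm⟩ := he.good
    obtain ⟨m', hm', hgm'⟩ := he'.good
    rcases hτ'.lt_or_eq with hlt | rfl
    · have hle : τ' ≤ τ := by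
        by_contra! hlt'
        exact hc'.2.2.2.2.2 τ' ⟨hlt', hlt⟩ hc.2.2.2.2.1
      exact ⟨m, m', hm, hm', by linarith [hm.2, he.lt_right, he'.lt_left, hm'.1], hgm, hgm'⟩
    · obtain rfl := hc.unique_right hc'
      obtain ⟨rfl, rfl⟩ := he.unique h0 h1 he'
      exact ⟨m, m, hm, hm, le_rfl, hgm, hgm⟩
  exact ⟨u, m, m', v, he.lt_left, hm.1.le, hmm, hm'.2.le, he'.lt_right, he.dist_left, he'.dist_right, left, right,
    hgm, hgm', fun x hx p hp => he.notMem_ball ⟨hx.1, hx.2.trans hm.2.le⟩ hp,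
    fun x hx p hp => he'.notMem_ball ⟨hm'.1.le.trans hx.1, hx.2⟩ hp⟩

variable {F : Set ι} {z : ℂ} {ρ R : ℝ} {N : Finset ℂ} {a : ℂ → ℝ → ℂ} {anc : ℂ → Finset ℂ} {V : Set ℂ} {b : ↥Vᶜ}
  {Λ : Set (FundamentalGroup ↥Vᶜ b)} {i : ι} {u m m' v : ℝ}

theorem Radii.disjoint_ball (hR : Radii g P r R₀) (hVP : V ⊆ P) {p : ℂ} (hp : p ∈ P) (hpV : p ∉ V) :
    Disjoint (ball p R₀) V := by
  rw [disjoint_left]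
  intro w hw hwV
  have hne : p ≠ w := fun h => hpV (h ▸ hwV)
  have := hR.sep p hp w (hVP hwV) hne
  rw [mem_ball'] at hw
  linarith [dist_nonneg (x := p) (y := w)]

theorem Ends.off_tree (hg : CurveSystem g P) (hR : Radii g P r R₀) (hF : Frame g P R₀ R z ρ)
    (h : IsGrown g P r R₀ F z ρ N a) (hi : i ∉ F) (he : Ends (g i) P r R₀ u m m' v) {x : ℝ}
    (hx : x ∈ Icc u m ∨ x ∈ Icc m' v) : g i x ∉ far R ∪ strands a N := by
  have := he.pos
  have := he.le_mid
  have := he.mid_le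
  have := he.mid_le'
  have := he.lt_one
  intro hT
  rcases hx with hx | hx
  · obtain ⟨p, hp, hb⟩ := h.curve_near hg hR hF hi ⟨by linarith [hx.1], by linarith [hx.2]⟩ hT
    exact he.off_left x hx p hp hb
  · obtain ⟨p, hp, hb⟩ := h.curve_near hg hR hF hi ⟨by linarith [hx.1], by linarith [hx.2]⟩ hT
    exact he.off_right x hx p hp hb

theorem Ends.isWord (hg : CurveSystem g P) (hR : Radii g P r R₀) (hF : Frame g P R₀ R z ρ)
    [Finite ι] (h : IsGrown g P r R₀ F z ρ N a) (hT : ArcTree R N a anc) (hVP : V ⊆ P)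
    (hA : Alphabet b (far R ∪ strands a N) (openStrands a N) Λ)
    (hi : i ∉ F) (he : Ends (g i) P r R₀ u m m' v) (hV : ∀ x ∈ Icc u v, g i x ∉ V) (Z : Finset ℝ)
    (hZ : ∀ x ∈ Ioo (0 : ℝ) 1, g i x ∈ P → x ∈ Z) :
    IsWord (far R ∪ strands a N) Λ (∑ t ∈ Z, (sphere (g i t) r ∩ (far R ∪ strands a N)).ncard)
      (piece (g i) (hg.cont i) (he.le_mid.trans (he.mid_le.trans he.mid_le')) hV) := by
  have h0 := he.pos
  have h1 := he.le_mid
  have h2 := he.mid_le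
  have h3 := he.mid_le'
  have h4 := he.lt_one
  have hmem : ∀ x ∈ Icc m m', x ∈ Icc (0 : ℝ) 1 := fun x hx => ⟨by linarith [hx.1], by linarith [hx.2]⟩
  have w1 : IsWord (far R ∪ strands a N) Λ 0 (piece (g i) (hg.cont i) h1 fun x hx => hV x ⟨hx.1, hx.2.trans (h2.trans h3)⟩) :=
    .of_disjoint hA fun t => he.off_tree hg hR hF h hi (Or.inl (segPath_mem h1 t))
  have w3 : IsWord (far R ∪ strands a N) Λ 0 (piece (g i) (hg.cont i) h3 fun x hx => hV x ⟨(h1.trans h2).trans hx.1, hx.2⟩) :=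
    .of_disjoint hA fun t => he.off_tree hg hR hF h hi (Or.inr (segPath_mem h3 t))
  have w2 := isWord_piece_of_nodes hA (hg.cont i) hR.pos hR.lt (fun p hp hpV => hR.disjoint_ball hVP hp hpV)
    (fun p hp => h.sphere_subset_openStrands hR hF hT hp) (fun p hp => h.finite_sphere hg hR hF hp) h2
    (fun x hx => hV x ⟨h1.trans hx.1, hx.2.trans h3⟩) he.mid he.mid'
    (fun x hx hxT => h.curve_near hg hR hF hi (hmem x hx) hxT)
    (fun p hp x hx hxr => (hR.near i p hp x (hmem x hx) hxr).imp fun t ht => ht.2)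
    (fun x hx x' hx' => hR.good i x (hmem x hx) x' (hmem x' hx')) Z
    (fun x hx => hZ x ⟨by linarith [hx.1], by linarith [hx.2]⟩)
  have om := he.off_tree hg hR hF h hi (Or.inl (right_mem_Icc.2 h1))
  have om' := he.off_tree hg hR hF h hi (Or.inr (left_mem_Icc.2 h3))
  have w := w1.trans hA om (w2.trans hA om' w3)
  rw [zero_add, add_zero] at w
  exact w.congr (((piece_trans (g i) (hg.cont i) h1 (h2.trans h3) hV).trans
    ((Path.Homotopic.refl _).hcomp (piece_trans (g i) (hg.cont i) h2 h3 _))).symm)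

end Ends

section Counting

open Set Metric
open scoped Pointwise

theorem Set.Finite.exists_finset_pow {G : Type*} [Group G] {Λ : Set G} (hΛ : Λ.Finite) (k : ℕ) :
    ∃ W : Finset G, (W : Set G) = Λ ^ k ∧ W.card ≤ Λ.ncard ^ k := by
  classical
  refine ⟨hΛ.toFinset ^ k, by simp, ?_⟩
  rw [ncard_eq_toFinset_card Λ hΛ]
  exact Finset.card_pow_le

variable {ι : Type*} {g : ι → ℝ → ℂ} {P : Finset ℂ} {r R₀ : ℝ}
  {F : Set ι} {z : ℂ} {ρ R : ℝ} {N : Finset ℂ} {a : ℂ → ℝ → ℂ} {anc : ℂ → Finset ℂ} {V : Set ℂ} {b : ↥Vᶜ}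
  {Λ : Set (FundamentalGroup ↥Vᶜ b)} {i : ι}

theorem starConvex_ball (x : ℂ) (hR : 0 < R₀) : StarConvex ℝ x (ball x R₀) :=
  (convex_ball x R₀).starConvex (mem_ball_self hR)

theorem Radii.notMem_of_ball (hR : Radii g P r R₀) (hVP : V ⊆ P) {p : ℂ} (hp : p ∈ P) {w : ℂ} (hw : w ∈ ball p R₀)
    (hwp : w ≠ p) : w ∉ V := by
  intro hwV
  have := hR.sep p hp w (hVP hwV) hwp.symm
  rw [mem_ball'] at hw
  linarith [dist_nonneg (x := p) (y := w)]

theorem exists_isWord [Finite ι] (hg : CurveSystem g P) (hR : Radii g P r R₀) (hF : Frame g P R₀ R z ρ)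
    (h : IsGrown g P r R₀ F z ρ N a) (hT : ArcTree R N a anc) (hVP : V ⊆ P)
    (hA : Alphabet b (far R ∪ strands a N) (openStrands a N) Λ)
    (hi : i ∉ F) {U W : ℂ} (hU : U ∈ V) (hW : W ∈ V) (h0 : g i 0 = U) (h1 : g i 1 = W)
    (hV : ∀ x ∈ Ioo (0 : ℝ) 1, g i x ∉ V) {x y : ↥Vᶜ} (hx : (x : ℂ) ∈ sphere U r) (hy : (y : ℂ) ∈ sphere W r)
    (hxT : (x : ℂ) ∉ far R ∪ strands a N) (hyT : (y : ℂ) ∉ far R ∪ strands a N) (Z : Finset ℝ)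
    (hZ : ∀ x ∈ Ioo (0 : ℝ) 1, g i x ∈ P → x ∈ Z) :
    ∃ Q : Path x y, IsWord (far R ∪ strands a N) Λ ((sphere U r ∩ (far R ∪ strands a N)).ncard +
        (∑ t ∈ Z, (sphere (g i t) r ∩ (far R ∪ strands a N)).ncard +
          (sphere W r ∩ (far R ∪ strands a N)).ncard)) Q ∧
      AvoidHomotopic V (curvePath (g i) (hg.cont i) h0 h1)
        ((Path.segment U (x : ℂ)).trans ((Q.map continuous_subtype_val).trans (Path.segment W (y : ℂ)).symm)) := by
  have hUP : U ∈ P := hVP hU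
  have hWP : W ∈ P := hVP hW
  obtain ⟨u, m, m', v, he⟩ := hg.exists_ends hR (i := i) (h0 ▸ hUP) (h1 ▸ hWP)
  have huv : u ≤ v := he.le_mid.trans (he.mid_le.trans he.mid_le')
  have hsph : ∀ {p : ℂ}, p ∈ P → Disjoint (sphere p r) V := fun {p} hp => by
    rw [disjoint_left]
    intro w hw
    refine hR.notMem_of_ball hVP hp (sphere_subset_closedBall.trans (closedBall_subset_ball hR.lt) hw) ?_
    rintro rfl
    rw [mem_sphere, dist_self] at hw
    exact hR.pos.ne hw
  have arc : ∀ {p : ℂ}, p ∈ P → ∀ {x y : ↥Vᶜ}, (x : ℂ) ∈ sphere p r → (y : ℂ) ∈ sphere p r →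
      (x : ℂ) ∉ far R ∪ strands a N → (y : ℂ) ∉ far R ∪ strands a N →
      ∃ q : Path x y, (∀ t, (q t : ℂ) ∈ sphere p r) ∧
        IsWord (far R ∪ strands a N) Λ (sphere p r ∩ (far R ∪ strands a N)).ncard q := fun {p} hp {x y} hx hy hxT hyT =>
    exists_isWord_arc hA hR.pos (hsph hp) (h.sphere_subset_openStrands hR hF hT hp)
      (h.finite_sphere hg hR hF hp) hx hy hxT hyT
  have hVuv : ∀ t ∈ Icc u v, g i t ∉ V := fun t ht => hV t ⟨he.pos.trans_le ht.1, ht.2.trans_lt he.lt_one⟩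
  have ou := he.off_tree hg hR hF h hi (Or.inl (left_mem_Icc.2 he.le_mid))
  have ov := he.off_tree hg hR hF h hi (Or.inr (right_mem_Icc.2 he.mid_le'))
  have du : g i u ∈ sphere U r := by rw [← h0]; exact he.dist_left
  have dv : g i v ∈ sphere W r := by rw [← h1]; exact he.dist_right
  obtain ⟨p, hp, hpw⟩ := arc hUP (x := x) (y := ⟨g i u, hVuv u (left_mem_Icc.2 huv)⟩) hx du hxT ou
  obtain ⟨q, hq, hqw⟩ := arc hWP (x := ⟨g i v, hVuv v (right_mem_Icc.2 huv)⟩) (y := y) dv hy ov hyT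
  have hsb : ∀ p : ℂ, sphere p r ⊆ ball p R₀ := fun p =>
    sphere_subset_closedBall.trans (closedBall_subset_ball hR.lt)
  have hw := he.isWord hg hR hF h hT hVP hA hi hVuv Z hZ
  refine ⟨_, hpw.trans hA ou (hw.trans hA ov hqw), ?_⟩
  have hR₀ := hR.pos.trans hR.lt
  exact curvePath_standard (hg.cont i) h0 h1 he.pos huv he.lt_one hV hU hW (starConvex_ball U hR₀)
    (fun w hw hne => hR.notMem_of_ball hVP hUP hw hne) (starConvex_ball W hR₀)
    (fun w hw hne => hR.notMem_of_ball hVP hWP hw hne) (fun t ht => h0 ▸ he.near_left t ht)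
    (fun t ht => h1 ▸ he.near_right t ht) p q (fun t => hsb _ (hp t)) (fun t => hsb _ (hq t))

theorem card_le_of_words [Finite ι] (hg : CurveSystem g P) (hR : Radii g P r R₀) (hF : Frame g P R₀ R z ρ)
    (h : IsGrown g P r R₀ F z ρ N a) (hT : ArcTree R N a anc) (hVN : ∀ w ∈ V, w ∈ N) (hV : V.Finite)
    {U W : ℂ} (hU : U ∈ V) (hW : W ∈ V) (J : Finset ι) (hJF : ∀ i ∈ J, i ∉ F) (h0 : ∀ i ∈ J, g i 0 = U)
    (h1 : ∀ i ∈ J, g i 1 = W) (hgV : ∀ i ∈ J, ∀ x ∈ Ioo (0 : ℝ) 1, g i x ∉ V)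
    (hne : ∀ i ∈ J, ∀ j ∈ J, i ≠ j → ¬ HomotopicIn V (fun t => g i t) (fun t => g j t)) (k : ℕ)
    (hk : ∀ i ∈ J, ∃ Z : Finset ℝ, (∀ x ∈ Ioo (0 : ℝ) 1, g i x ∈ P → x ∈ Z) ∧
      (sphere U r ∩ (far R ∪ strands a N)).ncard + (∑ t ∈ Z, (sphere (g i t) r ∩ (far R ∪ strands a N)).ncard +
          (sphere W r ∩ (far R ∪ strands a N)).ncard) ≤ k) :
    J.card ≤ (3 * 2 ^ V.ncard + 1) ^ k := by
  classical
  rcases J.eq_empty_or_nonempty with rfl | ⟨j, hj⟩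
  · simp
  have hVP : V ⊆ P := fun w hw => h.subset (hVN w hw)
  have hVT : V ⊆ far R ∪ strands a N := fun w hw => Or.inr (hT.mem_strands (hVN w hw) subset_rfl)
  obtain ⟨u, m, m', v, he⟩ := hg.exists_ends hR (i := j) (by rw [h0 j hj]; exact hVP hU)
    (by rw [h1 j hj]; exact hVP hW)
  have ou := he.off_tree hg hR hF h (hJF j hj) (Or.inl (left_mem_Icc.2 he.le_mid))
  have ov := he.off_tree hg hR hF h (hJF j hj) (Or.inr (right_mem_Icc.2 he.mid_le'))
  let b : ↥Vᶜ := ⟨g j u, fun hh => ou (hVT hh)⟩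
  let y : ↥Vᶜ := ⟨g j v, fun hh => ov (hVT hh)⟩
  have hb : (b : ℂ) ∈ sphere U r := by rw [← h0 j hj]; exact he.dist_left
  have hy : (y : ℂ) ∈ sphere W r := by rw [← h1 j hj]; exact he.dist_right
  have seg : ∀ {p : ℂ} {x : ↥Vᶜ}, p ∈ V → (x : ℂ) ∈ sphere p r →
      AvoidHomotopic V (Path.segment p (x : ℂ)) (Path.segment p (x : ℂ)) := by
    intro p x hp hx
    refine .refl fun t h0 _ => hR.notMem_of_ball hVP (hVP hp) ?_ fun he => h0 ?_
    · exact (starConvex_ball p (hR.pos.trans hR.lt)).segment_subset (sphere_subset_closedBall.trans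
        (closedBall_subset_ball hR.lt) hx) (Path.range_segment p (x : ℂ) ▸ mem_range_self t)
    · exact Path.segment_injective_of_ne (show p ≠ (x : ℂ) from fun h => x.2 (h ▸ hp)) (he.trans (Path.source _).symm)
  obtain ⟨Λ, hΛ, hcard, hA⟩ := hT.exists_alphabet hV hVN (b := b) ou
  obtain ⟨β, hβ⟩ := hA.joined y ov
  have hex : ∀ i : J, ∃ Q : Path b y, IsWord (far R ∪ strands a N) Λ k Q ∧
      AvoidHomotopic V (curvePath (g i) (hg.cont i) (h0 i i.2) (h1 i i.2))
        ((Path.segment U (b : ℂ)).trans ((Q.map continuous_subtype_val).trans (Path.segment W (y : ℂ)).symm)) := by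
    intro i
    obtain ⟨Z, hZ, hle⟩ := hk i i.2
    obtain ⟨Q, hQ, hQh⟩ := exists_isWord hg hR hF h hT hVP hA (hJF i i.2) hU hW (h0 i i.2) (h1 i i.2) (hgV i i.2)
      hb hy ou ov Z hZ
    exact ⟨Q, hQ.mono hA hle, hQh⟩
  choose Q hQ hQh using hex
  obtain ⟨Wd, hWd, hWc⟩ := hΛ.exists_finset_pow k
  let word : J → FundamentalGroup ↥Vᶜ b := fun i => loopClass ((Path.refl b).trans ((Q i).trans β.symm))
  have hword : ∀ i, word i ∈ Wd := fun i => by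
    rw [← Finset.mem_coe, hWd]
    exact hQ i (Path.refl b) β (fun t => ou) hβ
  have hinj : Function.Injective word := by
    intro i i' heq
    by_contra hii
    refine hne i i.2 i' i'.2 (fun hh => hii (Subtype.ext hh)) ?_
    have hQQ : (Q i).Homotopic (Q i') := by
      simp only [word, loopClass, Path.Homotopic.Quotient.mk_trans, Path.Homotopic.Quotient.mk_symm] at heq
      rw [← Path.Homotopic.Quotient.eq]
      simpa using congrArg (fun c => c.trans (Path.Homotopic.Quotient.mk β)) heq
    have key : AvoidHomotopic V (curvePath (g i) (hg.cont i) (h0 i i.2) (h1 i i.2))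
        (curvePath (g i') (hg.cont i') (h0 i' i'.2) (h1 i' i'.2)) := by
      refine (hQh i).trans (AvoidHomotopic.trans ?_ (hQh i').symm)
      exact (seg hU hb).hcomp b.2 ((AvoidHomotopic.of_homotopic hQQ).hcomp y.2 (seg hW hy).symm₂)
    have := key.homotopicIn
    simpa [curvePath, segPath] using this
  have := Finset.card_le_card_of_injOn word (s := Finset.univ) (t := Wd) (fun i _ => hword i) hinj.injOn
  rw [Finset.card_univ, Fintype.card_coe] at this
  exact this.trans (hWc.trans (Nat.pow_le_pow_left hcard k))

end Counting

section Probes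

open Set Metric

/-- The segment from `w` towards `U`, of relative length `c w`. -/
def probe (U : ℂ) (c : ℂ → ℝ) (w : ℂ) (t : ℝ) : ℂ := w + ((t * c w : ℝ) : ℂ) * (U - w)

/-- For `w ∈ V \ K`, the segment from `w` towards `U` is cut where it first meets `K` or a point of `V`. -/
structure IsProbe (V K : Set ℂ) (U : ℂ) (c : ℂ → ℝ) : Prop where
  mem : U ∈ K
  pos : ∀ w ∈ V \ K, 0 < c w
  le : ∀ w ∈ V \ K, c w ≤ 1
  end_mem : ∀ w ∈ V \ K, probe U c w 1 ∈ K ∪ V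
  off : ∀ w ∈ V \ K, ∀ t ∈ Ioo (0 : ℝ) 1, probe U c w t ∉ K ∪ V

variable {V K : Set ℂ} {U : ℂ} {c : ℂ → ℝ}

theorem continuous_probe (w : ℂ) : Continuous (probe U c w) := by
  unfold probe
  fun_prop

@[simp]
theorem probe_zero (w : ℂ) : probe U c w 0 = w := by simp [probe]

theorem exists_isProbe (hV : V.Finite) (hK : IsClosed K) (hU : U ∈ K) : ∃ c, IsProbe V K U c := by
  have hex : ∀ w ∈ V \ K, ∃ c : ℝ, 0 < c ∧ c ≤ 1 ∧ w + (c : ℂ) * (U - w) ∈ K ∪ V ∧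
      ∀ t ∈ Ioo 0 c, w + (t : ℂ) * (U - w) ∉ K ∪ V := by
    rintro w ⟨hw, hwK⟩
    have hne : U - w ≠ 0 := sub_ne_zero.2 fun h => hwK (h ▸ hU)
    have hcl : IsClosed (K ∪ V \ {w}) := hK.union (hV.subset sdiff_subset).isClosed
    have hcomp : IsCompact (Icc (0 : ℝ) 1 ∩ (fun t : ℝ => w + (t : ℂ) * (U - w)) ⁻¹' (K ∪ V \ {w})) :=
      isCompact_Icc.inter_right (hcl.preimage (by fun_prop))
    obtain ⟨c, ⟨hc, hcK⟩, hmin⟩ := hcomp.exists_isLeast ⟨1, by simp, Or.inl (by simpa using hU)⟩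
    have hself : ∀ t : ℝ, w + (t : ℂ) * (U - w) = w → t = 0 := fun t h => by
      rw [add_eq_left, mul_eq_zero] at h
      exact_mod_cast h.resolve_right hne
    refine ⟨c, hc.1.lt_of_ne ?_, hc.2, hcK.imp_right And.left, ?_⟩
    · rintro rfl
      rcases hcK with h | h <;> simp at h
      exact hwK h
    · rintro t ht (h | h)
      · exact absurd (hmin ⟨⟨ht.1.le, ht.2.le.trans hc.2⟩, Or.inl h⟩) (not_le.2 ht.2)
      · exact absurd (hmin ⟨⟨ht.1.le, ht.2.le.trans hc.2⟩, Or.inr ⟨h, fun hh => ht.1.ne' (hself t hh)⟩⟩) (not_le.2 ht.2)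
  choose! c hc using hex
  refine ⟨c, hU, fun w hw => (hc w hw).1, fun w hw => (hc w hw).2.1, fun w hw => ?_, fun w hw t ht => ?_⟩
  · simpa [probe] using (hc w hw).2.2.1
  · have h0 := (hc w hw).1
    have := (hc w hw).2.2.2 (t * c w) ⟨mul_pos ht.1 h0, by nlinarith [ht.2]⟩
    simpa [probe] using this

namespace IsProbe

theorem ne (h : IsProbe V K U c) {w : ℂ} (hw : w ∈ V \ K) : U - w ≠ 0 :=
  sub_ne_zero.2 fun he => hw.2 (he ▸ h.mem)

theorem injective (h : IsProbe V K U c) {w : ℂ} (hw : w ∈ V \ K) {t s : ℝ} (he : probe U c w t = probe U c w s) :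
    t = s := by
  have := mul_right_cancel₀ (h.ne hw) (add_left_cancel (a := w) he)
  have h2 : t * c w = s * c w := by exact_mod_cast this
  exact mul_right_cancel₀ (h.pos w hw).ne' h2

theorem notMem (h : IsProbe V K U c) {w : ℂ} (hw : w ∈ V \ K) {t : ℝ} (ht : t ∈ Icc (0 : ℝ) 1)
    (hK : probe U c w t ∈ K) : t = 1 := by
  by_contra h1
  rcases ht.1.eq_or_lt with rfl | h0
  · rw [probe_zero] at hK
    exact hw.2 hK
  · exact h.off w hw t ⟨h0, ht.2.lt_of_ne h1⟩ (Or.inl hK)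

theorem dist_lt (h : IsProbe V K U c) {w : ℂ} (hw : w ∈ V \ K) : dist (probe U c w 1) U < dist w U := by
  have h1 : probe U c w 1 - U = ((1 - c w : ℝ) : ℂ) * (w - U) := by
    simp only [probe]
    push_cast
    ring
  rw [dist_eq_norm, h1, norm_mul, Complex.norm_real, Real.norm_of_nonneg (by linarith [h.le w hw]), dist_eq_norm]
  have : 0 < ‖w - U‖ := norm_pos_iff.2 (by rw [← neg_sub, neg_ne_zero]; exact h.ne hw)
  nlinarith [h.pos w hw]

theorem eq_of_lt (h : IsProbe V K U c) {w w' : ℂ} (hw : w ∈ V \ K) (hw' : w' ∈ V \ K) {t s : ℝ}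
    (ht : t ∈ Ioo (0 : ℝ) 1) (hs : s ∈ Ioo (0 : ℝ) 1) (he : probe U c w t = probe U c w' s)
    (hle : t * c w ≤ s * c w') : w = w' := by
  have a0 := mul_pos ht.1 (h.pos w hw)
  have a1 : t * c w < 1 := by nlinarith [ht.2, h.pos w hw, h.le w hw]
  have b1 : s * c w' < 1 := by nlinarith [hs.2, h.pos w' hw', h.le w' hw']
  have hc' := h.pos w' hw'
  set A := t * c w
  set B := s * c w'
  have he' : w + (A : ℂ) * (U - w) = w' + (B : ℂ) * (U - w') := he
  have hA : (1 - (A : ℂ)) ≠ 0 := by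
    have : (1 - A : ℝ) ≠ 0 := by linarith
    exact_mod_cast this
  have hw1 : w = w' + (((B - A) / (1 - A) : ℝ) : ℂ) * (U - w') := by
    push_cast
    field_simp
    linear_combination he'
  have hq0 : 0 ≤ (B - A) / (1 - A) := div_nonneg (by linarith) (by linarith)
  have hqB : (B - A) / (1 - A) < B := by
    rw [div_lt_iff₀ (by linarith)]
    nlinarith
  rcases hq0.eq_or_lt with h0 | h0
  · rw [← h0] at hw1
    simpa using hw1
  · exfalso
    refine h.off w' hw' ((B - A) / (1 - A) / c w') ⟨div_pos h0 hc', ?_⟩ (Or.inr ?_)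
    · rw [div_lt_one hc']
      exact hqB.trans_le (by simp only [B]; nlinarith [hs.2])
    · have : probe U c w' ((B - A) / (1 - A) / c w') = w := by
        rw [probe, div_mul_cancel₀ _ hc'.ne', ← hw1]
      rw [this]
      exact hw.1

theorem eq_of_mem (h : IsProbe V K U c) {w w' : ℂ} (hw : w ∈ V \ K) (hw' : w' ∈ V \ K) {t s : ℝ}
    (ht : t ∈ Ioo (0 : ℝ) 1) (hs : s ∈ Ioo (0 : ℝ) 1) (he : probe U c w t = probe U c w' s) : w = w' :=
  (le_total (t * c w) (s * c w')).elim (fun hle => h.eq_of_lt hw hw' ht hs he hle)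
    fun hle => (h.eq_of_lt hw' hw hs ht he.symm hle).symm

end IsProbe

end Probes

section CurveDrawings

open Set Metric

variable {E : Type*} {f : E → ℝ → ℂ} {V : Set ℂ} {U W : ℂ} {C : Finset ((E × ℝ) × (E × ℝ))}

/-- A drawing of edges from `U` to `W`, where `C` is the finite set of ordered crossings. -/
structure CurveDrawing (f : E → ℝ → ℂ) (V : Set ℂ) (U W : ℂ) (C : Finset ((E × ℝ) × (E × ℝ))) : Prop where
  cont : ∀ e, Continuous (f e)
  finite : V.Finite
  source_mem : U ∈ V
  target_mem : W ∈ V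
  source : ∀ e, f e 0 = U
  target : ∀ e, f e 1 = W
  interior : ∀ e, ∀ t ∈ Ioo (0 : ℝ) 1, f e t ∉ V
  mem_crossings : ∀ p, p ∈ C ↔ p.1 ≠ p.2 ∧ p.1.2 ∈ Ioo (0 : ℝ) 1 ∧ p.2.2 ∈ Ioo (0 : ℝ) 1 ∧
    f p.1.1 p.1.2 = f p.2.1 p.2.2

/-- The union of the curves. -/
def curveUnion (f : E → ℝ → ℂ) : Set ℂ := ⋃ e, f e '' Icc 0 1

theorem mem_curveUnion (e : E) {t : ℝ} (ht : t ∈ Icc (0 : ℝ) 1) : f e t ∈ curveUnion f :=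
  mem_iUnion.2 ⟨e, t, ht, rfl⟩

/-- The curves `f` together with the probes from the points of `V` that are not on any curve. -/
def withProbes (f : E → ℝ → ℂ) (V : Set ℂ) (U : ℂ) (c : ℂ → ℝ) : E ⊕ ↥(V \ curveUnion f) → ℝ → ℂ :=
  Sum.elim f fun w => probe U c w

theorem eq_zero_or_one {t : ℝ} (ht : t ∈ Icc (0 : ℝ) 1) (h : t ∉ Ioo (0 : ℝ) 1) : t = 0 ∨ t = 1 := by
  by_contra! hh
  exact h ⟨ht.1.lt_of_ne hh.1.symm, ht.2.lt_of_ne hh.2⟩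

theorem exists_frame {ι : Type*} [Finite ι] {g : ι → ℝ → ℂ} {P : Finset ℂ} {z : ℂ} {R₀ : ℝ} (hg : ∀ i, Continuous (g i))
    (hR₀ : 0 < R₀) (hz : z ∈ P) (hre : ∀ i, ∀ t ∈ Icc (0 : ℝ) 1, (g i t).re ≤ z.re) (hre' : ∀ p ∈ P, p.re ≤ z.re) :
    ∃ R ρ, Frame g P R₀ R z ρ := by
  have hb : Bornology.IsBounded ((⋃ i, g i '' Icc 0 1) ∪ P) :=
    ((isCompact_iUnion fun i => isCompact_Icc.image (hg i)).union P.finite_toSet.isCompact).isBounded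
  obtain ⟨R', hR'⟩ := hb.exists_norm_le
  have hzR : ‖z‖ < R' + R₀ := (hR' z (Or.inr hz)).trans_lt (by linarith)
  have hR'0 : 0 ≤ R' := (norm_nonneg _).trans (hR' z (Or.inr hz))
  obtain ⟨ρ, hρ, he, hlt⟩ := exists_first_exit (φ := fun t : ℝ => ‖z + t‖) (ρ := R' + R₀) (a := 0)
    (b := R' + R₀ + ‖z‖) (by fun_prop) (by positivity) (by simpa using hzR) (by
      have := norm_sub_norm_le ((R' + R₀ + ‖z‖ : ℝ) : ℂ) (-z)
      rw [norm_neg, Complex.norm_real, Real.norm_of_nonneg (by positivity), sub_neg_eq_add, add_comm _ z] at this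
      linarith)
  refine ⟨R' + R₀, ρ, hz, hρ.1, fun i t ht => ?_, fun p hp => ?_, hre, hre', fun t ht => ?_, he⟩
  · exact (hR' _ (Or.inl (mem_iUnion.2 ⟨i, t, ht, rfl⟩))).trans_lt (by linarith)
  · linarith [hR' p (Or.inr hp)]
  · have := hlt (t * ρ) ⟨mul_nonneg ht.1 hρ.1.le, by nlinarith [ht.2, hρ.1]⟩
    simpa using this

namespace CurveDrawing

variable {c : ℂ → ℝ} {P : Finset ℂ}

theorem isCompact_curveUnion [Finite E] (d : CurveDrawing f V U W C) : IsCompact (curveUnion f) :=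
  isCompact_iUnion fun e => isCompact_Icc.image (d.cont e)

theorem mem_of_notMem_Ioo (d : CurveDrawing f V U W C) (e : E) {t : ℝ} (ht : t ∈ Icc (0 : ℝ) 1)
    (h : t ∉ Ioo (0 : ℝ) 1) : f e t ∈ V := by
  rcases eq_zero_or_one ht h with rfl | rfl
  · exact d.source e ▸ d.source_mem
  · exact d.target e ▸ d.target_mem

theorem curveSystem (d : CurveDrawing f V U W C) (hc : IsProbe V (curveUnion f) U c) (hVP : V ⊆ P)
    (hCP : ∀ p ∈ C, f p.1.1 p.1.2 ∈ P) (hcP : ∀ w ∈ V \ curveUnion f, probe U c w 1 ∈ P)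
    (hPV : ∀ p ∈ P, p ∈ curveUnion f ∪ V) : CurveSystem (withProbes f V U c) P where
  cont := by
    rintro (e | w)
    · exact d.cont e
    · exact continuous_probe _
  coincide := by
    have key : ∀ e, ∀ w : ↥(V \ curveUnion f), ∀ t ∈ Icc (0 : ℝ) 1, ∀ s ∈ Icc (0 : ℝ) 1,
        f e t = probe U c w s → probe U c w s ∈ P := by
      intro e w t ht s hs he
      have := hc.notMem w.2 hs (he ▸ mem_curveUnion e ht)
      exact this ▸ hcP w w.2
    have ends : ∀ w : ↥(V \ curveUnion f), ∀ t ∈ Icc (0 : ℝ) 1, t ∉ Ioo (0 : ℝ) 1 → probe U c w t ∈ P := by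
      intro w t ht hn
      rcases eq_zero_or_one ht hn with rfl | rfl
      · rw [probe_zero]
        exact hVP w.2.1
      · exact hcP w w.2
    rintro (e | w) (e' | w') t ht s hs he <;> simp only [withProbes, Sum.elim_inl, Sum.elim_inr] at he ⊢
    · by_cases ht' : t ∈ Ioo (0 : ℝ) 1
      · by_cases hs' : s ∈ Ioo (0 : ℝ) 1
        · by_cases heq : (e, t) = (e', s)
          · obtain ⟨rfl, rfl⟩ := Prod.mk.inj heq
            exact Or.inr ⟨rfl, rfl⟩
          · exact Or.inl (hCP ((e, t), (e', s)) ((d.mem_crossings _).2 ⟨heq, ht', hs', he⟩))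
        · exact Or.inl (he ▸ hVP (d.mem_of_notMem_Ioo e' hs hs'))
      · exact Or.inl (hVP (d.mem_of_notMem_Ioo e ht ht'))
    · exact Or.inl (he ▸ key e w' t ht s hs he)
    · exact Or.inl (key e' w s hs t ht he.symm)
    · by_cases ht' : t ∈ Ioo (0 : ℝ) 1
      · by_cases hs' : s ∈ Ioo (0 : ℝ) 1
        · obtain rfl : w = w' := Subtype.ext (hc.eq_of_mem w.2 w'.2 ht' hs' he)
          exact Or.inr ⟨rfl, hc.injective w.2 he⟩
        · exact Or.inl (he ▸ ends w' s hs hs')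
      · exact Or.inl (ends w t ht ht')
  finite := by
    have h01 : ({0, 1} : Set ℝ).Finite := toFinite _
    rintro (e | w) <;> simp only [withProbes, Sum.elim_inl, Sum.elim_inr]
    · let T := {t ∈ Ioo (0 : ℝ) 1 | f e t ∈ P ∧ ∀ p ∈ C, p.1 ≠ (e, t)}
      have hT : T.Finite := by
        refine Finite.of_injOn (f := f e) (t := P) (fun t ht => ht.2.1) (fun t ht s hs he => ?_) P.finite_toSet
        by_contra hne
        exact ht.2.2 ((e, t), (e, s)) ((d.mem_crossings _).2 ⟨fun h => hne (Prod.mk.inj h).2, ht.1, hs.1, he⟩) rfl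
      refine ((h01.union (C.finite_toSet.image fun p => p.1.2)).union hT).subset ?_
      rintro t ⟨ht, hP⟩
      by_cases ht' : t ∈ Ioo (0 : ℝ) 1
      · by_cases hp : ∃ p ∈ C, p.1 = (e, t)
        · obtain ⟨p, hp, he⟩ := hp
          exact Or.inl (Or.inr ⟨p, hp, by simp [he]⟩)
        · exact Or.inr ⟨ht', hP, fun p hpC he => hp ⟨p, hpC, he⟩⟩
      · exact Or.inl (Or.inl (eq_zero_or_one ht ht'))
    · refine h01.subset fun t ⟨ht, hP⟩ => ?_
      by_contra hn
      exact hc.off w w.2 t (by_contra fun h => hn (eq_zero_or_one ht h)) (hPV _ hP)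

theorem re_le (hc : IsProbe V (curveUnion f) U c) {x : ℝ} (hx : ∀ p ∈ curveUnion f ∪ V, p.re ≤ x)
    (i : E ⊕ ↥(V \ curveUnion f)) {t : ℝ} (ht : t ∈ Icc (0 : ℝ) 1) : (withProbes f V U c i t).re ≤ x := by
  rcases i with e | w <;> simp only [withProbes, Sum.elim_inl, Sum.elim_inr]
  · exact hx _ (Or.inl (mem_curveUnion e ht))
  · have h0 := hc.pos w w.2
    have h1 := hc.le w w.2
    have := convex_re_le x (hx w (Or.inr w.2.1)) (hx U (Or.inl hc.mem)) (a := 1 - t * c w) (b := t * c w)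
      (by nlinarith [ht.2]) (by nlinarith [ht.1]) (by ring)
    have he : probe U c w t = (1 - t * c w) • (w : ℂ) + (t * c w) • U := by
      simp only [probe, Complex.real_smul]
      push_cast
      ring
    rw [he]
    exact this

/-- A set of points that contains the rightmost point `z` and is closed under moving along the probes and along
a set `S` of curves, that meets all ends of probes on the curves, contains all of `V`. -/
theorem mem_of_closed (d : CurveDrawing f V U W C) (hc : IsProbe V (curveUnion f) U c) (hVP : V ⊆ P)
    (hcP : ∀ w ∈ V \ curveUnion f, probe U c w 1 ∈ P) {z : ℂ} (hz : z ∈ curveUnion f ∪ V) (hzP : z ∈ P) {e : ℂ → E}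
    (he : ∀ x ∈ curveUnion f, x ∈ f (e x) '' Icc 0 1) {S : Set E} (hzS : e z ∈ S)
    (hcS : ∀ w ∈ V \ curveUnion f, e (probe U c w 1) ∈ S) {N : Finset ℂ} (hzN : z ∈ N)
    (hN : ∀ i ∈ Sum.inl '' S ∪ range Sum.inr, ∀ τ ∈ Icc (0 : ℝ) 1, ∀ τ' ∈ Icc (0 : ℝ) 1,
      withProbes f V U c i τ ∈ N → withProbes f V U c i τ' ∈ P → withProbes f V U c i τ' ∈ N) {w : ℂ} (hw : w ∈ V) :
    w ∈ N := by
  have h0 : (0 : ℝ) ∈ Icc (0 : ℝ) 1 := by simp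
  have h1 : (1 : ℝ) ∈ Icc (0 : ℝ) 1 := by simp
  have edge : ∀ x ∈ curveUnion f, e x ∈ S → x ∈ P → (x ∈ N ↔ U ∈ N) := by
    intro x hx hxS hxP
    obtain ⟨t, ht, hxt⟩ := he x hx
    have a1 := hN (.inl (e x)) (Or.inl ⟨_, hxS, rfl⟩) t ht 0 h0
    have a2 := hN (.inl (e x)) (Or.inl ⟨_, hxS, rfl⟩) 0 h0 t ht
    simp only [withProbes, Sum.elim_inl, hxt, d.source] at a1 a2
    exact ⟨fun h => a1 h (hVP d.source_mem), fun h => a2 h hxP⟩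
  have hWU : W ∈ N ↔ U ∈ N := by
    have a1 := hN (.inl (e z)) (Or.inl ⟨_, hzS, rfl⟩) 1 h1 0 h0
    have a2 := hN (.inl (e z)) (Or.inl ⟨_, hzS, rfl⟩) 0 h0 1 h1
    simp only [withProbes, Sum.elim_inl, d.target, d.source] at a1 a2
    exact ⟨fun h => a1 h (hVP d.source_mem), fun h => a2 h (hVP d.target_mem)⟩
  have hprobe : ∀ w (hw : w ∈ V \ curveUnion f), w ∈ N ↔ probe U c w 1 ∈ N := by
    intro w hw
    have a1 := hN (.inr ⟨w, hw⟩) (Or.inr ⟨_, rfl⟩) 1 h1 0 h0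
    have a2 := hN (.inr ⟨w, hw⟩) (Or.inr ⟨_, rfl⟩) 0 h0 1 h1
    simp only [withProbes, Sum.elim_inr, probe_zero] at a1 a2
    exact ⟨fun h => a2 h (hcP w hw), fun h => a1 h (hVP hw.1)⟩
  have all : ∀ w ∈ V, w ∈ N ↔ U ∈ N := by
    by_contra! hbad
    obtain ⟨w, ⟨hw, hwN⟩, hmin⟩ := exists_min_image {w ∈ V | ¬ (w ∈ N ↔ U ∈ N)} (fun w => dist w U)
      (d.finite.subset fun w hw => hw.1) (by
        obtain ⟨w, hw, h⟩ := hbad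
        exact ⟨w, hw, fun hiff => by tauto⟩)
    by_cases hwK : w ∈ curveUnion f
    · obtain ⟨e', t, ht, rfl⟩ := mem_iUnion.1 hwK
      rcases eq_zero_or_one ht fun h => d.interior e' t h hw with rfl | rfl
      · exact hwN (by rw [d.source])
      · exact hwN (by rw [d.target, hWU])
    · refine hwN ((hprobe w ⟨hw, hwK⟩).trans ?_)
      by_cases hK : probe U c w 1 ∈ curveUnion f
      · exact edge _ hK (hcS w ⟨hw, hwK⟩) (hcP w ⟨hw, hwK⟩)
      · by_contra hcon
        exact absurd (hmin _ ⟨(hc.end_mem w ⟨hw, hwK⟩).resolve_left hK, hcon⟩) (not_le.2 (hc.dist_lt ⟨hw, hwK⟩))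
  refine (all w hw).2 ?_
  by_cases hzK : z ∈ curveUnion f
  · exact (edge z hzK hzS hzP).1 hzN
  · exact (all z (hz.resolve_left hzK)).1 hzN

end CurveDrawing

end CurveDrawings

section FewCrossings

open Set Metric

namespace CurveDrawing

variable {E : Type*} {f : E → ℝ → ℂ} {V : Set ℂ} {U W : ℂ} {C : Finset ((E × ℝ) × (E × ℝ))} {c : ℂ → ℝ}

theorem passages_subset (hc : IsProbe V (curveUnion f) U c) (S : Set E) {p : ℂ} (hp : p ∈ curveUnion f) :
    passages (withProbes f V U c) (Sum.inl '' S ∪ range Sum.inr) p ⊆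
      Prod.map Sum.inl id '' {x : E × ℝ | x.1 ∈ S ∧ x.2 ∈ Icc 0 1 ∧ f x.1 x.2 = p} ∪
        (fun w => (Sum.inr w, 1)) '' {w | probe U c w 1 = p} := by
  rintro ⟨i, t⟩ ⟨hi, ht, he⟩
  rcases hi with ⟨e, heS, rfl⟩ | ⟨w, rfl⟩
  · exact Or.inl ⟨(e, t), ⟨heS, ht, he⟩, rfl⟩
  · have he' : probe U c w t = p := he
    obtain rfl : t = 1 := hc.notMem w.2 ht (he' ▸ hp)
    exact Or.inr ⟨w, he', rfl⟩

theorem ncard_passages_le (d : CurveDrawing f V U W C) (hc : IsProbe V (curveUnion f) U c) (S : Set E) {p : ℂ}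
    (hp : p ∈ curveUnion f) {Q : Finset (E × ℝ)} (hQ : ∀ x : E × ℝ, x.1 ∈ S → x.2 ∈ Icc 0 1 → f x.1 x.2 = p → x ∈ Q) :
    (passages (withProbes f V U c) (Sum.inl '' S ∪ range Sum.inr) p).ncard ≤ Q.card + V.ncard := by
  have hB : (V \ curveUnion f).Finite := d.finite.subset sdiff_subset
  have := hB.to_subtype
  have hsub : {x : E × ℝ | x.1 ∈ S ∧ x.2 ∈ Icc 0 1 ∧ f x.1 x.2 = p} ⊆ Q := fun x hx => hQ x hx.1 hx.2.1 hx.2.2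
  have hfin := Q.finite_toSet.subset hsub
  refine (ncard_le_ncard (passages_subset hc S hp) ((hfin.image _).union (toFinite _))).trans ?_
  refine (ncard_union_le _ _).trans (add_le_add ((ncard_image_le hfin).trans ?_) ((ncard_image_le (toFinite _)).trans ?_))
  · exact (ncard_le_ncard hsub Q.finite_toSet).trans (ncard_coe_finset Q).le
  · refine (ncard_le_ncard (subset_univ _) finite_univ).trans ?_
    rw [ncard_univ, Nat.card_coe_set_eq]
    exact ncard_le_ncard sdiff_subset d.finite

/-- Few curves `S` suffice to control the number of pairwise non-homotopic curves that have few crossings with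
those of `S`. -/
theorem exists_card_le [Finite E] [Nonempty E] [DecidableEq E] (d : CurveDrawing f V U W C)
    (hne : ∀ e e', e ≠ e' → ¬ HomotopicIn V (fun t => f e t) (fun t => f e' t)) :
    ∃ S : Finset E, S.card ≤ V.ncard + 1 ∧ ∀ (k : ℕ) (J : Finset E),
      (∀ h ∈ J, h ∉ S ∧ (C.filter fun p => p.1.1 = h ∧ p.2.1 ∈ S).card ≤ k) →
        J.card ≤ (3 * 2 ^ V.ncard + 1) ^ (12 * V.ncard + 10 + (2 * V.ncard + 3) * k) := by
  classical
  obtain ⟨e₀⟩ := ‹Nonempty E›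
  have hUK : U ∈ curveUnion f := d.source e₀ ▸ mem_curveUnion e₀ (by simp)
  have hWK : W ∈ curveUnion f := d.target e₀ ▸ mem_curveUnion e₀ (by simp)
  have hKc : IsCompact (curveUnion f) := d.isCompact_curveUnion
  obtain ⟨c, hc⟩ := exists_isProbe d.finite hKc.isClosed hUK
  obtain ⟨z, hz, hzmax⟩ := (hKc.union d.finite.isCompact).exists_isMaxOn ⟨U, Or.inl hUK⟩ Complex.continuous_re.continuousOn
  have hB : (V \ curveUnion f).Finite := d.finite.subset sdiff_subset
  have := hB.to_subtype
  have he : ∀ x, ∃ e, x ∈ curveUnion f → x ∈ f e '' Icc 0 1 := by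
    intro x
    by_cases hx : x ∈ curveUnion f
    · exact (mem_iUnion.1 hx).imp fun e h _ => h
    · exact ⟨e₀, fun h => absurd h hx⟩
  choose e he using he
  let Q : Finset ℂ := insert z (hB.toFinset.image fun w => probe U c w 1)
  let P : Finset ℂ := d.finite.toFinset ∪ C.image (fun p => f p.1.1 p.1.2) ∪ Q
  let S : Finset E := Q.image e
  have hzQ : z ∈ Q := Finset.mem_insert_self _ _
  have hcQ : ∀ w ∈ V \ curveUnion f, probe U c w 1 ∈ Q := fun w hw =>
    Finset.mem_insert_of_mem (Finset.mem_image_of_mem _ (hB.mem_toFinset.2 hw))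
  have hQP : ∀ x ∈ Q, x ∈ P := fun x hx => Finset.mem_union_right _ hx
  have hQS : ∀ x ∈ Q, e x ∈ S := fun x hx => Finset.mem_image_of_mem e hx
  have hVP : V ⊆ P := fun w hw => Finset.mem_union_left _ (Finset.mem_union_left _ (d.finite.mem_toFinset.2 hw))
  have hCP : ∀ p ∈ C, f p.1.1 p.1.2 ∈ P := fun p hp =>
    Finset.mem_union_left _ (Finset.mem_union_right _ (Finset.mem_image_of_mem (fun p => f p.1.1 p.1.2) hp))
  have hPV : ∀ p ∈ P, p ∈ curveUnion f ∪ V := by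
    intro p hp
    simp only [P, Q, Finset.mem_union, Finset.mem_insert, Finset.mem_image, Finite.mem_toFinset] at hp
    rcases hp with (hp | ⟨x, hx, rfl⟩) | rfl | ⟨w, hw, rfl⟩
    · exact Or.inr hp
    · exact Or.inl (mem_curveUnion _ (Ioo_subset_Icc_self ((d.mem_crossings x).1 hx).2.1))
    · exact hz
    · exact hc.end_mem w hw
  have hScard : S.card ≤ V.ncard + 1 := by
    refine Finset.card_image_le.trans ((Finset.card_insert_le _ _).trans (Nat.succ_le_succ (Finset.card_image_le.trans ?_)))
    rw [← ncard_eq_toFinset_card _ hB]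
    exact ncard_le_ncard sdiff_subset d.finite
  refine ⟨S, hScard, fun k J hJ => ?_⟩
  have hg := d.curveSystem hc hVP hCP (fun w hw => hQP _ (hcQ w hw)) hPV
  obtain ⟨r, R₀, hR⟩ := hg.exists_radii
  obtain ⟨R, ρ, hF⟩ := exists_frame hg.cont (hR.pos.trans hR.lt) (hQP z hzQ)
    (fun i t ht => re_le hc (fun p hp => hzmax hp) i ht) fun p hp => hzmax (hPV p hp)
  obtain ⟨N, a, anc, hN, hT, hVN⟩ := IsGrown.exists_tree (F := Sum.inl '' (S : Set E) ∪ range Sum.inr) hg hR hF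
    (V := V) fun N _ hzN hcl w hw => d.mem_of_closed hc hVP (fun w hw => hQP _ (hcQ w hw)) hz (hQP z hzQ)
      (S := S) he (hQS z hzQ) (fun w hw => hQS _ (hcQ w hw)) hzN hcl hw
  have hend : ∀ p ∈ V, p ∈ curveUnion f → (sphere p r ∩ (far R ∪ strands a N)).ncard ≤ 6 * V.ncard + 5 := by
    intro p hpV hpK
    refine (hN.ncard_sphere_le hg hR hF (hVP hpV)).trans ?_
    have h1 := d.ncard_passages_le hc S hpK (Q := S ×ˢ {0, 1}) fun x hx ht hxp => Finset.mem_product.2 ⟨hx, by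
      simpa using eq_zero_or_one ht fun h => d.interior _ _ h (hxp ▸ hpV)⟩
    have h2 : (S ×ˢ ({0, 1} : Finset ℝ)).card ≤ S.card * 2 := by
      rw [Finset.card_product]
      exact Nat.mul_le_mul le_rfl Finset.card_le_two
    omega
  have hmid : ∀ h ∉ S, ∀ t ∈ Ioo (0 : ℝ) 1, f h t ∈ P → (sphere (f h t) r ∩ (far R ∪ strands a N)).ncard ≤
      (2 * V.ncard + 3) * (C.filter fun p => p.1 = (h, t) ∧ p.2.1 ∈ S).card := by
    intro h hh t ht hP
    have hK : f h t ∈ curveUnion f := mem_curveUnion h (Ioo_subset_Icc_self ht)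
    have hq : ∀ x : E × ℝ, x.1 ∈ (S : Set E) → x.2 ∈ Icc 0 1 → f x.1 x.2 = f h t →
        ((h, t), x) ∈ C.filter fun p => p.1 = (h, t) ∧ p.2.1 ∈ S := by
      intro x hx hxt hxp
      refine Finset.mem_filter.2 ⟨(d.mem_crossings _).2 ⟨?_, ht, ?_, hxp.symm⟩, rfl, hx⟩
      · intro heq
        have hxh : x.1 = h := (congrArg Prod.fst heq).symm
        exact hh (hxh ▸ hx)
      · by_contra hn
        exact d.interior h t ht (hxp ▸ d.mem_of_notMem_Ioo _ hxt hn)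
    rcases Nat.eq_zero_or_pos (C.filter fun p => p.1 = (h, t) ∧ p.2.1 ∈ S).card with h0 | h0
    · have hQn : ∀ x ∈ Q, x ≠ f h t := by
        rintro x hx rfl
        obtain ⟨s, hs, hse⟩ := he _ hK
        have := hq (e (f h t), s) (hQS _ hx) hs hse
        rw [Finset.card_eq_zero.1 h0] at this
        exact Finset.notMem_empty _ this
      rw [hN.sphere_eq_empty hR hF hP (hQn z hzQ).symm ?_]
      · simp
      · refine subset_empty_iff.1 ((passages_subset hc S hK).trans ?_)
        rintro - (⟨x, ⟨hx, hxt, hxp⟩, rfl⟩ | ⟨w, hw, rfl⟩)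
        · have := hq x hx hxt hxp
          rw [Finset.card_eq_zero.1 h0] at this
          exact Finset.notMem_empty _ this
        · exact hQn _ (hcQ w w.2) hw
    · refine (hN.ncard_sphere_le hg hR hF hP).trans ?_
      have h1 := d.ncard_passages_le hc S hK (Q := (C.filter fun p => p.1 = (h, t) ∧ p.2.1 ∈ S).image Prod.snd)
        fun x hx hxt hxp => Finset.mem_image.2 ⟨_, hq x hx hxt hxp, rfl⟩
      have h2 := h1.trans (Nat.add_le_add_right Finset.card_image_le _)
      nlinarith
  have hfin : ∀ h, {t ∈ Icc (0 : ℝ) 1 | f h t ∈ P}.Finite := fun h => hg.finite (.inl h)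
  rw [← Finset.card_map (Function.Embedding.inl (α := E) (β := ↥(V \ curveUnion f)))]
  have hmap : ∀ {p : E ⊕ ↥(V \ curveUnion f) → Prop}, (∀ h ∈ J, p (.inl h)) → ∀ i ∈ J.map Function.Embedding.inl, p i := by
    intro p hp i hi
    obtain ⟨h, hh, rfl⟩ := Finset.mem_map.1 hi
    exact hp h hh
  refine card_le_of_words hg hR hF hN hT hVN d.finite d.source_mem d.target_mem _ (hmap fun h hh => ?_)
    (hmap fun h _ => d.source h) (hmap fun h _ => d.target h) (hmap fun h _ => d.interior h)
    (hmap fun h _ => hmap fun h' _ hhh => hne h h' fun heq => hhh (heq ▸ rfl)) _ (hmap fun h hh => ?_)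
  · rintro (⟨x, hx, hxh⟩ | ⟨w, hw⟩)
    · exact (hJ h hh).1 (Sum.inl_injective hxh ▸ hx)
    · cases hw
  · let Z := (hfin h).toFinset.filter (· ∈ Ioo (0 : ℝ) 1)
    refine ⟨Z, fun x hx hxP => Finset.mem_filter.2 ⟨(hfin h).mem_toFinset.2 ⟨Ioo_subset_Icc_self hx, hxP⟩, hx⟩, ?_⟩
    have hsum : ∑ t ∈ Z, (sphere (withProbes f V U c (.inl h) t) r ∩ (far R ∪ strands a N)).ncard ≤ (2 * V.ncard + 3) * k := by
      calc _ ≤ ∑ t ∈ Z, (2 * V.ncard + 3) * (C.filter fun p => p.1 = (h, t) ∧ p.2.1 ∈ S).card :=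
            Finset.sum_le_sum fun t ht => by
              obtain ⟨h1, h2⟩ := Finset.mem_filter.1 ht
              exact hmid h (hJ h hh).1 t h2 ((hfin h).mem_toFinset.1 h1).2
        _ = (2 * V.ncard + 3) * ∑ t ∈ Z, (C.filter fun p => p.1 = (h, t) ∧ p.2.1 ∈ S).card := by
            rw [Finset.mul_sum]
        _ ≤ _ := by
            refine Nat.mul_le_mul le_rfl (le_trans ?_ (hJ h hh).2)
            rw [← Finset.card_biUnion]
            · refine Finset.card_le_card fun p hp => ?_
              obtain ⟨t, -, hp⟩ := Finset.mem_biUnion.1 hp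
              obtain ⟨hpC, hp1, hp2⟩ := Finset.mem_filter.1 hp
              exact Finset.mem_filter.2 ⟨hpC, by rw [hp1], hp2⟩
            · intro t _ t' _ hne
              refine Finset.disjoint_left.2 fun p hp hp' => hne ?_
              have := (Finset.mem_filter.1 hp).2.1.symm.trans (Finset.mem_filter.1 hp').2.1
              exact (Prod.mk.inj this).2
    have hU := hend U d.source_mem hUK
    have hW := hend W d.target_mem hWK
    omega

end CurveDrawing

end FewCrossings

section Counting

open Set

namespace CurveDrawing

variable {E : Type*} {f : E → ℝ → ℂ} {V : Set ℂ} {U W : ℂ} {C : Finset ((E × ℝ) × (E × ℝ))}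

theorem card_mul_le [Fintype E] [Nonempty E] [DecidableEq E] (d : CurveDrawing f V U W C)
    (hne : ∀ e e', e ≠ e' → ¬ HomotopicIn V (fun t => f e t) (fun t => f e' t)) {N M : ℕ}
    (hM : ∀ e, N * (C.filter fun p => p.2.1 = e).card ≤ M) (k : ℕ) :
    N * ((k + 1) * Fintype.card E) ≤ (V.ncard + 1) * M + N * ((k + 1) * (V.ncard + 1 +
      (3 * 2 ^ V.ncard + 1) ^ (12 * V.ncard + 10 + (2 * V.ncard + 3) * k))) := by
  obtain ⟨S, hS, hJ⟩ := d.exists_card_le hne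
  let cr : E → ℕ := fun h => (C.filter fun p => p.1.1 = h ∧ p.2.1 ∈ S).card
  let A := Finset.univ.filter fun h => h ∉ S ∧ cr h ≤ k
  let B := Finset.univ.filter fun h => k < cr h
  have hA := hJ k A fun h hh => (Finset.mem_filter.1 hh).2
  have hcard : Fintype.card E ≤ S.card + A.card + B.card := by
    rw [← Finset.card_univ]
    refine le_trans (Finset.card_le_card fun h _ => ?_) ((Finset.card_union_le (S ∪ A) B).trans
      (Nat.add_le_add_right (Finset.card_union_le S A) _))
    simp only [A, B, Finset.mem_union, Finset.mem_filter, Finset.mem_univ, true_and]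
    by_cases h1 : h ∈ S <;> by_cases h2 : cr h ≤ k <;> simp_all
  have hB : (k + 1) * B.card ≤ (C.filter fun p => p.2.1 ∈ S).card := by
    calc (k + 1) * B.card = ∑ _h ∈ B, (k + 1) := by rw [Finset.sum_const, smul_eq_mul, mul_comm]
      _ ≤ ∑ h ∈ B, cr h := Finset.sum_le_sum fun h hh => (Finset.mem_filter.1 hh).2
      _ = (B.biUnion fun h => C.filter fun p => p.1.1 = h ∧ p.2.1 ∈ S).card := by
        refine (Finset.card_biUnion fun h _ h' _ hne => Finset.disjoint_left.2 fun p hp hp' => hne ?_).symm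
        exact (Finset.mem_filter.1 hp).2.1.symm.trans (Finset.mem_filter.1 hp').2.1
      _ ≤ _ := Finset.card_le_card fun p hp => by
        obtain ⟨h, -, hp⟩ := Finset.mem_biUnion.1 hp
        exact Finset.mem_filter.2 ⟨(Finset.mem_filter.1 hp).1, (Finset.mem_filter.1 hp).2.2⟩
  have hSM : N * (C.filter fun p => p.2.1 ∈ S).card ≤ S.card * M := by
    have : (C.filter fun p => p.2.1 ∈ S) = S.biUnion fun e => C.filter fun p => p.2.1 = e := by
      ext p
      simp [and_comm]
    calc _ ≤ N * ∑ e ∈ S, (C.filter fun p => p.2.1 = e).card := by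
          rw [this]
          exact Nat.mul_le_mul le_rfl Finset.card_biUnion_le
      _ = ∑ e ∈ S, N * (C.filter fun p => p.2.1 = e).card := Finset.mul_sum ..
      _ ≤ ∑ _e ∈ S, M := Finset.sum_le_sum fun e _ => hM e
      _ = S.card * M := by rw [Finset.sum_const, smul_eq_mul]
  calc N * ((k + 1) * Fintype.card E) ≤ N * ((k + 1) * (V.ncard + 1 +
        (3 * 2 ^ V.ncard + 1) ^ (12 * V.ncard + 10 + (2 * V.ncard + 3) * k) + B.card)) := by
        gcongr
        omega
    _ = N * ((k + 1) * B.card) + N * ((k + 1) * (V.ncard + 1 +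
        (3 * 2 ^ V.ncard + 1) ^ (12 * V.ncard + 10 + (2 * V.ncard + 3) * k))) := by ring
    _ ≤ _ := by
        refine Nat.add_le_add_right ?_ _
        exact (Nat.mul_le_mul le_rfl hB).trans (hSM.trans (Nat.mul_le_mul hS le_rfl))

end CurveDrawing

namespace PlaneDrawing

variable {n m : ℕ}

/-- The set of ordered crossings of a drawing. -/
def crossings (D : PlaneDrawing n m) : Set ((Fin m × I) × (Fin m × I)) :=
  {p | p.1 ≠ p.2 ∧ p.1.2 ≠ 0 ∧ p.1.2 ≠ 1 ∧ p.2.2 ≠ 0 ∧ p.2.2 ≠ 1 ∧ D.f p.1.1 p.1.2 = D.f p.2.1 p.2.2}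

/-- The number of ordered crossings of a set `J` of parallel edges each having few crossings. -/
theorem card_mul_le (D : PlaneDrawing n m) (hD : D.NonHomotopic) (hC : D.crossings.Finite) {U W : ℂ}
    {J : Finset (Fin m)} (hJ : J.Nonempty) (hU : ∀ e ∈ J, D.f e 0 = U) (hW : ∀ e ∈ J, D.f e 1 = W) {N M : ℕ}
    (hM : ∀ e ∈ J, N * (hC.toFinset.filter fun p => p.2.1 = e).card ≤ M) (k : ℕ) :
    N * ((k + 1) * J.card) ≤ (n + 1) * M + N * ((k + 1) * (n + 1 +
      (3 * 2 ^ n + 1) ^ (12 * n + 10 + (2 * n + 3) * k))) := by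
  let f : J → ℝ → ℂ := fun e t => D.f e (projIcc 0 1 zero_le_one t)
  let φ : (J × ℝ) × (J × ℝ) → (Fin m × I) × (Fin m × I) := fun p =>
    ((p.1.1, projIcc 0 1 zero_le_one p.1.2), (p.2.1, projIcc 0 1 zero_le_one p.2.2))
  let C' : Set ((J × ℝ) × (J × ℝ)) := {p | p.1 ≠ p.2 ∧ p.1.2 ∈ Ioo (0 : ℝ) 1 ∧ p.2.2 ∈ Ioo (0 : ℝ) 1 ∧
    f p.1.1 p.1.2 = f p.2.1 p.2.2}
  have hproj : ∀ t ∈ Ioo (0 : ℝ) 1, projIcc (0 : ℝ) 1 zero_le_one t ≠ 0 ∧ projIcc (0 : ℝ) 1 zero_le_one t ≠ 1 := by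
    intro t ht
    rw [projIcc_of_mem zero_le_one (Ioo_subset_Icc_self ht)]
    exact ⟨fun h => ht.1.ne' (congrArg Subtype.val h), fun h => ht.2.ne (congrArg Subtype.val h)⟩
  have hinj : ∀ t ∈ Ioo (0 : ℝ) 1, ∀ s ∈ Ioo (0 : ℝ) 1, projIcc (0 : ℝ) 1 zero_le_one t = projIcc 0 1 zero_le_one s →
      t = s := fun t ht s hs he => by
    rw [projIcc_of_mem zero_le_one (Ioo_subset_Icc_self ht), projIcc_of_mem zero_le_one (Ioo_subset_Icc_self hs)] at he
    exact congrArg Subtype.val he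
  have hφ : ∀ p ∈ C', φ p ∈ D.crossings := by
    rintro ⟨⟨e, t⟩, e', t'⟩ ⟨hne, ht, ht', he⟩
    refine ⟨fun h => hne ?_, (hproj t ht).1, (hproj t ht).2, (hproj t' ht').1, (hproj t' ht').2, he⟩
    obtain ⟨h1, h2⟩ := Prod.mk.inj h
    exact Prod.ext (Subtype.ext h1) (hinj t ht t' ht' h2)
  have hφi : InjOn φ C' := by
    rintro ⟨⟨e₁, t₁⟩, e₁', t₁'⟩ ⟨-, ht₁, ht₁', -⟩ ⟨⟨e₂, t₂⟩, e₂', t₂'⟩ ⟨-, ht₂, ht₂', -⟩ h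
    simp only [φ, Prod.mk.injEq] at h
    obtain ⟨⟨h1, h2⟩, h3, h4⟩ := h
    obtain rfl := Subtype.ext h1
    obtain rfl := Subtype.ext h3
    obtain rfl := hinj t₁ ht₁ t₂ ht₂ h2
    obtain rfl := hinj t₁' ht₁' t₂' ht₂' h4
    rfl
  have hC' : C'.Finite := Finite.of_injOn hφ hφi hC
  obtain ⟨e₀, he₀⟩ := hJ
  have : Nonempty J := ⟨⟨e₀, he₀⟩⟩
  have d : CurveDrawing f D.V U W hC'.toFinset :=
    { cont := fun e => (D.cont e).comp continuous_projIcc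
      finite := D.finV
      source_mem := hU e₀ he₀ ▸ D.source_mem e₀
      target_mem := hW e₀ he₀ ▸ D.target_mem e₀
      source := fun e => by simpa [f] using hU e e.2
      target := fun e => by simpa [f] using hW e e.2
      interior := fun e t ht => D.interior_not_mem e _ (hproj t ht).1 (hproj t ht).2
      mem_crossings := fun p => hC'.mem_toFinset }
  have := d.card_mul_le (N := N) (M := M) (fun e e' hne hh => hD.1 e e' (fun h => hne (Subtype.ext h)) (Or.inl ?_))
    (fun e => le_trans (Nat.mul_le_mul le_rfl ?_) (hM e e.2)) k
  · rwa [Fintype.card_coe, D.cardV] at this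
  · simpa [f, projIcc_val] using hh
  · refine Finset.card_le_card_of_injOn φ (fun p hp => ?_) fun p hp q hq h => ?_
    · obtain ⟨h1, h2⟩ := Finset.mem_filter.1 hp
      exact Finset.mem_filter.2 ⟨hC.mem_toFinset.2 (hφ p (hC'.mem_toFinset.1 h1)), congrArg Subtype.val h2⟩
    · exact hφi (hC'.mem_toFinset.1 (Finset.mem_filter.1 hp).1) (hC'.mem_toFinset.1 (Finset.mem_filter.1 hq).1) h

/-- Many parallel edges force many crossings. -/
theorem sq_mul_le_ncard_crossings (D : PlaneDrawing n m) (hD : D.NonHomotopic) (hC : D.crossings.Finite) {U W : ℂ}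
    {J : Finset (Fin m)} (hU : ∀ e ∈ J, D.f e 0 = U) (hW : ∀ e ∈ J, D.f e 1 = W) {k : ℕ}
    (hn : 8 * (n + 1) ≤ J.card) (hk : 8 * (3 * 2 ^ n + 1) ^ (12 * n + 10 + (2 * n + 3) * k) ≤ J.card) :
    J.card ^ 2 * (k + 1) ≤ 8 * (n + 1) * D.crossings.ncard := by
  set N := J.card with hN
  set X := D.crossings.ncard with hX
  let deg : Fin m → ℕ := fun e => (hC.toFinset.filter fun p => p.2.1 = e).card
  let J' := J.filter fun e => N * deg e ≤ 2 * X
  have hdeg : ∑ e ∈ J, deg e ≤ X := by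
    rw [hX, ncard_eq_toFinset_card _ hC, ← Finset.card_biUnion]
    · exact Finset.card_le_card fun p hp => by
        obtain ⟨e, -, hp⟩ := Finset.mem_biUnion.1 hp
        exact (Finset.mem_filter.1 hp).1
    · exact fun e _ e' _ hne => Finset.disjoint_left.2 fun p hp hp' =>
        hne ((Finset.mem_filter.1 hp).2.symm.trans (Finset.mem_filter.1 hp').2)
  have hJ' : N ≤ 2 * J'.card := by
    have h1 : (J.filter fun e => ¬ N * deg e ≤ 2 * X).card * (2 * X + 1) ≤ N * X := by
      calc _ = ∑ _e ∈ J.filter fun e => ¬ N * deg e ≤ 2 * X, (2 * X + 1) := by rw [Finset.sum_const, smul_eq_mul]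
        _ ≤ ∑ e ∈ J.filter fun e => ¬ N * deg e ≤ 2 * X, N * deg e :=
          Finset.sum_le_sum fun e he => Nat.lt_of_not_le (Finset.mem_filter.1 he).2
        _ ≤ ∑ e ∈ J, N * deg e := Finset.sum_le_sum_of_subset (Finset.filter_subset _ _)
        _ = N * ∑ e ∈ J, deg e := (Finset.mul_sum ..).symm
        _ ≤ N * X := Nat.mul_le_mul le_rfl hdeg
    have h2 : J'.card + _ = N := Finset.card_filter_add_card_filter_not (s := J) fun e => N * deg e ≤ 2 * X
    by_contra! hlt
    have h3 : N < 2 * (J.filter fun e => ¬ N * deg e ≤ 2 * X).card := by omega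
    nlinarith
  have hpos : J'.Nonempty := Finset.card_pos.1 (by omega)
  have := D.card_mul_le hD hC hpos (fun e he => hU e (Finset.mem_filter.1 he).1)
    (fun e he => hW e (Finset.mem_filter.1 he).1) (fun e he => (Finset.mem_filter.1 he).2) k
  set T := (3 * 2 ^ n + 1) ^ (12 * n + 10 + (2 * n + 3) * k)
  have h5 : N * ((k + 1) * (N + 4 * (n + 1 + T))) ≤ N * ((k + 1) * (4 * J'.card)) := by
    gcongr
    omega
  nlinarith

end PlaneDrawing

end Counting

section Asymptotics

open Filter

theorem eventually_add_mul_rpow_le (A C : ℝ) {s : ℝ} (hs : s < 1) : ∀ᶠ x : ℝ in atTop, A + C * x ^ s ≤ x := by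
  have h1 : Tendsto (fun x : ℝ => C * x ^ (-(1 - s))) atTop (nhds (C * 0)) :=
    (tendsto_rpow_neg_atTop (by linarith)).const_mul C
  rw [mul_zero] at h1
  filter_upwards [h1.eventually (eventually_le_nhds (show (0 : ℝ) < 1 / 2 by norm_num)), eventually_ge_atTop (2 * A),
    eventually_gt_atTop 0] with x hx hA h0
  have : x ^ s = x ^ (-(1 - s)) * x := by
    rw [← Real.rpow_add_one h0.ne']
    congr 1
    ring
  rw [this]
  nlinarith

theorem eventually_mul_pow_floor_le {A B : ℝ} (hA : 0 < A) (hB : 1 ≤ B) (a b : ℕ) (K : ℝ) {s : ℝ} (hs : s < 1) :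
    ∀ᶠ m : ℕ in atTop, A * B ^ (a + b * ⌊K * Real.log m ^ s⌋₊) ≤ m := by
  have hlog := Real.tendsto_log_atTop.comp (tendsto_natCast_atTop_atTop (R := ℝ))
  filter_upwards [hlog.eventually (eventually_add_mul_rpow_le (Real.log A + a * Real.log B) (b * |K| * Real.log B) hs),
    hlog.eventually (eventually_ge_atTop 0), eventually_gt_atTop 0] with m hm hl hm0
  simp only [Function.comp_apply] at hm hl
  have hm0' : (0 : ℝ) < m := by exact_mod_cast hm0
  have hB0 : 0 < B := by linarith
  rw [← Real.log_le_log_iff (by positivity) hm0', Real.log_mul hA.ne' (by positivity), Real.log_pow]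
  refine le_trans ?_ hm
  have hl' : 0 ≤ Real.log m ^ s := Real.rpow_nonneg hl s
  have hf : (⌊K * Real.log m ^ s⌋₊ : ℝ) ≤ |K| * Real.log m ^ s := by
    refine le_trans (by exact_mod_cast Nat.floor_mono (mul_le_mul_of_nonneg_right (le_abs_self K) hl')) (Nat.floor_le ?_)
    positivity
  have hlB := Real.log_nonneg hB
  push_cast
  nlinarith [mul_le_mul_of_nonneg_left hf (mul_nonneg (Nat.cast_nonneg (α := ℝ) b) hlB)]

end Asymptotics

namespace PlaneDrawing

/-- Some pair of vertices is joined by many edges. -/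
theorem exists_parallel {n m : ℕ} (D : PlaneDrawing n m) (hn : 0 < n) : ∃ (U W : ℂ) (J : Finset (Fin m)),
    (∀ e ∈ J, D.f e 0 = U) ∧ (∀ e ∈ J, D.f e 1 = W) ∧ m ≤ n ^ 2 * J.card := by
  classical
  have hcard : D.finV.toFinset.card = n := by rw [← Set.ncard_eq_toFinset_card _ D.finV, D.cardV]
  obtain ⟨p, -, hp⟩ := Finset.exists_le_card_fiber_of_nsmul_le_card_of_maps_to (s := Finset.univ)
    (t := D.finV.toFinset ×ˢ D.finV.toFinset) (f := fun e => (D.f e 0, D.f e 1)) (b := (m / n ^ 2 : ℝ))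
    (fun e _ => by simp [D.source_mem, D.target_mem])
    (Finset.card_pos.1 (by rw [Finset.card_product, hcard]; positivity))
    (by
      rw [Finset.card_product, hcard, nsmul_eq_mul]
      push_cast
      rw [← sq, mul_div_cancel₀ _ (by positivity), Finset.card_univ, Fintype.card_fin])
  refine ⟨p.1, p.2, Finset.univ.filter fun e => (D.f e 0, D.f e 1) = p, fun e he => ?_, fun e he => ?_, ?_⟩
  · rw [← (Finset.mem_filter.1 he).2]
  · rw [← (Finset.mem_filter.1 he).2]
  · rw [div_le_iff₀ (by positivity)] at hp
    rw [mul_comm]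
    exact_mod_cast hp

theorem crossingNumber_eq_top {n m : ℕ} (D : PlaneDrawing n m) (h : D.crossings.Infinite) : D.crossingNumber = ⊤ := by
  change ((D.crossings.encard : ℕ∞) : ℝ≥0∞) / 2 = ⊤
  rw [h.encard_eq]
  simp [ENNReal.top_div]

theorem ofReal_le_crossingNumber {n m : ℕ} (D : PlaneDrawing n m) (h : D.crossings.Finite) {x : ℝ}
    (hx : x ≤ D.crossings.ncard / 2) : ENNReal.ofReal x ≤ D.crossingNumber := by
  change _ ≤ ((D.crossings.encard : ℕ∞) : ℝ≥0∞) / 2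
  rw [← h.cast_ncard_eq]
  refine (ENNReal.ofReal_le_ofReal hx).trans_eq ?_
  rw [ENNReal.ofReal_div_of_pos two_pos]
  simp

end PlaneDrawing

/-- There is a constant `c > 0` such that for every `n ≥ 2` and all
sufficiently large `m`, every non-homotopic drawing in the plane with `n` vertices and
`m` edges has crossing number at least `c · m² · (log m)^(1/(6n)) / n⁷`. -/
theorem crossing_number_superquadratic_quantitative :
    ∃ c : ℝ, 0 < c ∧ ∀ n : ℕ, 2 ≤ n → ∃ M : ℕ, ∀ m : ℕ, M ≤ m →
      ∀ D : PlaneDrawing n m, D.NonHomotopic →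
        ENNReal.ofReal (c * (m : ℝ) ^ 2 * (Real.log m) ^ ((1 : ℝ) / (6 * n)) / (n : ℝ) ^ 7)
          ≤ D.crossingNumber := by
  refine ⟨1, one_pos, fun n hn => ?_⟩
  have hn2 : (2 : ℝ) ≤ n := by exact_mod_cast hn
  have hs : (1 : ℝ) / (6 * n) < 1 := by
    rw [div_lt_one (by positivity)]
    linarith
  have hB : (1 : ℝ) ≤ 3 * 2 ^ n + 1 := by linarith [pow_pos (two_pos (α := ℝ)) n]
  obtain ⟨M, hM⟩ := Filter.eventually_atTop.1 ((eventually_mul_pow_floor_le (A := 8 * n ^ 2) (by positivity) hB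
    (12 * n + 10) (2 * n + 3) (16 * (n + 1)) hs).and (Filter.eventually_ge_atTop (8 * (n + 1) * n ^ 2 + 1)))
  refine ⟨M, fun m hm D hD => ?_⟩
  obtain ⟨h1, h2⟩ := hM m hm
  by_cases hC : D.crossings.Finite
  swap
  · rw [D.crossingNumber_eq_top hC]
    exact le_top
  refine D.ofReal_le_crossingNumber hC ?_
  obtain ⟨U, W, J, hU, hW, hJ⟩ := D.exists_parallel (by omega)
  set k := ⌊16 * ((n : ℝ) + 1) * Real.log m ^ ((1 : ℝ) / (6 * n))⌋₊
  have h1' : n ^ 2 * (8 * (3 * 2 ^ n + 1) ^ (12 * n + 10 + (2 * n + 3) * k)) ≤ m := by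
    have : ((n ^ 2 * (8 * (3 * 2 ^ n + 1) ^ (12 * n + 10 + (2 * n + 3) * k)) : ℕ) : ℝ) ≤ m := by
      refine le_trans (le_of_eq ?_) h1
      push_cast
      ring
    exact_mod_cast this
  have hn0 : 0 < n ^ 2 := by positivity
  have key := D.sq_mul_le_ncard_crossings hD hC hU hW (k := k)
    (Nat.le_of_mul_le_mul_left (by linarith) hn0) (Nat.le_of_mul_le_mul_left (h1'.trans hJ) hn0)
  have key' : (J.card : ℝ) ^ 2 * (k + 1) ≤ 8 * (n + 1) * D.crossings.ncard := by exact_mod_cast key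
  have hJ' : (m : ℝ) ≤ n ^ 2 * J.card := by exact_mod_cast hJ
  have hfl := (Nat.lt_floor_add_one (16 * ((n : ℝ) + 1) * Real.log m ^ ((1 : ℝ) / (6 * n)))).le
  have hl : 0 ≤ Real.log m ^ ((1 : ℝ) / (6 * n)) := Real.rpow_nonneg (Real.log_natCast_nonneg m) _
  set l := Real.log m ^ ((1 : ℝ) / (6 * n))
  have hX : (J.card : ℝ) ^ 2 * l ≤ D.crossings.ncard / 2 := by
    have h3 := (mul_le_mul_of_nonneg_left hfl (sq_nonneg (J.card : ℝ))).trans key'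
    have h4 : (0 : ℝ) < 16 * (n + 1) := by positivity
    refine le_of_mul_le_mul_left ?_ h4
    linarith
  refine le_trans ?_ hX
  rw [one_mul, div_le_iff₀ (by positivity)]
  have h5 : (m : ℝ) ^ 2 ≤ (n ^ 2 * J.card) ^ 2 := by gcongr
  have h6 : (n : ℝ) ^ 4 ≤ n ^ 7 := pow_le_pow_right₀ (by linarith) (by norm_num)
  calc (m : ℝ) ^ 2 * l ≤ (n ^ 2 * J.card) ^ 2 * l := by gcongr
    _ = (J.card : ℝ) ^ 2 * l * n ^ 4 := by ring
    _ ≤ _ := by gcongr
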